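/- Let B = B(0,1) ⊂ ℝ^d and let A : B → ℝ^{d×d} be measurable with λ|ξ|² ≤ A(x)ξ·ξ for all ξ ∈ ℝ^d and ∑_{i,j}|a^{ij}(x)|² ≤ Λ² for all x ∈ B, where λ, Λ > 0, and suppose its mean oscillation satisfies ω_A(r) ≤ c₀ (ln(1/r))^{−2} for all r ∈ (0,1/2), with c₀ > 0. Let f : ℝ^d → ℝ^d be smooth and supported in B(0,1/3). Suppose u is continuously differentiable on B, continuous on B̄, u = 0 on ∂B, ∇u is square integrable on B, and ∫_B (A∇u)·∇φ = ∫_B f·∇φ for every φ ∈ C_c^∞(B). Then for every α > 0, the Lebesgue measure of {x ∈ B : |∇u(x)| > α} is at most (C/α) ∫_B |f| dx, where C depends only on d, λ, Λ and c₀. -/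

import Mathlib

open MeasureTheory Metric Matrix Set

/-- Mean oscillation over `B = B(0,1)`:
`ω_A(r) = sup_{x ∈ B} ⨍_{B(x,r) ∩ B} |A − Ā_{B(x,r) ∩ B}|`. -/
noncomputable def meanOscB {d : ℕ} {F : Type*} [NormedAddCommGroup F] [NormedSpace ℝ F]
    (h : EuclideanSpace ℝ (Fin d) → F) (r : ℝ) : ℝ :=
  ⨆ x ∈ ball (0 : EuclideanSpace ℝ (Fin d)) 1,
    ⨍ y in ball x r ∩ ball (0 : EuclideanSpace ℝ (Fin d)) 1,
      ‖h y - ⨍ z in ball x r ∩ ball (0 : EuclideanSpace ℝ (Fin d)) 1, h z‖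

/-- The gradient of `u`, as a vector in `ℝ^d`. -/
noncomputable def grad {d : ℕ} (u : EuclideanSpace ℝ (Fin d) → ℝ)
    (x : EuclideanSpace ℝ (Fin d)) : Fin d → ℝ :=
  fun i => fderiv ℝ u x (EuclideanSpace.single i 1)

section Work

open scoped ContDiff Gradient RealInnerProductSpace Topology
open Filter

variable {E : Type*} [NormedAddCommGroup E] [InnerProductSpace ℝ E] [FiniteDimensional ℝ E]
  [MeasurableSpace E] [BorelSpace E]

/-- A mollifier `η` adapted to the constant coefficient operator `div (M ∇ ·)`: its first moment
`η z • z` is the flux `M ∇Ψ` (up to the antisymmetric part of `M`) of a compactly supported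
function `Ψ`. -/
structure IsAdaptedKernel (C : ℝ) (M : E →L[ℝ] E) (η Ψ : E → ℝ) : Prop where
  contDiff_η : ContDiff ℝ ∞ η
  contDiff_Ψ : ContDiff ℝ ∞ Ψ
  η_eq_zero : ∀ z, 1 / 8 ≤ ‖z‖ → η z = 0
  Ψ_eq_zero : ∀ z, 1 / 8 ≤ ‖z‖ → Ψ z = 0
  integral_η : ∫ z, η z = 1
  η_nonneg : ∀ z, 0 ≤ η z
  η_le : ∀ z, η z ≤ C
  norm_gradient_Ψ_le : ∀ z, ‖∇ Ψ z‖ ≤ C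
  norm_fderiv_η_le : ∀ z, ‖fderiv ℝ η z‖ ≤ C
  taylor_η : ∀ z h, |η (z + h) - η z - fderiv ℝ η z h| ≤ C * ‖h‖ ^ 2
  flux : ∀ z, M (∇ Ψ z) + ContinuousLinearMap.adjoint M (∇ Ψ z) = (2 * η z) • z

/-- A smooth profile on the line together with a primitive vanishing on the same half-line. -/
theorem exists_profile : ∃ (g G : ℝ → ℝ) (B : ℝ), 0 < B ∧ ContDiff ℝ ∞ g ∧ ContDiff ℝ ∞ G ∧
    (∀ t, HasDerivAt G (g t) t) ∧ (∀ t, 1 ≤ t → g t = 0) ∧ (∀ t, 1 ≤ t → G t = 0) ∧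
    (∀ t, 0 ≤ g t) ∧ (∀ t, g t ≤ 1) ∧ (∀ t, t ≤ 1 / 2 → 1 / B ≤ g t) ∧
    (∀ t, |deriv g t| ≤ B) ∧ (∀ s t, |g (s + t) - g s - deriv g s * t| ≤ B * t ^ 2) := by
  set g : ℝ → ℝ := fun t => Real.smoothTransition (1 - t) with hg
  have hgs : ContDiff ℝ ∞ g := Real.smoothTransition.contDiff.comp (contDiff_const.sub contDiff_id)
  have hgd : ∀ t, DifferentiableAt ℝ g t := fun t => (hgs.differentiable (by simp)) t
  have hg0 : ∀ t, 1 ≤ t → g t = 0 := fun t ht =>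
    Real.smoothTransition.zero_of_nonpos (by linarith)
  have hg1 : ∀ t, t ≤ 0 → g t = 1 := fun t ht =>
    Real.smoothTransition.one_of_one_le (by linarith)
  have hd1 : ContDiff ℝ ∞ (deriv g) := ((contDiff_infty_iff_deriv).1 hgs).2
  have hd2 : ContDiff ℝ ∞ (deriv (deriv g)) := ((contDiff_infty_iff_deriv).1 hd1).2
  have hsupp : ∀ t, t ∉ Icc (0 : ℝ) 1 → deriv g t = 0 := by
    intro t ht
    have : (t < 0) ∨ (1 < t) := by
      by_contra! h
      exact ht ⟨h.1, h.2⟩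
    rcases this with h | h
    · have : g =ᶠ[𝓝 t] fun _ => 1 := by
        filter_upwards [Iio_mem_nhds h] with s hs using hg1 s hs.le
      rw [this.deriv_eq]; simp
    · have : g =ᶠ[𝓝 t] fun _ => 0 := by
        filter_upwards [Ioi_mem_nhds h] with s hs using hg0 s hs.le
      rw [this.deriv_eq]; simp
  have hc1 : HasCompactSupport (deriv g) := HasCompactSupport.intro isCompact_Icc hsupp
  have hc2 : HasCompactSupport (deriv (deriv g)) := hc1.deriv
  obtain ⟨B1, hB1⟩ := hc1.exists_bound_of_continuous hd1.continuous
  obtain ⟨B2, hB2⟩ := hc2.exists_bound_of_continuous hd2.continuous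
  have hB1' : 0 ≤ B1 := (norm_nonneg _).trans (hB1 0)
  have hB2' : 0 ≤ B2 := (norm_nonneg _).trans (hB2 0)
  have hpos : 0 < g (1 / 2) := Real.smoothTransition.pos_of_pos (by norm_num)
  have hanti : Antitone g := fun a b hab => Real.smoothTransition.monotone (by linarith)
  have hG : ∀ t, HasDerivAt (fun t => ∫ s in (1 : ℝ)..t, g s) (g t) t := fun t =>
    intervalIntegral.integral_hasDerivAt_right (hgs.continuous.intervalIntegrable _ _)
      hgs.continuous.aestronglyMeasurable.stronglyMeasurableAtFilter hgs.continuous.continuousAt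
  refine ⟨g, fun t => ∫ s in (1 : ℝ)..t, g s, B1 + B2 + 1 / g (1 / 2), by positivity, hgs, ?_, hG,
    hg0, ?_, fun t => Real.smoothTransition.nonneg _, fun t => Real.smoothTransition.le_one _, ?_,
    ?_, ?_⟩
  · rw [contDiff_infty_iff_deriv]
    refine ⟨fun t => (hG t).differentiableAt, ?_⟩
    have : deriv (fun t => ∫ s in (1 : ℝ)..t, g s) = g := funext fun t => (hG t).deriv
    rwa [this]
  · intro t ht
    refine intervalIntegral.integral_zero_ae (ae_of_all _ fun s hs => ?_)
    rw [uIoc_of_le ht] at hs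
    exact hg0 s hs.1.le
  · intro t ht
    refine le_trans ?_ (hanti ht)
    rw [div_le_iff₀ (by positivity)]
    have : g (1 / 2) * (1 / g (1 / 2)) = 1 := by field_simp
    nlinarith
  · intro t
    have := hB1 t
    rw [Real.norm_eq_abs] at this
    have : 0 ≤ 1 / g (1 / 2) := by positivity
    linarith
  · intro s t
    have hlip : ∀ x y, |deriv g x - deriv g y| ≤ B2 * |x - y| := by
      intro x y
      have := Convex.norm_image_sub_le_of_norm_deriv_le (f := deriv g) (s := univ) (C := B2)
        (x := y) (y := x)
        (fun z _ => (hd1.differentiable (by simp)) z) (fun z _ => hB2 z) convex_univ trivial trivial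
      simpa [Real.norm_eq_abs] using this
    have key := Convex.norm_image_sub_le_of_norm_deriv_le
      (f := fun x => g (s + x) - deriv g s * x) (s := Icc (-|t|) |t|) (C := B2 * |t|)
      (x := 0) (y := t) ?_ ?_ (convex_Icc _ _) ⟨by simp, by simp⟩
      ⟨neg_abs_le t, le_abs_self t⟩
    · simp only [add_zero, mul_zero, sub_zero, Real.norm_eq_abs] at key
      have h2 : B2 * |t| * |t| = B2 * t ^ 2 := by rw [mul_assoc, abs_mul_abs_self]; ring
      rw [h2] at key
      have h3 : g (s + t) - g s - deriv g s * t = g (s + t) - deriv g s * t - g s := by ring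
      rw [h3]
      refine key.trans (mul_le_mul_of_nonneg_right ?_ (sq_nonneg t))
      have : 0 ≤ 1 / g (1 / 2) := by positivity
      linarith
    · intro x _
      exact ((hgd _).comp x (by fun_prop)).sub (by fun_prop)
    · intro x hx
      have h1 : HasDerivAt (fun x => g (s + x)) (deriv g (s + x)) x := by
        simpa using (hgd (s + x)).hasDerivAt.comp_const_add s x
      have h2 : HasDerivAt (fun x => g (s + x) - deriv g s * x)
          (deriv g (s + x) - deriv g s) x := by
        have := h1.sub ((hasDerivAt_id x).const_mul (deriv g s))
        rw [mul_one] at this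
        exact this
      rw [h2.deriv, Real.norm_eq_abs]
      refine (hlip _ _).trans ?_
      have : |x| ≤ |t| := abs_le.2 hx
      simpa using mul_le_mul_of_nonneg_left this hB2'

/-- The inverse of the symmetric part of a coercive operator. -/
theorem exists_inverse_symmetric_part {l L : ℝ} (hl : 0 < l) (hL : 0 < L) (M : E →L[ℝ] E)
    (hM : ∀ x, l * ‖x‖ ^ 2 ≤ ⟪M x, x⟫) (hML : ‖M‖ ≤ L) :
    ∃ N : E →L[ℝ] E, (∀ z, M (N z) + ContinuousLinearMap.adjoint M (N z) = (2 : ℝ) • z) ∧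
      (∀ x y, ⟪N x, y⟫ = ⟪x, N y⟫) ∧ (∀ z, l * ‖N z‖ ≤ ‖z‖) ∧
      ∀ z, l / L ^ 2 * ‖z‖ ^ 2 ≤ ⟪N z, z⟫ := by
  set S : E →L[ℝ] E := (1 / 2 : ℝ) • (M + ContinuousLinearMap.adjoint M) with hS
  have hSapp : ∀ x, (2 : ℝ) • S x = M x + ContinuousLinearMap.adjoint M x := by
    intro x; simp [hS]
  have hSs : ∀ x y, ⟪S x, y⟫ = ⟪x, S y⟫ := by
    intro x y
    simp only [hS, _root_.smul_apply, _root_.add_apply, inner_smul_left, inner_smul_right,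
      inner_add_left, inner_add_right, ContinuousLinearMap.adjoint_inner_left,
      ContinuousLinearMap.adjoint_inner_right]
    simp; ring
  have hSc : ∀ x, l * ‖x‖ ^ 2 ≤ ⟪S x, x⟫ := by
    intro x
    have : ⟪S x, x⟫ = ⟪M x, x⟫ := by
      simp only [hS, _root_.smul_apply, _root_.add_apply, inner_smul_left, inner_add_left,
        ContinuousLinearMap.adjoint_inner_left, real_inner_comm x (M x)]
      simp; ring
    rw [this]; exact hM x
  have hSL : ∀ x, ‖S x‖ ≤ L * ‖x‖ := by
    intro x
    have h1 : ‖M x‖ ≤ L * ‖x‖ := M.le_of_opNorm_le hML x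
    have h2 : ‖ContinuousLinearMap.adjoint M x‖ ≤ L * ‖x‖ :=
      (ContinuousLinearMap.adjoint M).le_of_opNorm_le
        (by rwa [LinearIsometryEquiv.norm_map]) x
    have h3 : ‖(2 : ℝ) • S x‖ ≤ L * ‖x‖ + L * ‖x‖ := by
      rw [hSapp]; exact (norm_add_le _ _).trans (add_le_add h1 h2)
    rw [norm_smul] at h3
    norm_num at h3
    linarith
  have hinj : Function.Injective (S : E →ₗ[ℝ] E) := by
    rw [injective_iff_map_eq_zero]
    intro x hx
    have h1 := hSc x
    have hx' : S x = 0 := hx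
    rw [hx', inner_zero_left] at h1
    have : ‖x‖ ^ 2 ≤ 0 := by nlinarith [sq_nonneg ‖x‖]
    simpa using le_antisymm this (sq_nonneg _)
  set e := LinearEquiv.ofInjectiveEndo (S : E →ₗ[ℝ] E) hinj with he
  set N : E →L[ℝ] E := LinearMap.toContinuousLinearMap (e.symm : E →ₗ[ℝ] E) with hN
  have hSN : ∀ z, S (N z) = z := by
    intro z
    have h : e (e.symm z) = z := e.apply_symm_apply z
    exact h
  have hNl : ∀ z, l * ‖N z‖ ≤ ‖z‖ := by
    intro z
    have h1 := hSc (N z)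
    rw [hSN] at h1
    have h2 := real_inner_le_norm z (N z)
    rcases eq_or_lt_of_le (norm_nonneg (N z)) with h | h
    · rw [← h]; simp
    · nlinarith
  refine ⟨N, fun z => ?_, fun x y => ?_, hNl, fun z => ?_⟩
  · rw [← hSapp, hSN]
  · calc ⟪N x, y⟫ = ⟪N x, S (N y)⟫ := by rw [hSN]
      _ = ⟪S (N x), N y⟫ := (hSs _ _).symm
      _ = ⟪x, N y⟫ := by rw [hSN]
  · have h1 := hSc (N z)
    rw [hSN, real_inner_comm] at h1
    have h2 := hSL (N z)
    rw [hSN] at h2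
    refine le_trans ?_ h1
    rw [div_mul_eq_mul_div, div_le_iff₀ (by positivity)]
    have : ‖z‖ ^ 2 ≤ (L * ‖N z‖) ^ 2 := by gcongr
    nlinarith

set_option maxHeartbeats 1600000 in
/-- Adapted kernels exist for all coercive operators, with a constant depending only on the
dimension, the coercivity constant and the norm bound. -/
theorem exists_isAdaptedKernel (E : Type*) [NormedAddCommGroup E] [InnerProductSpace ℝ E]
    [FiniteDimensional ℝ E] [MeasurableSpace E] [BorelSpace E] {l L : ℝ} (hl : 0 < l)
    (hL : 0 < L) :
    ∃ C : ℝ, 1 ≤ C ∧ ∀ M : E →L[ℝ] E, (∀ x, l * ‖x‖ ^ 2 ≤ ⟪M x, x⟫) → ‖M‖ ≤ L →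
      ∃ η Ψ : E → ℝ, IsAdaptedKernel C M η Ψ := by
  obtain ⟨g, G, B, hB, hgs, hGs, hGd, hg0, hG0, hgn, hg1, hglow, hgB, hgT⟩ := exists_profile
  set ν : ℝ := l / L ^ 2 with hν
  have hνpos : 0 < ν := by positivity
  set κ : ℝ := 64 / ν with hκ
  have hκpos : 0 < κ := by positivity
  set ρ : ℝ := Real.sqrt (l / (2 * κ)) with hρ
  have hρpos : 0 < ρ := Real.sqrt_pos.2 (by positivity)
  set m : ℝ := (volume (ball (0 : E) ρ)).toReal / B with hm
  have hmpos : 0 < m := div_pos (ENNReal.toReal_pos (measure_ball_pos _ _ hρpos).ne'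
    measure_ball_lt_top.ne) hB
  set C1 : ℝ := B * (κ / l) + B * (3 * κ / l) ^ 2 with hC1
  set C2 : ℝ := B * (2 * κ / l) with hC2
  have hC1n : 0 ≤ C1 := by positivity
  have hC2n : 0 ≤ C2 := by positivity
  refine ⟨1 + (1 / m) * (1 + 1 / l + C2 + (C1 + 64 * (1 + C2))), ?_, fun M hM hML => ?_⟩
  · have : 0 ≤ (1 / m) * (1 + 1 / l + C2 + (C1 + 64 * (1 + C2))) := by positivity
    linarith
  obtain ⟨N, hMN, hNs, hNl, hNlow⟩ := exists_inverse_symmetric_part hl hL M hM hML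
  have hNl' : ∀ z, ‖N z‖ ≤ ‖z‖ / l := fun z => by
    rw [le_div_iff₀ hl]; linarith [hNl z]
  set Q : E → ℝ := fun z => κ * ⟪N z, z⟫ with hQ
  have hQlow : ∀ z, 64 * ‖z‖ ^ 2 ≤ Q z := by
    intro z
    have := mul_le_mul_of_nonneg_left (hNlow z) hκpos.le
    have h2 : κ * (ν * ‖z‖ ^ 2) = 64 * ‖z‖ ^ 2 := by
      rw [hκ]; field_simp
    rw [← h2]; exact this
  have hQ1 : ∀ z, 1 / 8 ≤ ‖z‖ → 1 ≤ Q z := fun z hz => by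
    have := hQlow z
    nlinarith
  have hQs : ContDiff ℝ ∞ Q := contDiff_const.mul (N.contDiff.inner ℝ contDiff_id)
  have hQd : ∀ z, HasGradientAt Q ((2 * κ) • N z) z := by
    intro z
    rw [hasGradientAt_iff_hasFDerivAt]
    have h1 := ((N.hasFDerivAt (x := z)).inner ℝ (hasFDerivAt_id z)).const_mul κ
    refine h1.congr_fderiv ?_
    ext w
    simp only [_root_.smul_apply, ContinuousLinearMap.comp_apply, fderivInnerCLM_apply,
      ContinuousLinearMap.prod_apply, ContinuousLinearMap.id_apply, id_eq, smul_eq_mul,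
      InnerProductSpace.toDual_apply_apply, inner_smul_left, hNs w z, real_inner_comm (N z) w]
    simp
    ring
  have hQexp : ∀ z h, Q (z + h) = Q z + (2 * κ * ⟪N z, h⟫ + κ * ⟪N h, h⟫) := by
    intro z h
    simp only [hQ, map_add, inner_add_left, inner_add_right]
    rw [hNs h z, real_inner_comm (N z) h]; ring
  have hηd : ∀ z, HasFDerivAt (fun z => g (Q z)) (deriv g (Q z) • fderiv ℝ Q z) z := by
    intro z
    exact ((hgs.differentiable (by simp) (Q z)).hasDerivAt).comp_hasFDerivAt z
      (hQs.differentiable (by simp) z).hasFDerivAt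
  have hQf : ∀ z h, fderiv ℝ Q z h = 2 * κ * ⟪N z, h⟫ := by
    intro z h
    rw [← inner_gradient_left, (hQd z).gradient, inner_smul_left]; simp
  have hgz : ∀ z, 1 / 8 ≤ ‖z‖ → g (Q z) = 0 := fun z hz => hg0 _ (hQ1 z hz)
  have hgcont : Continuous fun z => g (Q z) := hgs.continuous.comp hQs.continuous
  have hgcs : HasCompactSupport fun z => g (Q z) :=
    HasCompactSupport.intro (isCompact_closedBall (0 : E) (1 / 8)) fun z hz => by
      apply hgz; simp at hz; linarith
  have hgint : Integrable fun z => g (Q z) := hgcont.integrable_of_hasCompactSupport hgcs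
  set c : ℝ := ∫ z, g (Q z) with hc
  have hQup : ∀ z, Q z ≤ κ / l * ‖z‖ ^ 2 := by
    intro z
    have h1 := real_inner_le_norm (N z) z
    have h2 : ‖N z‖ * ‖z‖ ≤ ‖z‖ / l * ‖z‖ := by gcongr; exact hNl' z
    calc Q z = κ * ⟪N z, z⟫ := rfl
      _ ≤ κ * (‖z‖ / l * ‖z‖) := by gcongr; linarith
      _ = _ := by ring
  have hmc : m ≤ c := by
    have h1 : ∫ z in ball (0 : E) ρ, 1 / B ≤ ∫ z in ball (0 : E) ρ, g (Q z) := by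
      refine setIntegral_mono_on (integrableOn_const measure_ball_lt_top.ne)
        hgint.integrableOn measurableSet_ball
        fun z hz => hglow _ ?_
      have hz' : ‖z‖ < ρ := by simpa using hz
      have : ‖z‖ ^ 2 ≤ l / (2 * κ) := by
        have h3 : ρ ^ 2 = l / (2 * κ) := Real.sq_sqrt (by positivity)
        rw [← h3]; gcongr
      calc Q z ≤ κ / l * ‖z‖ ^ 2 := hQup z
        _ ≤ κ / l * (l / (2 * κ)) := by gcongr
        _ = 1 / 2 := by field_simp
    have h2 : ∫ z in ball (0 : E) ρ, g (Q z) ≤ c :=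
      setIntegral_le_integral hgint (ae_of_all _ fun z => hgn _)
    have h3 : ∫ z in ball (0 : E) ρ, 1 / B = m := by
      rw [setIntegral_const, hm, smul_eq_mul, Measure.real]; ring
    linarith
  have hcpos : 0 < c := hmpos.trans_le hmc
  have hcm : 1 / c ≤ 1 / m := one_div_le_one_div_of_le hmpos hmc
  have hc0 : 0 ≤ 1 / c := by positivity
  have hcancel : ∀ {X K : ℝ}, X ≤ K → 0 ≤ K → 1 / c * X ≤ 1 / m * K := by
    intro X K h1 h2
    exact (mul_le_mul_of_nonneg_left h1 hc0).trans (mul_le_mul_of_nonneg_right hcm h2)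
  have hfd : ∀ z h, |deriv g (Q z) * (2 * κ * ⟪N z, h⟫)| ≤ C2 * ‖h‖ := by
    intro z h
    by_cases hz : 1 / 8 ≤ ‖z‖
    · have h0 : deriv g (Q z) = 0 := by
        have hmin : IsLocalMin g (Q z) := by
          refine Filter.Eventually.of_forall fun t => ?_
          rw [hgz z hz]; exact hgn t
        exact hmin.deriv_eq_zero
      rw [h0]; simp; positivity
    · have hz' : ‖z‖ ≤ 1 := by linarith
      rw [abs_mul]
      have h1 : |2 * κ * ⟪N z, h⟫| ≤ 2 * κ / l * ‖h‖ := by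
        rw [abs_mul, abs_of_pos (by positivity : 0 < 2 * κ)]
        calc 2 * κ * |⟪N z, h⟫| ≤ 2 * κ * (‖N z‖ * ‖h‖) := by
              gcongr; exact abs_real_inner_le_norm _ _
          _ ≤ 2 * κ * (1 / l * ‖h‖) := by
              gcongr
              exact (hNl' z).trans (by gcongr)
          _ = _ := by ring
      calc |deriv g (Q z)| * |2 * κ * ⟪N z, h⟫| ≤ B * (2 * κ / l * ‖h‖) := by
            gcongr; exact hgB _
        _ = _ := by rw [hC2]; ring
  have htay : ∀ z h, |g (Q (z + h)) - g (Q z) - deriv g (Q z) * (2 * κ * ⟪N z, h⟫)| ≤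
      (C1 + 64 * (1 + C2)) * ‖h‖ ^ 2 := by
    intro z h
    have hin : |⟪N z, h⟫| ≤ ‖z‖ / l * ‖h‖ :=
      (abs_real_inner_le_norm _ _).trans (by gcongr; exact hNl' z)
    have hin2 : |⟪N h, h⟫| ≤ ‖h‖ / l * ‖h‖ :=
      (abs_real_inner_le_norm _ _).trans (by gcongr; exact hNl' h)
    rcases le_or_gt (1 / 8) ‖h‖ with hh | hh
    · have h1 : |g (Q (z + h)) - g (Q z)| ≤ 1 := by
        rw [abs_le]
        constructor <;> linarith [hgn (Q (z + h)), hg1 (Q (z + h)), hgn (Q z), hg1 (Q z)]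
      have h2 := hfd z h
      have h3 : (1 : ℝ) ≤ 64 * ‖h‖ ^ 2 := by nlinarith
      have h4 : ‖h‖ ≤ 64 * ‖h‖ ^ 2 := by nlinarith
      calc _ ≤ |g (Q (z + h)) - g (Q z)| + |deriv g (Q z) * (2 * κ * ⟪N z, h⟫)| := abs_sub _ _
        _ ≤ 1 + C2 * ‖h‖ := add_le_add h1 h2
        _ ≤ 64 * ‖h‖ ^ 2 + C2 * (64 * ‖h‖ ^ 2) := by gcongr
        _ ≤ _ := by nlinarith [sq_nonneg ‖h‖]
    · rcases le_or_gt 1 ‖z‖ with hz | hz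
      · have hzh : 1 / 8 ≤ ‖z + h‖ := by
          have := norm_sub_norm_le z (-h)
          rw [norm_neg, sub_neg_eq_add] at this
          linarith
        have h0 : deriv g (Q z) = 0 := by
          have hmin : IsLocalMin g (Q z) := by
            refine Filter.Eventually.of_forall fun t => ?_
            rw [hgz z (by linarith)]; exact hgn t
          exact hmin.deriv_eq_zero
        rw [hgz _ hzh, hgz z (by linarith), h0]
        simp; positivity
      · set t : ℝ := 2 * κ * ⟪N z, h⟫ + κ * ⟪N h, h⟫ with ht
        have h1 := hgT (Q z) t
        rw [← hQexp] at h1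
        have ht1 : |t| ≤ 3 * κ / l * ‖h‖ := by
          calc |t| ≤ |2 * κ * ⟪N z, h⟫| + |κ * ⟪N h, h⟫| := abs_add_le _ _
            _ = 2 * κ * |⟪N z, h⟫| + κ * |⟪N h, h⟫| := by
              rw [abs_mul, abs_of_pos (by positivity : 0 < 2 * κ), abs_mul, abs_of_pos hκpos]
            _ ≤ 2 * κ * (1 / l * ‖h‖) + κ * (1 / l * ‖h‖) := by
              gcongr
              · exact hin.trans (by gcongr)
              · exact hin2.trans (by gcongr; linarith)
            _ = _ := by ring
        have ht2 : t ^ 2 ≤ (3 * κ / l * ‖h‖) ^ 2 := by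
          rw [← sq_abs t]; gcongr
        have h5 : |deriv g (Q z) * (κ * ⟪N h, h⟫)| ≤ B * (κ / l) * ‖h‖ ^ 2 := by
          rw [abs_mul, abs_mul, abs_of_pos hκpos]
          calc |deriv g (Q z)| * (κ * |⟪N h, h⟫|) ≤ B * (κ * (‖h‖ / l * ‖h‖)) := by
                gcongr; exact hgB _
            _ = _ := by ring
        have h6 : g (Q (z + h)) - g (Q z) - deriv g (Q z) * (2 * κ * ⟪N z, h⟫) =
            (g (Q (z + h)) - g (Q z) - deriv g (Q z) * t) + deriv g (Q z) * (κ * ⟪N h, h⟫) := by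
          rw [ht]; ring
        rw [h6]
        calc _ ≤ |g (Q (z + h)) - g (Q z) - deriv g (Q z) * t| +
              |deriv g (Q z) * (κ * ⟪N h, h⟫)| := abs_add_le _ _
          _ ≤ B * (3 * κ / l * ‖h‖) ^ 2 + B * (κ / l) * ‖h‖ ^ 2 := by
              gcongr
              exact h1.trans (by gcongr)
          _ ≤ _ := by
              rw [hC1]
              nlinarith [mul_nonneg hC2n (sq_nonneg ‖h‖), sq_nonneg ‖h‖]
  have hη : ∀ z, HasFDerivAt (fun z => 1 / c * g (Q z))
      ((1 / c) • (deriv g (Q z) • fderiv ℝ Q z)) z := fun z => (hηd z).const_mul _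
  have hηapp : ∀ z h, fderiv ℝ (fun z => 1 / c * g (Q z)) z h =
      1 / c * (deriv g (Q z) * (2 * κ * ⟪N z, h⟫)) := by
    intro z h
    rw [(hη z).fderiv]
    simp [hQf]
  have hΨd : ∀ z, HasGradientAt (fun z => 1 / c * (1 / (2 * κ) * G (Q z)))
      ((1 / c * g (Q z)) • N z) z := by
    intro z
    rw [hasGradientAt_iff_hasFDerivAt]
    have h1 := (((hGd (Q z)).comp_hasFDerivAt z
      (hQs.differentiable (by simp) z).hasFDerivAt).const_mul (1 / (2 * κ))).const_mul (1 / c)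
    refine h1.congr_fderiv ?_
    ext w
    simp [hQf, inner_smul_left]
    field_simp
  refine ⟨fun z => 1 / c * g (Q z), fun z => 1 / c * (1 / (2 * κ) * G (Q z)), ?_⟩
  have hl0 : 0 ≤ 1 / l := by positivity
  have hm0 : 0 ≤ 1 / m := by positivity
  constructor
  · exact contDiff_const.mul (hgs.comp hQs)
  · exact contDiff_const.mul (contDiff_const.mul (hGs.comp hQs))
  · intro z hz; rw [hgz z hz, mul_zero]
  · intro z hz; rw [hG0 _ (hQ1 z hz)]; simp
  · rw [integral_const_mul, ← hc]; field_simp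
  · intro z; exact mul_nonneg hc0 (hgn _)
  · intro z
    have := hcancel (hg1 (Q z)) zero_le_one
    have h2 : 0 ≤ 1 / m * (1 / l + C2 + (C1 + 64 * (1 + C2))) := by positivity
    nlinarith
  · intro z
    rw [(hΨd z).gradient, norm_smul, Real.norm_of_nonneg (mul_nonneg hc0 (hgn _)), mul_assoc]
    have h1 : g (Q z) * ‖N z‖ ≤ 1 / l := by
      by_cases hz : 1 / 8 ≤ ‖z‖
      · rw [hgz z hz]; simpa using hl.le
      · calc g (Q z) * ‖N z‖ ≤ 1 * (‖z‖ / l) := by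
              gcongr
              · exact hg1 _
              · exact hNl' z
          _ ≤ 1 / l := by rw [one_mul]; gcongr; linarith
    have := hcancel h1 hl0
    have h2 : 0 ≤ 1 / m * (1 + C2 + (C1 + 64 * (1 + C2))) := by positivity
    nlinarith
  · intro z
    refine ContinuousLinearMap.opNorm_le_bound _ (by positivity) fun h => ?_
    rw [hηapp, Real.norm_eq_abs, abs_mul, abs_of_nonneg hc0]
    have := hcancel (hfd z h) (by positivity)
    have h2 : 0 ≤ (1 + 1 / m * (1 + 1 / l + (C1 + 64 * (1 + C2)))) * ‖h‖ := by positivity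
    nlinarith
  · intro z h
    have h1 : (fun z => 1 / c * g (Q z)) (z + h) - (fun z => 1 / c * g (Q z)) z -
        fderiv ℝ (fun z => 1 / c * g (Q z)) z h =
        1 / c * (g (Q (z + h)) - g (Q z) - deriv g (Q z) * (2 * κ * ⟪N z, h⟫)) := by
      rw [hηapp]; ring
    rw [h1, abs_mul, abs_of_nonneg hc0]
    have := hcancel (htay z h) (by positivity)
    have h2 : 0 ≤ (1 + 1 / m * (1 + 1 / l + C2)) * ‖h‖ ^ 2 := by positivity
    nlinarith
  · intro z
    rw [(hΨd z).gradient, map_smul, map_smul, ← smul_add, hMN, smul_smul]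
    congr 1; ring

theorem contDiff_gradient {φ : E → ℝ} (hφ : ContDiff ℝ ∞ φ) : ContDiff ℝ ∞ (∇ φ) := by
  have h1 : ContDiff ℝ ∞ (fderiv ℝ φ) := hφ.fderiv_right (by simp)
  exact (InnerProductSpace.toDual ℝ E).symm.contDiff.comp h1

theorem continuous_gradient {φ : E → ℝ} (hφ : ContDiff ℝ ∞ φ) : Continuous (∇ φ) :=
  (contDiff_gradient hφ).continuous

theorem ContDiff.hasGradientAt {φ : E → ℝ} (hφ : ContDiff ℝ ∞ φ) (x : E) :
    HasGradientAt φ (∇ φ x) x :=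
  (hφ.differentiable (by simp) x).hasGradientAt

theorem norm_gradient (φ : E → ℝ) (x : E) : ‖∇ φ x‖ = ‖fderiv ℝ φ x‖ := by
  simp [gradient]

theorem gradient_comp_affine {φ : E → ℝ} (hφ : ContDiff ℝ ∞ φ) (c : E) (t : ℝ) (x : E) :
    ∇ (fun y => φ (c + t • y)) x = t • ∇ φ (c + t • x) := by
  apply HasGradientAt.gradient
  rw [hasGradientAt_iff_hasFDerivAt]
  have h1 : HasFDerivAt (fun y : E => c + t • y) (t • ContinuousLinearMap.id ℝ E) x :=
    ((hasFDerivAt_id x).const_smul t).const_add c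
  have h2 := (hφ.differentiable (by simp) (c + t • x)).hasFDerivAt.comp x h1
  refine h2.congr_fderiv ?_
  ext w
  simp [inner_smul_left]

theorem contDiff_comp_affine {φ : E → ℝ} (hφ : ContDiff ℝ ∞ φ) (c : E) (t : ℝ) :
    ContDiff ℝ ∞ (fun y => φ (c + t • y)) :=
  hφ.comp (contDiff_const.add (contDiff_id.const_smul t))

theorem gradient_eq_zero_of_forall_eq_zero {Ψ : E → ℝ} {ρ : ℝ} (h : ∀ z, ρ ≤ ‖z‖ → Ψ z = 0)
    {z : E} (hz : ρ < ‖z‖) : ∇ Ψ z = 0 := by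
  have : Ψ =ᶠ[𝓝 z] fun _ => 0 := by
    have : {w : E | ρ < ‖w‖} ∈ 𝓝 z := (isOpen_lt continuous_const continuous_norm).mem_nhds hz
    filter_upwards [this] with w hw using h w (le_of_lt hw)
  rw [gradient, this.fderiv_eq]; simp

theorem hasCompactSupport_of_forall_eq_zero {F : Type*} [Zero F] {Ψ : E → F} {ρ : ℝ}
    (h : ∀ z, ρ < ‖z‖ → Ψ z = 0) : HasCompactSupport Ψ :=
  HasCompactSupport.intro (isCompact_closedBall (0 : E) ρ) fun z hz => h z (by simpa using hz)

theorem HasCompactSupport.gradient {Ψ : E → ℝ} (h : HasCompactSupport Ψ) :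
    HasCompactSupport (∇ Ψ) := by
  have := h.fderiv (𝕜 := ℝ)
  exact this.comp_left (g := (InnerProductSpace.toDual ℝ E).symm) (by simp)

/-- Mixed second order integrals against a test function are symmetric. -/
theorem integral_fderiv_mul_fderiv_comm {F Ψ : E → ℝ} (hF : ContDiff ℝ ∞ F)
    (hΨ : ContDiff ℝ ∞ Ψ) (hc : HasCompactSupport Ψ) (v w : E) :
    ∫ z, fderiv ℝ F z v * fderiv ℝ Ψ z w = ∫ z, fderiv ℝ F z w * fderiv ℝ Ψ z v := by
  have hΨ1 : ContDiff ℝ ∞ (fderiv ℝ Ψ) := hΨ.fderiv_right (by simp)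
  have hF1 : ContDiff ℝ ∞ (fderiv ℝ F) := hF.fderiv_right (by simp)
  have key : ∀ v w : E, ∫ z, fderiv ℝ F z v * fderiv ℝ Ψ z w =
      - ∫ z, F z * fderiv ℝ (fderiv ℝ Ψ) z v w := by
    intro v w
    have hg : ContDiff ℝ ∞ (fun z => fderiv ℝ Ψ z w) := hΨ1.clm_apply contDiff_const
    have hgd : ∀ z, fderiv ℝ (fun z => fderiv ℝ Ψ z w) z v = fderiv ℝ (fderiv ℝ Ψ) z v w := by
      intro z
      rw [fderiv_clm_apply (hΨ1.differentiable (by simp) z) (by fun_prop)]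
      simp
    have hgc : HasCompactSupport (fun z => fderiv ℝ Ψ z w) := hc.fderiv_apply ℝ w
    have hi1 : Integrable fun z => fderiv ℝ F z v * fderiv ℝ Ψ z w :=
      ((hF1.clm_apply contDiff_const).continuous.mul hg.continuous).integrable_of_hasCompactSupport
        hgc.mul_left
    have hi2 : Integrable fun z => F z * fderiv ℝ (fun z => fderiv ℝ Ψ z w) z v :=
      (hF.continuous.mul ((hg.fderiv_right (m := ∞) (by simp)).clm_apply
        contDiff_const).continuous).integrable_of_hasCompactSupport (hgc.fderiv_apply ℝ v).mul_left
    have hi3 : Integrable fun z => F z * fderiv ℝ Ψ z w :=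
      (hF.continuous.mul hg.continuous).integrable_of_hasCompactSupport hgc.mul_left
    have := integral_mul_fderiv_eq_neg_fderiv_mul_of_integrable hi1 hi2 hi3
      (fun z _ => hF.differentiable (by simp) z) (fun z _ => hg.differentiable (by simp) z)
    simp only [hgd] at this
    linarith
  rw [key v w, key w v]
  congr 1
  refine integral_congr_ae (ae_of_all _ fun z => ?_)
  have hs : IsSymmSndFDerivAt ℝ Ψ z :=
    hΨ.contDiffAt.isSymmSndFDerivAt (by
      simp only [minSmoothness_of_isRCLikeNormedField]
      exact WithTop.coe_le_coe.2 (le_top : (2 : ℕ∞) ≤ ⊤))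
  simp only [hs v w]

theorem integral_inner_gradient_comm {F Ψ : E → ℝ} (hF : ContDiff ℝ ∞ F)
    (hΨ : ContDiff ℝ ∞ Ψ) (hc : HasCompactSupport Ψ) (M : E →L[ℝ] E) :
    ∫ z, ⟪∇ F z, M (∇ Ψ z)⟫ = ∫ z, ⟪M (∇ F z), ∇ Ψ z⟫ := by
  set b := stdOrthonormalBasis ℝ E
  have hexp : ∀ x y : E, ⟪x, M y⟫ = ∑ i, ∑ j, ⟪b i, M (b j)⟫ * (⟪x, b i⟫ * ⟪y, b j⟫) := by
    intro x y
    conv_lhs => rw [← b.sum_repr' x, ← b.sum_repr' y]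
    rw [sum_inner]
    refine Finset.sum_congr rfl fun i _ => ?_
    rw [map_sum, inner_sum]
    refine Finset.sum_congr rfl fun j _ => ?_
    rw [map_smul, inner_smul_left, inner_smul_right, real_inner_comm x (b i),
      real_inner_comm y (b j)]
    simp; ring
  have hint : ∀ v w : E, Integrable fun z => fderiv ℝ F z v * fderiv ℝ Ψ z w := by
    intro v w
    have hΨ1 : ContDiff ℝ ∞ (fderiv ℝ Ψ) := hΨ.fderiv_right (by simp)
    have hF1 : ContDiff ℝ ∞ (fderiv ℝ F) := hF.fderiv_right (by simp)
    exact ((hF1.clm_apply contDiff_const).mul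
      (hΨ1.clm_apply contDiff_const)).continuous.integrable_of_hasCompactSupport
        (hc.fderiv_apply ℝ w).mul_left
  have h1 : ∀ z, ⟪∇ F z, M (∇ Ψ z)⟫ =
      ∑ i, ∑ j, ⟪b i, M (b j)⟫ * (fderiv ℝ F z (b i) * fderiv ℝ Ψ z (b j)) := by
    intro z
    rw [hexp]; simp only [inner_gradient_left]
  have h2 : ∀ z, ⟪M (∇ F z), ∇ Ψ z⟫ =
      ∑ i, ∑ j, ⟪b i, M (b j)⟫ * (fderiv ℝ F z (b j) * fderiv ℝ Ψ z (b i)) := by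
    intro z
    rw [real_inner_comm, hexp]; simp only [inner_gradient_left]
    refine Finset.sum_congr rfl fun i _ => Finset.sum_congr rfl fun j _ => ?_
    ring
  simp only [h1, h2]
  rw [integral_finsetSum _ fun i _ => integrable_finsetSum _ fun j _ => (hint _ _).const_mul _,
    integral_finsetSum _ fun i _ => integrable_finsetSum _ fun j _ => (hint _ _).const_mul _]
  refine Finset.sum_congr rfl fun i _ => ?_
  rw [integral_finsetSum _ fun j _ => (hint _ _).const_mul _,
    integral_finsetSum _ fun j _ => (hint _ _).const_mul _]
  refine Finset.sum_congr rfl fun j _ => ?_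
  rw [integral_const_mul, integral_const_mul, integral_fderiv_mul_fderiv_comm hF hΨ hc]

theorem IsAdaptedKernel.hasCompactSupport_Ψ {C : ℝ} {M : E →L[ℝ] E} {η Ψ : E → ℝ}
    (h : IsAdaptedKernel C M η Ψ) : HasCompactSupport Ψ :=
  hasCompactSupport_of_forall_eq_zero (ρ := 1 / 8) fun z hz => h.Ψ_eq_zero z hz.le

theorem IsAdaptedKernel.hasCompactSupport_η {C : ℝ} {M : E →L[ℝ] E} {η Ψ : E → ℝ}
    (h : IsAdaptedKernel C M η Ψ) : HasCompactSupport η :=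
  hasCompactSupport_of_forall_eq_zero (ρ := 1 / 8) fun z hz => h.η_eq_zero z hz.le

theorem IsAdaptedKernel.integral_mul_inner {C : ℝ} {M : E →L[ℝ] E} {η Ψ : E → ℝ}
    (h : IsAdaptedKernel C M η Ψ) {F : E → ℝ} (hF : ContDiff ℝ ∞ F) :
    ∫ z, η z * ⟪∇ F z, z⟫ = ∫ z, ⟪M (∇ F z), ∇ Ψ z⟫ := by
  have h1 : ∀ z, 2 * (η z * ⟪∇ F z, z⟫) = ⟪∇ F z, M (∇ Ψ z)⟫ + ⟪M (∇ F z), ∇ Ψ z⟫ := by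
    intro z
    rw [← ContinuousLinearMap.adjoint_inner_right, ← inner_add_right, h.flux, inner_smul_right]
    ring
  have hc := h.hasCompactSupport_Ψ
  have hcont := continuous_gradient hF
  have hcont' := continuous_gradient h.contDiff_Ψ
  have hi1 : Integrable fun z => ⟪∇ F z, M (∇ Ψ z)⟫ := by
    refine Continuous.integrable_of_hasCompactSupport (by fun_prop) ?_
    refine hc.gradient.mono' ?_
    intro z hz
    apply subset_tsupport
    intro h0
    exact hz (by simp [h0])
  have hi2 : Integrable fun z => ⟪M (∇ F z), ∇ Ψ z⟫ := by
    refine Continuous.integrable_of_hasCompactSupport (by fun_prop) ?_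
    refine hc.gradient.mono' ?_
    intro z hz
    apply subset_tsupport
    intro h0
    exact hz (by simp [h0])
  have h2 : 2 * ∫ z, η z * ⟪∇ F z, z⟫ = 2 * ∫ z, ⟪M (∇ F z), ∇ Ψ z⟫ := by
    rw [← integral_const_mul]
    simp only [h1]
    rw [integral_add hi1 hi2, integral_inner_gradient_comm hF h.contDiff_Ψ hc]
    ring
  linarith

/-- A measurable, uniformly elliptic and bounded field of operators. -/
structure IsEllipticField (l L : ℝ) (a : E → E →L[ℝ] E) : Prop where
  stronglyMeasurable : StronglyMeasurable a
  le_inner : ∀ x ξ, l * ‖ξ‖ ^ 2 ≤ ⟪a x ξ, ξ⟫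
  norm_le : ∀ x, ‖a x‖ ≤ L

/-- `φ` solves `div (a (∇φ + q) + R) = 0` weakly in the ball `B(c, ρ)`. -/
def IsWeakSol (a : E → E →L[ℝ] E) (φ : E → ℝ) (q : E) (R : E → E) (c : E) (ρ : ℝ) : Prop :=
  ∀ ψ : E → ℝ, ContDiff ℝ ∞ ψ → HasCompactSupport ψ → tsupport ψ ⊆ ball c ρ →
    ∫ x, ⟪a x (∇ φ x + q) + R x, ∇ ψ x⟫ = 0

/-- The defect of `φ` with respect to the constant coefficient operator `M` in the unit ball. -/
noncomputable def defect (M : E →L[ℝ] E) (a : E → E →L[ℝ] E) (φ : E → ℝ) (q : E) (R : E → E) :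
    E → E :=
  (ball (0 : E) 1).indicator fun x => M (∇ φ x + q) - (a x (∇ φ x + q) + R x)

theorem IsEllipticField.aestronglyMeasurable_apply {l L : ℝ} {a : E → E →L[ℝ] E}
    (ha : IsEllipticField l L a) {v : E → E} {μ : Measure E} (hv : AEStronglyMeasurable v μ) :
    AEStronglyMeasurable (fun x => a x (v x)) μ :=
  ((ContinuousLinearMap.id ℝ (E →L[ℝ] E)).aestronglyMeasurable_comp₂
    ha.stronglyMeasurable.aestronglyMeasurable hv)

theorem IsEllipticField.norm_apply_le {l L : ℝ} {a : E → E →L[ℝ] E}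
    (ha : IsEllipticField l L a) (x ξ : E) : ‖a x ξ‖ ≤ L * ‖ξ‖ :=
  (a x).le_of_opNorm_le (ha.norm_le x) ξ

theorem IsEllipticField.integrableOn_flux {l L : ℝ} {a : E → E →L[ℝ] E} (ha : IsEllipticField l L a)
    {φ : E → ℝ} (hφ : ContDiff ℝ ∞ φ) (q : E) {R : E → E} (hR : MemLp R 2)
    (c : E) (ρ : ℝ) :
    IntegrableOn (fun x => a x (∇ φ x + q) + R x) (ball c ρ) := by
  have hcont : Continuous fun x => ∇ φ x + q := (continuous_gradient hφ).add continuous_const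
  have h1 : IntegrableOn (fun x => ∇ φ x + q) (ball c ρ) :=
    (hcont.continuousOn.integrableOn_compact (isCompact_closedBall c ρ)).mono_set
      ball_subset_closedBall
  have h2 : IntegrableOn R (ball c ρ) :=
    (hR.locallyIntegrable (by norm_num)).integrableOn_isCompact (isCompact_closedBall c ρ)
      |>.mono_set ball_subset_closedBall
  refine Integrable.add ?_ h2
  refine (h1.norm.const_mul L).mono' (ha.aestronglyMeasurable_apply h1.aestronglyMeasurable) ?_
  exact ae_of_all _ fun x => ha.norm_apply_le _ _

theorem IsEllipticField.integrable_defect {l L : ℝ} {a : E → E →L[ℝ] E} (ha : IsEllipticField l L a)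
    {φ : E → ℝ} (hφ : ContDiff ℝ ∞ φ) (q : E) {R : E → E} (hR : MemLp R 2) (M : E →L[ℝ] E) :
    Integrable (defect M a φ q R) := by
  rw [defect, integrable_indicator_iff measurableSet_ball]
  refine Integrable.sub ?_ (ha.integrableOn_flux hφ q hR 0 1)
  have hcont : Continuous fun x => M (∇ φ x + q) :=
    M.continuous.comp ((continuous_gradient hφ).add continuous_const)
  exact (hcont.continuousOn.integrableOn_compact (isCompact_closedBall (0 : E) 1)).mono_set
    ball_subset_closedBall

theorem integral_inner_gradient_eq_zero {Ψ : E → ℝ} (hΨ : ContDiff ℝ ∞ Ψ)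
    (hc : HasCompactSupport Ψ) (v : E) : ∫ z, ⟪v, ∇ Ψ z⟫ = 0 := by
  have hΨ1 : ContDiff ℝ ∞ (fderiv ℝ Ψ) := hΨ.fderiv_right (by simp)
  have hi1 : Integrable fun z => (fderiv ℝ Ψ z v) :=
    (hΨ1.clm_apply contDiff_const).continuous.integrable_of_hasCompactSupport
      (hc.fderiv_apply ℝ v)
  have hi3 : Integrable Ψ := hΨ.continuous.integrable_of_hasCompactSupport hc
  have := integral_mul_fderiv_eq_neg_fderiv_mul_of_integrable (f := fun _ : E => (1 : ℝ)) (g := Ψ)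
    (v := v) (μ := volume) (by simp) (by simpa using hi1) (by simpa using hi3)
    (fun z _ => by fun_prop) (fun z _ => hΨ.differentiable (by simp) z)
  simp only [one_mul, fderiv_fun_const] at this
  have e : ∀ z, ⟪v, ∇ Ψ z⟫ = fderiv ℝ Ψ z v := fun z => by
    rw [real_inner_comm, inner_gradient_left]
  simp only [e]
  simpa using this

theorem IsAdaptedKernel.abs_integral_mul_inner_le {C : ℝ} {M : E →L[ℝ] E} {η Ψ : E → ℝ}
    (h : IsAdaptedKernel C M η Ψ) {l L : ℝ} {a : E → E →L[ℝ] E} (ha : IsEllipticField l L a)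
    {φ : E → ℝ} (hφ : ContDiff ℝ ∞ φ) {q : E} {R : E → E} (hR : MemLp R 2)
    (hs : IsWeakSol a φ q R 0 1) {x : E} (hx : ‖x‖ < 1 / 2) {s : ℝ} (hs0 : 0 < s) (hs1 : s ≤ 1) :
    |∫ z, η z * ⟪∇ φ (x - s • z), z⟫| ≤
      C * ∫ z in ball (0 : E) (1 / 2), ‖defect M a φ q R (x - s • z)‖ := by
  set Φ : E → E := fun x => a x (∇ φ x + q) + R x with hΦ
  set G := defect M a φ q R with hG
  have hGi : Integrable G := ha.integrable_defect hφ q hR M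
  have hmem : ∀ z : E, ‖z‖ ≤ 1 / 8 → x - s • z ∈ ball (0 : E) 1 := by
    intro z hz
    rw [mem_ball_zero_iff]
    calc ‖x - s • z‖ ≤ ‖x‖ + ‖s • z‖ := norm_sub_le _ _
      _ = ‖x‖ + s * ‖z‖ := by rw [norm_smul, Real.norm_of_nonneg hs0.le]
      _ < 1 / 2 + 1 * (1 / 8) := add_lt_add_of_lt_of_le hx (by gcongr)
      _ < 1 := by norm_num
  have hΨ0 : ∀ z, 1 / 8 < ‖z‖ → ∇ Ψ z = 0 := fun z hz =>
    gradient_eq_zero_of_forall_eq_zero h.Ψ_eq_zero hz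
  -- the smoothed equation
  have htest : ∫ z, ⟪Φ (x - s • z), ∇ Ψ z⟫ = 0 := by
    set ψ : E → ℝ := fun y => Ψ (s⁻¹ • x + (-s⁻¹) • y) with hψ
    have hψz : ∀ y, y ∉ closedBall x (s / 8) → ψ y = 0 := by
      intro y hy
      apply h.Ψ_eq_zero
      have : s⁻¹ • x + (-s⁻¹) • y = (-s⁻¹) • (y - x) := by
        rw [smul_sub]; simp [add_comm]
      rw [this, norm_smul, norm_neg, norm_inv, Real.norm_of_nonneg hs0.le, ← dist_eq_norm,
        inv_mul_eq_div, le_div_iff₀ hs0]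
      simp only [mem_closedBall, not_le] at hy
      linarith
    have hts : tsupport ψ ⊆ closedBall x (s / 8) :=
      closure_minimal (fun y hy => by by_contra h'; exact hy (hψz y h')) isClosed_closedBall
    have hcs : HasCompactSupport ψ := HasCompactSupport.intro (isCompact_closedBall x (s / 8)) hψz
    have h0 := hs ψ (contDiff_comp_affine h.contDiff_Ψ _ _) hcs (hts.trans fun y hy => by
      rw [mem_closedBall, dist_eq_norm] at hy
      rw [mem_ball_zero_iff]
      have := norm_add_le (y - x) x
      rw [sub_add_cancel] at this
      linarith)
    simp only [hψ, gradient_comp_affine h.contDiff_Ψ, inner_smul_right] at h0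
    rw [integral_const_mul] at h0
    have h1 : ∫ y, ⟪Φ y, ∇ Ψ (s⁻¹ • x + (-s⁻¹) • y)⟫ = 0 := by
      rcases mul_eq_zero.1 h0 with h' | h'
      · simp [hs0.ne'] at h'
      · exact h'
    rw [← integral_sub_left_eq_self _ volume x] at h1
    have h2 := Measure.integral_comp_smul volume
      (fun z => ⟪Φ (x - z), ∇ Ψ (s⁻¹ • x + (-s⁻¹) • (x - z))⟫) s
    rw [h1, smul_zero] at h2
    rw [← h2]
    refine integral_congr_ae (ae_of_all _ fun z => ?_)
    have : s⁻¹ • x + (-s⁻¹) • (x - s • z) = z := by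
      rw [smul_sub, smul_smul]
      simp [hs0.ne']
    simp only [this]
  have hFs : ContDiff ℝ ∞ (fun z => φ (x + (-s) • z)) := contDiff_comp_affine hφ x (-s)
  have h1 : ∫ z, η z * ⟪∇ φ (x - s • z), z⟫ = ∫ z, ⟪M (∇ φ (x - s • z)), ∇ Ψ z⟫ := by
    have := h.integral_mul_inner hFs
    simp only [gradient_comp_affine hφ] at this
    simp only [neg_smul, ← sub_eq_add_neg] at this
    simp only [map_neg, map_smul, inner_neg_left, inner_smul_left, mul_neg, integral_neg,
      neg_inj] at this
    simp only [conj_trivial, mul_left_comm _ s, integral_const_mul] at this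
    exact mul_left_cancel₀ hs0.ne' this
  have h2 : ∫ z, ⟪M (∇ φ (x - s • z)), ∇ Ψ z⟫ = ∫ z, ⟪G (x - s • z), ∇ Ψ z⟫ := by
    have hcomp : ∀ {H : E → E}, Integrable H → Integrable fun z => H (x - s • z) := by
      intro H hH
      exact (hH.comp_sub_left x).comp_smul hs0.ne'
    have hbd : ∀ {H : E → E}, Integrable H → Integrable fun z => ⟪H (x - s • z), ∇ Ψ z⟫ := by
      intro H hH
      refine ((hcomp hH).norm.mul_const C).mono' ?_ (ae_of_all _ fun z => ?_)
      · exact (hcomp hH).aestronglyMeasurable.inner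
          (continuous_gradient h.contDiff_Ψ).aestronglyMeasurable
      · refine (norm_inner_le_norm _ _).trans ?_
        gcongr
        exact h.norm_gradient_Ψ_le z
    have e1 : ∀ z, ⟪G (x - s • z), ∇ Ψ z⟫ = ⟪M (∇ φ (x - s • z)), ∇ Ψ z⟫ + (⟪M q, ∇ Ψ z⟫ -
        ⟪(ball (0 : E) 1).indicator Φ (x - s • z), ∇ Ψ z⟫) := by
      intro z
      rcases le_or_gt ‖z‖ (1 / 8) with hz | hz
      · rw [hG, defect, indicator_of_mem (hmem z hz), indicator_of_mem (hmem z hz), map_add,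
          inner_sub_left, inner_add_left]
        ring
      · simp [hΨ0 z hz]
    have e2 : ∫ z, ⟪(ball (0 : E) 1).indicator Φ (x - s • z), ∇ Ψ z⟫ = 0 := by
      rw [← htest]
      refine integral_congr_ae (ae_of_all _ fun z => ?_)
      rcases le_or_gt ‖z‖ (1 / 8) with hz | hz
      · simp only [indicator_of_mem (hmem z hz)]
      · simp [hΨ0 z hz]
    have i1 : Integrable fun z => ⟪M (∇ φ (x - s • z)), ∇ Ψ z⟫ := by
      have := continuous_gradient hφ
      have := continuous_gradient h.contDiff_Ψ
      refine Continuous.integrable_of_hasCompactSupport (by fun_prop) ?_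
      exact hasCompactSupport_of_forall_eq_zero (ρ := 1 / 8) fun z hz => by simp [hΨ0 z hz]
    have i2 : Integrable fun z => ⟪M q, ∇ Ψ z⟫ := by
      have := continuous_gradient h.contDiff_Ψ
      refine Continuous.integrable_of_hasCompactSupport (by fun_prop) ?_
      exact hasCompactSupport_of_forall_eq_zero (ρ := 1 / 8) fun z hz => by simp [hΨ0 z hz]
    have i3 : Integrable fun z => ⟪(ball (0 : E) 1).indicator Φ (x - s • z), ∇ Ψ z⟫ :=
      hbd ((integrable_indicator_iff measurableSet_ball).2 (ha.integrableOn_flux hφ q hR 0 1))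
    have i4 : Integrable fun z => ⟪M q, ∇ Ψ z⟫ -
        ⟪(ball (0 : E) 1).indicator Φ (x - s • z), ∇ Ψ z⟫ := i2.sub i3
    simp only [e1]
    rw [integral_add i1 i4, integral_sub i2 i3, e2,
      integral_inner_gradient_eq_zero h.contDiff_Ψ h.hasCompactSupport_Ψ]
    ring
  have hGc : Integrable fun z => G (x - s • z) := (hGi.comp_sub_left x).comp_smul hs0.ne'
  rw [h1, h2, ← Real.norm_eq_abs, ← integral_const_mul,
    ← setIntegral_eq_integral_of_forall_compl_eq_zero (s := ball (0 : E) (1 / 2))]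
  · refine norm_integral_le_of_norm_le (hGc.norm.const_mul C).integrableOn (ae_of_all _ fun z => ?_)
    rw [mul_comm]
    refine (norm_inner_le_norm _ _).trans ?_
    gcongr
    exact h.norm_gradient_Ψ_le z
  · intro z hz
    rw [mem_ball_zero_iff, not_lt] at hz
    rw [hΨ0 z (by linarith), inner_zero_right]

theorem lintegral_segment_le {g : E → ENNReal} (hg : Measurable g) (S Z : Set E) :
    ∫⁻ x in S, ∫⁻ s in Ioc (0 : ℝ) 1, ∫⁻ z in Z, g (x - s • z) ≤
      volume Z * ∫⁻ x, g x := by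
  have hm : Measurable fun p : (E × ℝ) × E => g (p.1.1 - p.1.2 • p.2) :=
    hg.comp (by fun_prop)
  have hm2 : Measurable fun p : (ℝ × E) × E => g (p.2 - p.1.1 • p.1.2) :=
    hg.comp (by fun_prop)
  calc ∫⁻ x in S, ∫⁻ s in Ioc (0 : ℝ) 1, ∫⁻ z in Z, g (x - s • z)
      ≤ ∫⁻ x, ∫⁻ s in Ioc (0 : ℝ) 1, ∫⁻ z in Z, g (x - s • z) :=
        lintegral_mono' Measure.restrict_le_self le_rfl
    _ = ∫⁻ s in Ioc (0 : ℝ) 1, ∫⁻ x, ∫⁻ z in Z, g (x - s • z) := by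
        refine lintegral_lintegral_swap (Measurable.aemeasurable ?_)
        exact hm.lintegral_prod_right'
    _ = ∫⁻ s in Ioc (0 : ℝ) 1, ∫⁻ z in Z, ∫⁻ x, g (x - s • z) := by
        refine lintegral_congr fun s => ?_
        refine lintegral_lintegral_swap (Measurable.aemeasurable ?_)
        exact hg.comp (by fun_prop)
    _ = ∫⁻ s in Ioc (0 : ℝ) 1, ∫⁻ z in Z, ∫⁻ x, g x := by
        refine lintegral_congr fun s => lintegral_congr fun z => ?_
        exact lintegral_sub_right_eq_self g _
    _ = volume Z * ∫⁻ x, g x := by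
        simp [mul_comm]

theorem sub_eq_integral_gradient {φ : E → ℝ} (hφ : ContDiff ℝ ∞ φ) (x z : E) :
    φ (x - z) - φ x = - ∫ s in (0 : ℝ)..1, ⟪∇ φ (x - s • z), z⟫ := by
  have hd : ∀ s : ℝ, HasDerivAt (fun s : ℝ => φ (x - s • z)) (-⟪∇ φ (x - s • z), z⟫) s := by
    intro s
    have h1 : HasDerivAt (fun s : ℝ => x - s • z) (-z) s := by
      simpa using ((hasDerivAt_id s).smul_const z).const_sub x
    have h2 := (hφ.differentiable (by simp) (x - s • z)).hasFDerivAt.comp_hasDerivAt s h1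
    rw [map_neg, ← inner_gradient_left] at h2
    exact h2
  have hc : Continuous fun s : ℝ => ⟪∇ φ (x - s • z), z⟫ := by
    have := continuous_gradient hφ
    fun_prop
  have := intervalIntegral.integral_eq_sub_of_hasDerivAt (fun s _ => hd s)
    (hc.neg.intervalIntegrable 0 1)
  rw [intervalIntegral.integral_neg] at this
  simp only [one_smul, zero_smul, sub_zero] at this
  linarith

theorem IsAdaptedKernel.enorm_sub_average_le {C : ℝ} {M : E →L[ℝ] E} {η Ψ : E → ℝ}
    (h : IsAdaptedKernel C M η Ψ) {l L : ℝ} {a : E → E →L[ℝ] E} (ha : IsEllipticField l L a)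
    {φ : E → ℝ} (hφ : ContDiff ℝ ∞ φ) {q : E} {R : E → E} (hR : MemLp R 2)
    (hs : IsWeakSol a φ q R 0 1) {x : E} (hx : ‖x‖ < 1 / 2) :
    ‖φ x - ∫ z, η z * φ (x - z)‖ₑ ≤ ENNReal.ofReal C *
      ∫⁻ s in Ioc (0 : ℝ) 1, ∫⁻ z in ball (0 : E) (1 / 2), ‖defect M a φ q R (x - s • z)‖ₑ := by
  have hC : 0 ≤ C := (norm_nonneg _).trans (h.norm_gradient_Ψ_le 0)
  have hGi := ha.integrable_defect hφ q hR M
  have hgr := continuous_gradient hφ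
  have hηc := h.contDiff_η.continuous
  have hφc := hφ.continuous
  have hη0 : ∀ z, 1 / 8 < ‖z‖ → η z = 0 := fun z hz => h.η_eq_zero z hz.le
  have i1 : Integrable fun z => η z * φ (x - z) := by
    refine Continuous.integrable_of_hasCompactSupport (by fun_prop) ?_
    exact h.hasCompactSupport_η.mul_right
  have i2 : Integrable fun z => η z * φ x := by
    refine Continuous.integrable_of_hasCompactSupport (by fun_prop) ?_
    exact h.hasCompactSupport_η.mul_right
  have e1 : φ x - ∫ z, η z * φ (x - z) =
      ∫ z in closedBall (0 : E) (1 / 8), ∫ s in Ioc (0 : ℝ) 1, η z * ⟪∇ φ (x - s • z), z⟫ := by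
    have : φ x = ∫ z, η z * φ x := by rw [integral_mul_const, h.integral_η, one_mul]
    rw [this, ← integral_sub i2 i1, ← setIntegral_eq_integral_of_forall_compl_eq_zero
      (s := closedBall (0 : E) (1 / 8))]
    · refine setIntegral_congr_fun measurableSet_closedBall fun z _ => ?_
      rw [integral_const_mul, ← intervalIntegral.integral_of_le zero_le_one,
        ← neg_eq_iff_eq_neg.2 (sub_eq_integral_gradient hφ x z)]
      ring
    · intro z hz
      rw [hη0 z (by simpa using hz)]; ring
  have hcont : Continuous fun p : E × ℝ => η p.1 * ⟪∇ φ (x - p.2 • p.1), p.1⟫ := by fun_prop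
  have hprod : Integrable (Function.uncurry fun (z : E) (s : ℝ) => η z * ⟪∇ φ (x - s • z), z⟫)
      ((volume.restrict (closedBall (0 : E) (1 / 8))).prod (volume.restrict (Ioc (0 : ℝ) 1))) := by
    rw [Measure.prod_restrict]
    refine IntegrableOn.mono_set (t := closedBall (0 : E) (1 / 8) ×ˢ Icc (0 : ℝ) 1) ?_
      (prod_mono le_rfl Ioc_subset_Icc_self)
    exact hcont.continuousOn.integrableOn_compact
      ((isCompact_closedBall _ _).prod isCompact_Icc)
  rw [e1, integral_integral_swap hprod]
  refine (enorm_integral_le_lintegral_enorm _).trans ?_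
  rw [← lintegral_const_mul' _ _ ENNReal.ofReal_ne_top]
  refine setLIntegral_mono' measurableSet_Ioc fun s hs' => ?_
  rw [setIntegral_eq_integral_of_forall_compl_eq_zero fun z hz => by
    rw [hη0 z (by simpa using hz), zero_mul]]
  have hmain := h.abs_integral_mul_inner_le ha hφ hR hs hx hs'.1 hs'.2
  rw [Real.enorm_eq_ofReal_abs]
  refine (ENNReal.ofReal_le_ofReal hmain).trans ?_
  rw [ENNReal.ofReal_mul hC, ofReal_integral_norm_eq_lintegral_enorm]
  exact ((hGi.comp_sub_left x).comp_smul hs'.1.ne').integrableOn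

theorem IsEllipticField.stronglyMeasurable_defect {l L : ℝ} {a : E → E →L[ℝ] E}
    (ha : IsEllipticField l L a) {φ : E → ℝ} (hφ : ContDiff ℝ ∞ φ) (q : E) {R : E → E}
    (hR : StronglyMeasurable R) (M : E →L[ℝ] E) : StronglyMeasurable (defect M a φ q R) := by
  have hv : Continuous fun x => ∇ φ x + q := (continuous_gradient hφ).add continuous_const
  have h1 : StronglyMeasurable fun x => a x (∇ φ x + q) :=
    (isBoundedBilinearMap_apply.continuous.comp_stronglyMeasurable
      (ha.stronglyMeasurable.prodMk hv.stronglyMeasurable))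
  exact ((M.continuous.comp hv).stronglyMeasurable.sub (h1.add hR)).indicator measurableSet_ball

theorem IsAdaptedKernel.lintegral_sub_average_le {C : ℝ} {M : E →L[ℝ] E} {η Ψ : E → ℝ}
    (h : IsAdaptedKernel C M η Ψ) {l L : ℝ} {a : E → E →L[ℝ] E} (ha : IsEllipticField l L a)
    {φ : E → ℝ} (hφ : ContDiff ℝ ∞ φ) {q : E} {R : E → E} (hR : MemLp R 2)
    (hRm : StronglyMeasurable R) (hs : IsWeakSol a φ q R 0 1) :
    ∫⁻ x in ball (0 : E) (1 / 2), ‖φ x - ∫ z, η z * φ (x - z)‖ₑ ≤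
      ENNReal.ofReal C * (volume (ball (0 : E) (1 / 2)) * ∫⁻ x, ‖defect M a φ q R x‖ₑ) := by
  have hG := (ha.stronglyMeasurable_defect hφ q hRm M).measurable.enorm
  calc _ ≤ ∫⁻ x in ball (0 : E) (1 / 2), ENNReal.ofReal C * ∫⁻ s in Ioc (0 : ℝ) 1,
        ∫⁻ z in ball (0 : E) (1 / 2), ‖defect M a φ q R (x - s • z)‖ₑ :=
        setLIntegral_mono' measurableSet_ball fun x hx =>
          h.enorm_sub_average_le ha hφ hR hs (by simpa using hx)
    _ ≤ _ := by
        rw [lintegral_const_mul' _ _ ENNReal.ofReal_ne_top]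
        gcongr
        exact lintegral_segment_le hG _ _

/-- The constant and linear parts of the mollification at the origin. -/
theorem IsAdaptedKernel.abs_average_sub_affine_le {C : ℝ} {M : E →L[ℝ] E} {η Ψ : E → ℝ}
    (h : IsAdaptedKernel C M η Ψ) {φ : E → ℝ} (hφ : ContDiff ℝ ∞ φ) :
    (∀ x : E, ‖x‖ ≤ 1 / 2 →
      |(∫ z, η z * φ (x - z)) - (∫ z, η z * φ (-z)) - ⟪∫ z, η z • ∇ φ (-z), x⟫| ≤
        C * ‖x‖ ^ 2 * ∫ y in ball (0 : E) 1, |φ y|) ∧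
    |∫ z, η z * φ (-z)| ≤ C * ∫ y in ball (0 : E) 1, |φ y| ∧
    ‖∫ z, η z • ∇ φ (-z)‖ ≤ C * ∫ y in ball (0 : E) 1, |φ y| := by
  have hC : 0 ≤ C := (norm_nonneg _).trans (h.norm_gradient_Ψ_le 0)
  have hη1 : ContDiff ℝ ∞ (fderiv ℝ η) := h.contDiff_η.fderiv_right (by simp)
  have hηc := h.contDiff_η.continuous
  have hφc := hφ.continuous
  have hgr := continuous_gradient hφ
  have hηs := h.hasCompactSupport_η
  have hη0 : ∀ z, 1 / 8 < ‖z‖ → η z = 0 := fun z hz => h.η_eq_zero z hz.le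
  have hdη0 : ∀ z, 1 / 8 < ‖z‖ → fderiv ℝ η z = 0 := fun z hz => by
    have := gradient_eq_zero_of_forall_eq_zero h.η_eq_zero hz
    rwa [gradient, map_eq_zero_iff _ (InnerProductSpace.toDual ℝ E).symm.injective] at this
  have hφint : IntegrableOn (fun z => |φ (-z)|) (ball (0 : E) 1) := by
    have : Continuous fun z => |φ (-z)| := by fun_prop
    exact (this.continuousOn.integrableOn_compact (isCompact_closedBall (0 : E) 1)).mono_set
      ball_subset_closedBall
  have heq : ∫ y in ball (0 : E) 1, |φ (-y)| = ∫ y in ball (0 : E) 1, |φ y| := by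
    rw [← integral_indicator measurableSet_ball, ← integral_indicator measurableSet_ball,
      ← integral_neg_eq_self]
    refine integral_congr_ae (ae_of_all _ fun z => ?_)
    simp [indicator]
  -- a general bound for integrals against `φ`
  have hbound : ∀ (k : E → ℝ) (K : ℝ), (∀ z, |k z| ≤ K) → (∀ z, 1 ≤ ‖z‖ → k z = 0) →
      |∫ z, k z * φ (-z)| ≤ K * ∫ y in ball (0 : E) 1, |φ y| := by
    intro k K hk hk0
    rw [← setIntegral_eq_integral_of_forall_compl_eq_zero (s := ball (0 : E) 1), ← heq,
      ← integral_const_mul, ← Real.norm_eq_abs]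
    · refine norm_integral_le_of_norm_le (hφint.const_mul K) (ae_of_all _ fun z => ?_)
      rw [Real.norm_eq_abs, abs_mul]
      gcongr
      exact hk z
    · intro z hz
      rw [hk0 z (by simpa using hz), zero_mul]
  have hip : Integrable fun z => η z • ∇ φ (-z) :=
    Continuous.integrable_of_hasCompactSupport (by fun_prop) hηs.smul_right
  have hp : ∀ x, ⟪∫ z, η z • ∇ φ (-z), x⟫ = ∫ z, fderiv ℝ η z x * φ (-z) := by
    intro x
    rw [real_inner_comm, ← integral_inner hip]
    have hd : ∀ z, HasFDerivAt (fun z => φ (-z)) (-(fderiv ℝ φ (-z))) z := by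
      intro z
      have := (hφ.differentiable (by simp) (-z)).hasFDerivAt.comp z (hasFDerivAt_id z).neg
      refine this.congr_fderiv ?_
      ext w; simp
    have hφn : ContDiff ℝ ∞ fun z => φ (-z) := hφ.comp contDiff_neg
    have := integral_mul_fderiv_eq_neg_fderiv_mul_of_integrable (f := η) (g := fun z => φ (-z))
      (v := x) (μ := volume)
      ((((hη1.clm_apply contDiff_const).mul hφn).continuous).integrable_of_hasCompactSupport
        (hηs.fderiv_apply ℝ x).mul_right)
      ((h.contDiff_η.mul ((hφn.fderiv_right (m := ∞) (by simp)).clm_apply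
        contDiff_const)).continuous.integrable_of_hasCompactSupport hηs.mul_right)
      ((h.contDiff_η.mul hφn).continuous.integrable_of_hasCompactSupport hηs.mul_right)
      (fun z _ => h.contDiff_η.differentiable (by simp) z)
      (fun z _ => hφn.differentiable (by simp) z)
    rw [← neg_eq_iff_eq_neg.2 this, ← integral_neg]
    refine integral_congr_ae (ae_of_all _ fun z => ?_)
    simp only [(hd z).fderiv, inner_smul_right]
    rw [real_inner_comm, inner_gradient_left]
    simp
  refine ⟨fun x hx => ?_, ?_, ?_⟩
  · have e1 : ∫ z, η z * φ (x - z) = ∫ z, η (z + x) * φ (-z) := by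
      rw [← integral_add_right_eq_self _ x]
      refine integral_congr_ae (ae_of_all _ fun z => ?_)
      simp only
      congr 2
      abel
    have i1 : Integrable fun z => η (z + x) * φ (-z) := by
      refine Continuous.integrable_of_hasCompactSupport (by fun_prop) ?_
      exact (hηs.comp_homeomorph (Homeomorph.addRight x)).mul_right
    have i2 : Integrable fun z => η z * φ (-z) :=
      Continuous.integrable_of_hasCompactSupport (by fun_prop) hηs.mul_right
    have i3 : Integrable fun z => fderiv ℝ η z x * φ (-z) :=
      ((hη1.clm_apply contDiff_const).continuous.mul
        (by fun_prop : Continuous fun z => φ (-z))).integrable_of_hasCompactSupport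
        (hηs.fderiv_apply ℝ x).mul_right
    have i4 : Integrable fun z => η (z + x) * φ (-z) - η z * φ (-z) := i1.sub i2
    rw [e1, hp, ← integral_sub i1 i2, ← integral_sub i4 i3]
    have e2 : ∀ z, η (z + x) * φ (-z) - η z * φ (-z) - fderiv ℝ η z x * φ (-z) =
        (η (z + x) - η z - fderiv ℝ η z x) * φ (-z) := fun z => by ring
    simp only [e2]
    refine hbound _ _ (fun z => h.taylor_η z x) fun z hz => ?_
    have : 1 / 8 < ‖z + x‖ := by
      have := norm_sub_norm_le z (-x)
      rw [norm_neg, sub_neg_eq_add] at this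
      linarith
    rw [hη0 _ this, hη0 z (by linarith), hdη0 z (by linarith)]
    simp
  · refine hbound _ _ (fun z => ?_) fun z hz => hη0 z (by linarith)
    rw [abs_of_nonneg (h.η_nonneg z)]; exact h.η_le z
  · set p := ∫ z, η z • ∇ φ (-z) with hpdef
    set I := ∫ y in ball (0 : E) 1, |φ y| with hI
    have hI0 : 0 ≤ I := integral_nonneg fun _ => abs_nonneg _
    have h1 : |⟪p, p⟫| ≤ C * ‖p‖ * I := by
      rw [hp p]
      refine hbound _ _ (fun z => ?_) fun z hz => by rw [hdη0 z (by linarith)]; simp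
      rw [← Real.norm_eq_abs]
      exact (fderiv ℝ η z).le_of_opNorm_le (h.norm_fderiv_η_le z) p
    rw [real_inner_self_eq_norm_sq, abs_of_nonneg (sq_nonneg _)] at h1
    rcases eq_or_lt_of_le (norm_nonneg p) with h0 | h0
    · rw [← h0]; positivity
    · nlinarith

theorem IsAdaptedKernel.integral_abs_sub_affine_le {C : ℝ} {M : E →L[ℝ] E} {η Ψ : E → ℝ}
    (h : IsAdaptedKernel C M η Ψ) {l L : ℝ} {a : E → E →L[ℝ] E} (ha : IsEllipticField l L a)
    {φ : E → ℝ} (hφ : ContDiff ℝ ∞ φ) {q : E} {R : E → E} (hR : MemLp R 2)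
    (hRm : StronglyMeasurable R) (hs : IsWeakSol a φ q R 0 1) {τ : ℝ} (hτ0 : 0 ≤ τ)
    (hτ : τ ≤ 1 / 2) :
    ∫ x in ball (0 : E) τ, |φ x - (∫ z, η z * φ (-z)) - ⟪∫ z, η z • ∇ φ (-z), x⟫| ≤
      C * volume.real (ball (0 : E) (1 / 2)) * (∫ x, ‖defect M a φ q R x‖) +
        C * τ ^ 2 * (∫ y in ball (0 : E) 1, |φ y|) * volume.real (ball (0 : E) τ) := by
  have hC : 0 ≤ C := (norm_nonneg _).trans (h.norm_gradient_Ψ_le 0)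
  set m := ∫ z, η z * φ (-z)
  set p := ∫ z, η z • ∇ φ (-z)
  set I := ∫ y in ball (0 : E) 1, |φ y|
  have hI0 : 0 ≤ I := integral_nonneg fun _ => abs_nonneg _
  have hG0 : 0 ≤ ∫ x, ‖defect M a φ q R x‖ := integral_nonneg fun _ => norm_nonneg _
  have hGi := ha.integrable_defect hφ q hR M
  have hcont : Continuous fun x => φ x - m - ⟪p, x⟫ := by
    have := hφ.continuous
    fun_prop
  have hint : IntegrableOn (fun x => φ x - m - ⟪p, x⟫) (ball (0 : E) τ) :=
    (hcont.continuousOn.integrableOn_compact (isCompact_closedBall (0 : E) τ)).mono_set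
      ball_subset_closedBall
  have key : ENNReal.ofReal (∫ x in ball (0 : E) τ, ‖φ x - m - ⟪p, x⟫‖) ≤
      ENNReal.ofReal (C * volume.real (ball (0 : E) (1 / 2)) * (∫ x, ‖defect M a φ q R x‖) +
        C * τ ^ 2 * I * volume.real (ball (0 : E) τ)) := by
    rw [ofReal_integral_norm_eq_lintegral_enorm hint]
    calc _ ≤ ∫⁻ x in ball (0 : E) τ, (‖φ x - ∫ z, η z * φ (x - z)‖ₑ +
          ENNReal.ofReal (C * τ ^ 2 * I)) := by
          refine setLIntegral_mono' measurableSet_ball fun x hx => ?_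
          have hx' : ‖x‖ < τ := by simpa using hx
          have e : φ x - m - ⟪p, x⟫ = (φ x - ∫ z, η z * φ (x - z)) +
            ((∫ z, η z * φ (x - z)) - m - ⟪p, x⟫) := by ring
          rw [e]
          refine (enorm_add_le _ _).trans ?_
          gcongr
          rw [Real.enorm_eq_ofReal_abs]
          apply ENNReal.ofReal_le_ofReal
          refine ((h.abs_average_sub_affine_le hφ).1 x (by linarith)).trans ?_
          gcongr
      _ = (∫⁻ x in ball (0 : E) τ, ‖φ x - ∫ z, η z * φ (x - z)‖ₑ) +
          ENNReal.ofReal (C * τ ^ 2 * I) * volume (ball (0 : E) τ) := by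
          rw [lintegral_add_right _ measurable_const, setLIntegral_const]
      _ ≤ ENNReal.ofReal C * (volume (ball (0 : E) (1 / 2)) * ∫⁻ x, ‖defect M a φ q R x‖ₑ) +
          ENNReal.ofReal (C * τ ^ 2 * I) * volume (ball (0 : E) τ) := by
          gcongr
          refine le_trans ?_ (h.lintegral_sub_average_le ha hφ hR hRm hs)
          exact lintegral_mono_set (ball_subset_ball hτ)
      _ = _ := by
          rw [ENNReal.ofReal_add (by positivity) (by positivity), 
            ENNReal.ofReal_mul (p := C * volume.real (ball (0 : E) (1 / 2))) (by positivity),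
            ENNReal.ofReal_mul (p := C) hC, ENNReal.ofReal_mul (p := C * τ ^ 2 * I) (by positivity),
            ofReal_integral_norm_eq_lintegral_enorm hGi, Measure.real, Measure.real,
            ENNReal.ofReal_toReal measure_ball_lt_top.ne,
            ENNReal.ofReal_toReal measure_ball_lt_top.ne, mul_assoc (ENNReal.ofReal C)]
  exact (ENNReal.ofReal_le_ofReal_iff (by positivity)).1 key

theorem IsEllipticField.integrableOn_norm_sub {l L : ℝ} {a : E → E →L[ℝ] E}
    (ha : IsEllipticField l L a) (M : E →L[ℝ] E) (c : E) (ρ : ℝ) :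
    IntegrableOn (fun x => ‖M - a x‖) (ball c ρ) := by
  refine Integrable.mono' (g := fun _ => ‖M‖ + L) (integrableOn_const measure_ball_lt_top.ne)
    (stronglyMeasurable_const.sub ha.stronglyMeasurable).norm.aestronglyMeasurable
    (ae_of_all _ fun x => ?_)
  rw [norm_norm]
  exact (norm_sub_le _ _).trans (by gcongr; exact ha.norm_le x)

theorem MemLp.integrable_norm_sq {R : E → E} (hR : MemLp R 2) : Integrable fun x => ‖R x‖ ^ 2 :=
  hR.integrable_norm_pow (p := 2) (by norm_num)

/-- Caccioppoli's inequality. -/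
theorem exists_caccioppoli (E : Type*) [NormedAddCommGroup E] [InnerProductSpace ℝ E]
    [FiniteDimensional ℝ E] [MeasurableSpace E] [BorelSpace E] {l L τ : ℝ} (hl : 0 < l)
    (hL : 0 < L) (hτ0 : 0 < τ) (hτ : 2 * τ < 1) :
    ∃ K : ℝ, 0 < K ∧ ∀ (a : E → E →L[ℝ] E) (φ : E → ℝ) (q : E) (R : E → E) (M : E →L[ℝ] E),
      IsEllipticField l L a → ContDiff ℝ ∞ φ → MemLp R 2 → IsWeakSol a φ q R 0 1 → ‖M‖ ≤ L →
      ∫ x in ball (0 : E) τ, ‖∇ φ x‖ ^ 2 ≤ K * ((∫ x in ball (0 : E) (2 * τ), φ x ^ 2) +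
        ‖q‖ ^ 2 * (∫ x in ball (0 : E) 1, ‖M - a x‖) + ∫ x in ball (0 : E) 1, ‖R x‖ ^ 2) := by
  set ζ : ContDiffBump (0 : E) := ⟨τ, 2 * τ, hτ0, by linarith⟩ with hζ
  have hζs : ContDiff ℝ ∞ ζ := ζ.contDiff
  obtain ⟨B, hB⟩ := (ζ.hasCompactSupport.gradient).exists_bound_of_continuous
    (continuous_gradient hζs)
  have hB0 : 0 ≤ B := (norm_nonneg _).trans (hB 0)
  have hζ0 : ∀ x : E, 2 * τ ≤ ‖x‖ → ζ x = 0 := fun x hx => ζ.zero_of_le_dist (by simpa using hx)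
  have hζ1 : ∀ x : E, ‖x‖ ≤ τ → ζ x = 1 := fun x hx =>
    ζ.one_of_mem_closedBall (by simpa using hx)
  set K1 : ℝ := 4 * L ^ 2 / l + 1 with hK1
  set K2 : ℝ := 1 / l + 1 with hK2
  have hK1p : 0 < K1 := by positivity
  have hK2p : 0 < K2 := by positivity
  refine ⟨2 / l * (K1 * B ^ 2 + K2 * (4 * L + 2)), by positivity, ?_⟩
  intro a φ q R M ha hφ hR hs hM
  set ψ : E → ℝ := fun x => ζ x ^ 2 * φ x with hψ
  have hψs : ContDiff ℝ ∞ ψ := (hζs.pow 2).mul hφ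
  have hψg : ∀ x, ∇ ψ x = ζ x • (ζ x • ∇ φ x + (2 : ℝ) • (φ x • ∇ (ζ : E → ℝ) x)) := by
    intro x
    apply HasGradientAt.gradient
    rw [hasGradientAt_iff_hasFDerivAt]
    have h1 := (((hζs.differentiable (by simp) x).hasFDerivAt.pow 2).mul
      (hφ.differentiable (by simp) x).hasFDerivAt)
    refine h1.congr_fderiv ?_
    ext w
    simp
    ring
  have hψ0 : ∀ x, x ∉ closedBall (0 : E) (2 * τ) → ψ x = 0 := fun x hx => by
    simp only [hψ]
    rw [hζ0 x (by simp at hx; exact hx.le)]; simp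
  have hψc : HasCompactSupport ψ := HasCompactSupport.intro (isCompact_closedBall _ _) hψ0
  have hψt : tsupport ψ ⊆ ball (0 : E) 1 :=
    (closure_minimal (fun y hy => by by_contra h'; exact hy (hψ0 y h'))
      isClosed_closedBall).trans (closedBall_subset_ball hτ)
  have hψg0 : ∀ x, x ∉ ball (0 : E) 1 → ∇ ψ x = 0 := fun x hx => by
    rw [hψg, hζ0 x (by simp at hx; linarith)]; simp
  have h0 := hs ψ hψs hψc hψt
  have hMq := integral_inner_gradient_eq_zero hψs hψc (M q)
  rw [← setIntegral_eq_integral_of_forall_compl_eq_zero (s := ball (0 : E) 1)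
    fun x hx => by rw [hψg0 x hx, inner_zero_right]] at h0 hMq
  have hgφ := continuous_gradient hφ
  have hgψ := continuous_gradient hψs
  have hgζ := continuous_gradient hζs
  have hφc := hφ.continuous
  have hζc := hζs.continuous
  have honB : ∀ {f : E → ℝ}, Continuous f → ∀ ρ, IntegrableOn f (ball (0 : E) ρ) :=
    fun hf ρ => (hf.continuousOn.integrableOn_compact (isCompact_closedBall _ _)).mono_set
      ball_subset_closedBall
  have i1 : IntegrableOn (fun x => ⟪a x (∇ φ x + q) + R x, ∇ ψ x⟫) (ball (0 : E) 1) := by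
    obtain ⟨B', hB'⟩ := hψc.gradient.exists_bound_of_continuous hgψ
    have h2 := ha.integrableOn_flux hφ q hR 0 1
    refine (h2.norm.mul_const B').mono' (h2.aestronglyMeasurable.inner
      hgψ.aestronglyMeasurable) (ae_of_all _ fun x => ?_)
    refine (norm_inner_le_norm _ _).trans ?_
    gcongr
    exact hB' x
  have i2 : IntegrableOn (fun x => ⟪M q, ∇ ψ x⟫) (ball (0 : E) 1) := honB (by fun_prop) _
  have i3 : IntegrableOn (fun x => φ x ^ 2) (ball (0 : E) (2 * τ)) := honB (by fun_prop) _
  have i3' : IntegrableOn ((ball (0 : E) (2 * τ)).indicator fun x => φ x ^ 2) (ball (0 : E) 1) :=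
    ((integrable_indicator_iff measurableSet_ball).2 i3).integrableOn
  have i4 := ha.integrableOn_norm_sub M 0 1
  have i5 : IntegrableOn (fun x => ‖R x‖ ^ 2) (ball (0 : E) 1) :=
    (MemLp.integrable_norm_sq hR).integrableOn
  have hpt : ∀ x, l / 2 * ((ball (0 : E) τ).indicator (fun x => ‖∇ φ x‖ ^ 2) x) ≤
      (⟪a x (∇ φ x + q) + R x, ∇ ψ x⟫ - ⟪M q, ∇ ψ x⟫) +
      (K1 * B ^ 2 * (ball (0 : E) (2 * τ)).indicator (fun x => φ x ^ 2) x +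
      K2 * (4 * L * ‖q‖ ^ 2 * ‖M - a x‖ + 2 * ‖R x‖ ^ 2)) := by
    intro x
    have hM2 : ‖M - a x‖ ≤ 2 * L :=
      (norm_sub_le _ _).trans (by linarith [ha.norm_le x])
    set F : E := a x q - M q + R x with hF
    have hFn : ‖F‖ ^ 2 ≤ 4 * L * ‖q‖ ^ 2 * ‖M - a x‖ + 2 * ‖R x‖ ^ 2 := by
      have h1 : ‖a x q - M q‖ ≤ ‖M - a x‖ * ‖q‖ := by
        rw [norm_sub_rev]; exact (M - a x).le_opNorm q
      have h2 : ‖F‖ ≤ ‖M - a x‖ * ‖q‖ + ‖R x‖ := (norm_add_le _ _).trans (by gcongr)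
      have h3 : ‖F‖ ^ 2 ≤ (‖M - a x‖ * ‖q‖ + ‖R x‖) ^ 2 := by gcongr
      have h4 : ‖M - a x‖ * ‖M - a x‖ * ‖q‖ ^ 2 ≤ 2 * L * ‖M - a x‖ * ‖q‖ ^ 2 := by gcongr
      nlinarith [sq_nonneg (‖M - a x‖ * ‖q‖ - ‖R x‖)]
    rcases lt_or_ge ‖x‖ (2 * τ) with hx | hx
    · rw [indicator_of_mem (show x ∈ ball (0 : E) (2 * τ) by simpa using hx)]
      set P : E := ζ x • ∇ φ x with hP
      set Z : E := φ x • ∇ (ζ : E → ℝ) x with hZ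
      have hZn : ‖Z‖ ^ 2 ≤ B ^ 2 * φ x ^ 2 := by
        rw [hZ, norm_smul, mul_pow, Real.norm_eq_abs, sq_abs, mul_comm]
        gcongr
        exact hB x
      have hPn : (ball (0 : E) τ).indicator (fun x => ‖∇ φ x‖ ^ 2) x ≤ ‖P‖ ^ 2 := by
        by_cases hx' : x ∈ ball (0 : E) τ
        · rw [indicator_of_mem hx', hP, hζ1 x (by simpa using (mem_ball.1 hx').le), one_smul]
        · rw [indicator_of_notMem hx']; positivity
      have e1 : ⟪a x (∇ φ x + q) + R x, ∇ ψ x⟫ - ⟪M q, ∇ ψ x⟫ =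
          ⟪a x P, P⟫ + 2 * ⟪a x P, Z⟫ + ζ x * (⟪F, P⟫ + 2 * ⟪F, Z⟫) := by
        rw [hψg, ← hP, ← hZ]
        have : a x P = ζ x • a x (∇ φ x) := by rw [hP, map_smul]
        rw [this, hF]
        simp only [map_add, inner_add_left, inner_add_right, inner_smul_left, inner_smul_right,
          inner_sub_left, conj_trivial]
        ring
      have b1 := ha.le_inner x P
      have b2 : |⟪a x P, Z⟫| ≤ L * ‖P‖ * ‖Z‖ :=
        (abs_real_inner_le_norm _ _).trans (by gcongr; exact ha.norm_apply_le _ _)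
      have b3 := abs_real_inner_le_norm F P
      have b4 := abs_real_inner_le_norm F Z
      have b5 : |ζ x * (⟪F, P⟫ + 2 * ⟪F, Z⟫)| ≤ ‖F‖ * ‖P‖ + 2 * (‖F‖ * ‖Z‖) := by
        rw [abs_mul, abs_of_nonneg ζ.nonneg]
        calc _ ≤ 1 * (|⟪F, P⟫| + |2 * ⟪F, Z⟫|) := by
              gcongr
              · exact ζ.le_one
              · exact abs_add_le _ _
          _ ≤ _ := by
              rw [one_mul, abs_mul]
              norm_num
              linarith
      have c1 : 2 * L * ‖P‖ * ‖Z‖ ≤ l / 4 * ‖P‖ ^ 2 + 4 * L ^ 2 / l * ‖Z‖ ^ 2 := by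
        have : l / 4 * ‖P‖ ^ 2 + 4 * L ^ 2 / l * ‖Z‖ ^ 2 - 2 * L * ‖P‖ * ‖Z‖ =
          (l * ‖P‖ - 4 * L * ‖Z‖) ^ 2 / (4 * l) := by field_simp; ring
        have : 0 ≤ (l * ‖P‖ - 4 * L * ‖Z‖) ^ 2 / (4 * l) := by positivity
        linarith
      have c2 : ‖F‖ * ‖P‖ ≤ l / 4 * ‖P‖ ^ 2 + 1 / l * ‖F‖ ^ 2 := by
        have : l / 4 * ‖P‖ ^ 2 + 1 / l * ‖F‖ ^ 2 - ‖F‖ * ‖P‖ =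
          (l * ‖P‖ - 2 * ‖F‖) ^ 2 / (4 * l) := by field_simp; ring
        have : 0 ≤ (l * ‖P‖ - 2 * ‖F‖) ^ 2 / (4 * l) := by positivity
        linarith
      have c3 : 2 * (‖F‖ * ‖Z‖) ≤ ‖F‖ ^ 2 + ‖Z‖ ^ 2 := by nlinarith [sq_nonneg (‖F‖ - ‖Z‖)]
      have d1 : l / 2 * (ball (0 : E) τ).indicator (fun x => ‖∇ φ x‖ ^ 2) x ≤
          l / 2 * ‖P‖ ^ 2 := by gcongr
      have d2 : K1 * ‖Z‖ ^ 2 ≤ K1 * B ^ 2 * φ x ^ 2 := by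
        rw [mul_assoc]; gcongr
      have d3 : K2 * ‖F‖ ^ 2 ≤ K2 * (4 * L * ‖q‖ ^ 2 * ‖M - a x‖ + 2 * ‖R x‖ ^ 2) := by gcongr
      have d4 : K1 * ‖Z‖ ^ 2 = 4 * L ^ 2 / l * ‖Z‖ ^ 2 + ‖Z‖ ^ 2 := by rw [hK1]; ring
      have d5 : K2 * ‖F‖ ^ 2 = 1 / l * ‖F‖ ^ 2 + ‖F‖ ^ 2 := by rw [hK2]; ring
      rw [e1]
      linarith [neg_abs_le ⟪a x P, Z⟫, neg_abs_le (ζ x * (⟪F, P⟫ + 2 * ⟪F, Z⟫))]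
    · rw [indicator_of_notMem (by simp; linarith), indicator_of_notMem (by simpa using hx), hψg,
        hζ0 x hx]
      simp only [zero_smul, inner_zero_right]
      have : 0 ≤ ‖M - a x‖ := norm_nonneg _
      have : 0 ≤ K2 * (4 * L * ‖q‖ ^ 2 * ‖M - a x‖ + 2 * ‖R x‖ ^ 2) := by positivity
      linarith
  have hsub : ball (0 : E) τ ⊆ ball 0 1 := ball_subset_ball (by linarith)
  have hsub2 : ball (0 : E) (2 * τ) ⊆ ball 0 1 := ball_subset_ball hτ.le
  have iL : IntegrableOn (fun x => l / 2 * ((ball (0 : E) τ).indicator (fun x => ‖∇ φ x‖ ^ 2) x))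
      (ball (0 : E) 1) := by
    refine Integrable.const_mul (Integrable.integrableOn ?_) _
    exact (integrable_indicator_iff measurableSet_ball).2 (honB (by fun_prop) _)
  have i12 : IntegrableOn (fun x => ⟪a x (∇ φ x + q) + R x, ∇ ψ x⟫ - ⟪M q, ∇ ψ x⟫)
      (ball (0 : E) 1) := i1.sub i2
  have i3c : IntegrableOn (fun x => K1 * B ^ 2 *
    (ball (0 : E) (2 * τ)).indicator (fun x => φ x ^ 2) x) (ball (0 : E) 1) := i3'.const_mul _
  have i4c : IntegrableOn (fun x => 4 * L * ‖q‖ ^ 2 * ‖M - a x‖) (ball (0 : E) 1) := i4.const_mul _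
  have i5c : IntegrableOn (fun x => 2 * ‖R x‖ ^ 2) (ball (0 : E) 1) := i5.const_mul _
  have i45 : IntegrableOn (fun x => K2 * (4 * L * ‖q‖ ^ 2 * ‖M - a x‖ + 2 * ‖R x‖ ^ 2))
    (ball (0 : E) 1) := (i4c.add i5c).const_mul _
  have i345 : IntegrableOn (fun x => K1 * B ^ 2 *
    (ball (0 : E) (2 * τ)).indicator (fun x => φ x ^ 2) x +
      K2 * (4 * L * ‖q‖ ^ 2 * ‖M - a x‖ + 2 * ‖R x‖ ^ 2)) (ball (0 : E) 1) := i3c.add i45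
  have hI := setIntegral_mono_on iL (i12.add i345) measurableSet_ball fun x _ => hpt x
  rw [integral_const_mul, setIntegral_indicator measurableSet_ball,
    inter_eq_self_of_subset_right hsub] at hI
  have hI2 : ∫ x in ball (0 : E) 1, ((⟪a x (∇ φ x + q) + R x, ∇ ψ x⟫ - ⟪M q, ∇ ψ x⟫) +
      (K1 * B ^ 2 * (ball (0 : E) (2 * τ)).indicator (fun x => φ x ^ 2) x +
      K2 * (4 * L * ‖q‖ ^ 2 * ‖M - a x‖ + 2 * ‖R x‖ ^ 2))) =
      K1 * B ^ 2 * (∫ x in ball (0 : E) (2 * τ), φ x ^ 2) +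
      K2 * (4 * L * ‖q‖ ^ 2 * (∫ x in ball (0 : E) 1, ‖M - a x‖) +
        2 * ∫ x in ball (0 : E) 1, ‖R x‖ ^ 2) := by
    rw [integral_add i12 i345, integral_sub i1 i2, h0, hMq, integral_add i3c i45,
      integral_const_mul, setIntegral_indicator measurableSet_ball,
      inter_eq_self_of_subset_right hsub2, integral_const_mul, integral_add i4c i5c,
      integral_const_mul, integral_const_mul]
    ring
  have hI3 := hI.trans_eq hI2
  have n1 : 0 ≤ ∫ x in ball (0 : E) (2 * τ), φ x ^ 2 := integral_nonneg fun _ => sq_nonneg _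
  have n2 : 0 ≤ ∫ x in ball (0 : E) 1, ‖M - a x‖ := integral_nonneg fun _ => norm_nonneg _
  have n3 : 0 ≤ ∫ x in ball (0 : E) 1, ‖R x‖ ^ 2 := integral_nonneg fun _ => sq_nonneg _
  set X := ∫ x in ball (0 : E) (2 * τ), φ x ^ 2
  set Y := ∫ x in ball (0 : E) 1, ‖M - a x‖
  set W := ∫ x in ball (0 : E) 1, ‖R x‖ ^ 2
  have hfin : K1 * B ^ 2 * X + K2 * (4 * L * ‖q‖ ^ 2 * Y + 2 * W) ≤
      (K1 * B ^ 2 + K2 * (4 * L + 2)) * (X + ‖q‖ ^ 2 * Y + W) := by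
    have a1 : 0 ≤ K1 * B ^ 2 * (‖q‖ ^ 2 * Y + W) := by positivity
    have a2 : 0 ≤ K2 * ((4 * L + 2) * X + 2 * (‖q‖ ^ 2 * Y) + 4 * L * W) := by positivity
    linarith
  have hl2 : ∫ x in ball (0 : E) τ, ‖∇ φ x‖ ^ 2 =
      2 / l * (l / 2 * ∫ x in ball (0 : E) τ, ‖∇ φ x‖ ^ 2) := by field_simp
  rw [hl2, mul_assoc (2 / l)]
  exact mul_le_mul_of_nonneg_left (hI3.trans hfin) (by positivity)

theorem sq_integral_mul_le {α : Type*} [MeasurableSpace α] {μ : Measure α} {f g : α → ℝ}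
    (hf : AEStronglyMeasurable f μ) (hg : AEStronglyMeasurable g μ)
    (hf2 : Integrable (fun x => f x ^ 2) μ) (hg2 : Integrable (fun x => g x ^ 2) μ) :
    (∫ x, f x * g x ∂μ) ^ 2 ≤ (∫ x, f x ^ 2 ∂μ) * ∫ x, g x ^ 2 ∂μ := by
  have hfg : Integrable (fun x => f x * g x) μ := by
    refine (hf2.add hg2).mono' (hf.mul hg) (ae_of_all _ fun x => ?_)
    simp only [Pi.add_apply]
    rw [Real.norm_eq_abs, abs_le]
    constructor <;> nlinarith [sq_nonneg (f x + g x), sq_nonneg (f x - g x)]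
  have h : ∀ t : ℝ, 0 ≤ (∫ x, g x ^ 2 ∂μ) * (t * t) + (2 * ∫ x, f x * g x ∂μ) * t +
      ∫ x, f x ^ 2 ∂μ := by
    intro t
    have e : ∫ x, (f x + t * g x) ^ 2 ∂μ = (∫ x, g x ^ 2 ∂μ) * (t * t) +
        (2 * ∫ x, f x * g x ∂μ) * t + ∫ x, f x ^ 2 ∂μ := by
      have : ∀ x, (f x + t * g x) ^ 2 = t * t * g x ^ 2 + 2 * t * (f x * g x) + f x ^ 2 :=
        fun x => by ring
      simp only [this]
      rw [integral_add, integral_add, integral_const_mul, integral_const_mul]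
      · ring
      · exact hg2.const_mul _
      · exact hfg.const_mul _
      · exact (hg2.const_mul _).add (hfg.const_mul _)
      · exact hf2
    rw [← e]
    exact integral_nonneg fun x => sq_nonneg _
  have := discrim_le_zero h
  rw [discrim] at this
  nlinarith

theorem sq_integral_le {α : Type*} [MeasurableSpace α] {μ : Measure α} [IsFiniteMeasure μ]
    {f : α → ℝ} (hf : AEStronglyMeasurable f μ) (hf2 : Integrable (fun x => f x ^ 2) μ) :
    (∫ x, f x ∂μ) ^ 2 ≤ μ.real univ * ∫ x, f x ^ 2 ∂μ := by
  have := sq_integral_mul_le hf (aestronglyMeasurable_const (b := (1 : ℝ))) hf2 (by simp)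
  simpa [mul_comm] using this

theorem lintegral_segment_le' {g : E → ENNReal} (hg : Measurable g) (S Z : Set E) :
    ∫⁻ x in S, ∫⁻ z in Z, ∫⁻ s in Ioc (0 : ℝ) 1, g (x - s • z) ≤
      volume Z * ∫⁻ x, g x := by
  refine le_trans (le_of_eq ?_) (lintegral_segment_le hg S Z)
  refine lintegral_congr fun x => ?_
  exact lintegral_lintegral_swap (hg.comp (by fun_prop)).aemeasurable

theorem sq_sub_le_integral_gradient {φ : E → ℝ} (hφ : ContDiff ℝ ∞ φ) (x z : E) :
    (φ x - φ (x - z)) ^ 2 ≤ ‖z‖ ^ 2 * ∫ s in Ioc (0 : ℝ) 1, ‖∇ φ (x - s • z)‖ ^ 2 := by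
  have hg := continuous_gradient hφ
  have hcI : ∀ {f : ℝ → ℝ}, Continuous f → IntegrableOn f (Ioc (0 : ℝ) 1) := fun hf =>
    (hf.continuousOn.integrableOn_compact (isCompact_Icc (a := (0 : ℝ)) (b := 1))).mono_set
      Ioc_subset_Icc_self
  have h1 : φ x - φ (x - z) = ∫ s in Ioc (0 : ℝ) 1, ⟪∇ φ (x - s • z), z⟫ := by
    rw [← intervalIntegral.integral_of_le zero_le_one,
      ← neg_eq_iff_eq_neg.2 (sub_eq_integral_gradient hφ x z)]
    ring
  have hc : Continuous fun s : ℝ => ⟪∇ φ (x - s • z), z⟫ := by fun_prop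
  have h2 := sq_integral_le (μ := volume.restrict (Ioc (0 : ℝ) 1)) hc.aestronglyMeasurable
    (hcI (hc.pow 2))
  rw [← h1] at h2
  simp only [measureReal_restrict_apply_univ, Real.volume_real_Ioc, sub_zero] at h2
  refine h2.trans ?_
  rw [max_eq_left zero_le_one, one_mul, ← integral_const_mul]
  refine setIntegral_mono_on (hcI (hc.pow 2)) (hcI (by fun_prop)) measurableSet_Ioc fun s _ => ?_
  rw [← mul_pow, ← sq_abs]
  have := abs_real_inner_le_norm (∇ φ (x - s • z)) z
  rw [mul_comm ‖z‖]
  gcongr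

theorem abs_sub_le_integral_gradient {φ : E → ℝ} (hφ : ContDiff ℝ ∞ φ) (x z : E) :
    |φ x - φ (x - z)| ≤ ‖z‖ * ∫ s in Ioc (0 : ℝ) 1, ‖∇ φ (x - s • z)‖ := by
  have hg := continuous_gradient hφ
  have hcI : ∀ {f : ℝ → ℝ}, Continuous f → IntegrableOn f (Ioc (0 : ℝ) 1) := fun hf =>
    (hf.continuousOn.integrableOn_compact (isCompact_Icc (a := (0 : ℝ)) (b := 1))).mono_set
      Ioc_subset_Icc_self
  have h1 : φ x - φ (x - z) = ∫ s in Ioc (0 : ℝ) 1, ⟪∇ φ (x - s • z), z⟫ := by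
    rw [← intervalIntegral.integral_of_le zero_le_one,
      ← neg_eq_iff_eq_neg.2 (sub_eq_integral_gradient hφ x z)]
    ring
  rw [h1, ← integral_const_mul, ← Real.norm_eq_abs]
  refine norm_integral_le_of_norm_le (hcI (by fun_prop)) (ae_of_all _ fun s => ?_)
  rw [mul_comm]
  exact norm_inner_le_norm _ _

/-- The square integral on a smaller ball is controlled by a small multiple of the Dirichlet
integral and the `L¹` norm. -/
theorem integral_sq_le_of_gradient (δ : ℝ) (hδ0 : 0 < δ) (hδ : δ ≤ 1 / 4) {φ : E → ℝ}
    (hφ : ContDiff ℝ ∞ φ) :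
    ∫ x in ball (0 : E) (1 / 4), φ x ^ 2 ≤ 2 * δ ^ 2 * (∫ x in ball (0 : E) 1, ‖∇ φ x‖ ^ 2) +
      2 * volume.real (ball (0 : E) (1 / 4)) / volume.real (ball (0 : E) δ) ^ 2 *
        (∫ x in ball (0 : E) 1, |φ x|) ^ 2 := by
  set V := volume.real (ball (0 : E) δ) with hV
  have hVpos : 0 < V := ENNReal.toReal_pos (measure_ball_pos _ _ hδ0).ne' measure_ball_lt_top.ne
  set e := ∫ x in ball (0 : E) 1, |φ x| with he
  have he0 : 0 ≤ e := integral_nonneg fun _ => abs_nonneg _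
  have hg := continuous_gradient hφ
  have hφc := hφ.continuous
  have honB : ∀ {f : E → ℝ}, Continuous f → ∀ ρ, IntegrableOn f (ball (0 : E) ρ) :=
    fun hf ρ => (hf.continuousOn.integrableOn_compact (isCompact_closedBall _ _)).mono_set
      ball_subset_closedBall
  set g : E → ENNReal := (ball (0 : E) 1).indicator fun x => ENNReal.ofReal (‖∇ φ x‖ ^ 2) with hgd
  have hgm : Measurable g :=
    (ENNReal.continuous_ofReal.comp (by fun_prop :
      Continuous fun x => ‖∇ φ x‖ ^ 2)).measurable.indicator measurableSet_ball
  have hgI : ∫⁻ x, g x = ENNReal.ofReal (∫ x in ball (0 : E) 1, ‖∇ φ x‖ ^ 2) := by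
    rw [hgd, lintegral_indicator measurableSet_ball, ofReal_integral_eq_lintegral_ofReal
      (honB (by fun_prop) _) (ae_of_all _ fun x => sq_nonneg _)]
  have hpt : ∀ x ∈ ball (0 : E) (1 / 4), ENNReal.ofReal (φ x ^ 2) ≤
      ENNReal.ofReal (2 * δ ^ 2 / V) * (∫⁻ z in ball (0 : E) δ, ∫⁻ s in Ioc (0 : ℝ) 1,
        g (x - s • z)) + ENNReal.ofReal (2 * e ^ 2 / V ^ 2) := by
    intro x hx
    have hx' : ‖x‖ < 1 / 4 := by simpa using hx
    have c1 : Continuous fun z => φ x - φ (x - z) := by fun_prop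
    have c2 : Continuous fun z => φ (x - z) := by fun_prop
    set S := ∫ z in ball (0 : E) δ, (φ x - φ (x - z)) ^ 2 with hS
    have h1 : V * φ x = (∫ z in ball (0 : E) δ, (φ x - φ (x - z))) +
        ∫ z in ball (0 : E) δ, φ (x - z) := by
      rw [← integral_add (honB c1 _) (honB c2 _)]
      simp [hV]
    have h2 : (∫ z in ball (0 : E) δ, (φ x - φ (x - z))) ^ 2 ≤ V * S := by
      have : IsFiniteMeasure (volume.restrict (ball (0 : E) δ)) :=
        ⟨by rw [Measure.restrict_apply_univ]; exact measure_ball_lt_top⟩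
      have := sq_integral_le (μ := volume.restrict (ball (0 : E) δ)) c1.aestronglyMeasurable
        (honB (c1.pow 2) _)
      simpa [hV] using this
    have h3 : |∫ z in ball (0 : E) δ, φ (x - z)| ≤ e := by
      calc |∫ z in ball (0 : E) δ, φ (x - z)| ≤ ∫ z in ball (0 : E) δ, |φ (x - z)| :=
            abs_integral_le_integral_abs
        _ = ∫ z, (ball (0 : E) δ).indicator (fun z => |φ (x - z)|) z :=
            (integral_indicator measurableSet_ball).symm
        _ ≤ ∫ z, (ball (0 : E) 1).indicator (fun z => |φ z|) (x - z) := by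
            refine integral_mono_of_nonneg (ae_of_all _ fun z =>
              indicator_nonneg (fun _ _ => abs_nonneg _) _) ?_ (ae_of_all _ fun z => ?_)
            · refine Integrable.comp_sub_left
                (f := (ball (0 : E) 1).indicator fun z => |φ z|) ?_ x
              exact (integrable_indicator_iff measurableSet_ball).2 (honB (by fun_prop) _)
            · by_cases hz : z ∈ ball (0 : E) δ
              · have hz' : ‖z‖ < δ := by simpa using hz
                have : x - z ∈ ball (0 : E) 1 := by
                  rw [mem_ball_zero_iff]
                  linarith [norm_sub_le x z]
                simp only [indicator_of_mem hz, indicator_of_mem this, le_refl]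
              · simp only [indicator_of_notMem hz]
                exact indicator_nonneg (fun _ _ => abs_nonneg _) _
        _ = e := by
            rw [integral_sub_left_eq_self (f := (ball (0 : E) 1).indicator fun z => |φ z|),
              integral_indicator measurableSet_ball]
    have h4 : φ x ^ 2 ≤ 2 / V * S + 2 * e ^ 2 / V ^ 2 := by
      have a1 : (∫ z in ball (0 : E) δ, φ (x - z)) ^ 2 ≤ e ^ 2 :=
        sq_le_sq' (abs_le.1 h3).1 (abs_le.1 h3).2
      have a2 : (V * φ x) ^ 2 ≤ 2 * (V * S) + 2 * e ^ 2 := by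
        rw [h1]
        nlinarith [sq_nonneg ((∫ z in ball (0 : E) δ, (φ x - φ (x - z))) -
          ∫ z in ball (0 : E) δ, φ (x - z))]
      have a3 : 2 / V * S + 2 * e ^ 2 / V ^ 2 = (2 * (V * S) + 2 * e ^ 2) / V ^ 2 := by
        field_simp
      rw [a3, le_div_iff₀ (by positivity)]
      linarith
    have h5 : ENNReal.ofReal S ≤ ENNReal.ofReal (δ ^ 2) * ∫⁻ z in ball (0 : E) δ,
        ∫⁻ s in Ioc (0 : ℝ) 1, g (x - s • z) := by
      rw [hS, ofReal_integral_eq_lintegral_ofReal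
        (honB (f := fun z => (φ x - φ (x - z)) ^ 2) (by fun_prop) δ)
        (ae_of_all _ fun x => sq_nonneg _), ← lintegral_const_mul' _ _ ENNReal.ofReal_ne_top]
      refine setLIntegral_mono' measurableSet_ball fun z hz => ?_
      have hz' : ‖z‖ < δ := by simpa using hz
      have b1 : (φ x - φ (x - z)) ^ 2 ≤ δ ^ 2 * ∫ s in Ioc (0 : ℝ) 1, ‖∇ φ (x - s • z)‖ ^ 2 := by
        refine (sq_sub_le_integral_gradient hφ x z).trans ?_
        gcongr
      refine (ENNReal.ofReal_le_ofReal b1).trans ?_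
      rw [ENNReal.ofReal_mul (by positivity), ofReal_integral_eq_lintegral_ofReal]
      · refine mul_le_mul_right ?_ _
        refine setLIntegral_mono' measurableSet_Ioc fun s hs => ?_
        have : x - s • z ∈ ball (0 : E) 1 := by
          rw [mem_ball_zero_iff]
          have b2 := norm_sub_le x (s • z)
          rw [norm_smul, Real.norm_of_nonneg hs.1.le] at b2
          have b3 : s * ‖z‖ ≤ 1 * ‖z‖ := by gcongr; exact hs.2
          linarith
        rw [hgd, indicator_of_mem this]
      · have : Continuous fun s : ℝ => ‖∇ φ (x - s • z)‖ ^ 2 := by fun_prop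
        exact (this.continuousOn.integrableOn_compact (μ := volume)
          (isCompact_Icc (a := (0 : ℝ)) (b := 1))).mono_set Ioc_subset_Icc_self
      · exact ae_of_all _ fun s => sq_nonneg _
    have hS0 : 0 ≤ S := integral_nonneg fun _ => sq_nonneg _
    calc ENNReal.ofReal (φ x ^ 2) ≤ ENNReal.ofReal (2 / V * S + 2 * e ^ 2 / V ^ 2) :=
          ENNReal.ofReal_le_ofReal h4
      _ = ENNReal.ofReal (2 / V) * ENNReal.ofReal S + ENNReal.ofReal (2 * e ^ 2 / V ^ 2) := by
          rw [ENNReal.ofReal_add (by positivity) (by positivity),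
            ENNReal.ofReal_mul (by positivity)]
      _ ≤ ENNReal.ofReal (2 / V) * (ENNReal.ofReal (δ ^ 2) * ∫⁻ z in ball (0 : E) δ,
            ∫⁻ s in Ioc (0 : ℝ) 1, g (x - s • z)) + ENNReal.ofReal (2 * e ^ 2 / V ^ 2) := by
          gcongr
      _ = _ := by
          rw [← mul_assoc, ← ENNReal.ofReal_mul (by positivity)]
          congr 3
          ring
  have hD0 : 0 ≤ ∫ x in ball (0 : E) 1, ‖∇ φ x‖ ^ 2 := integral_nonneg fun _ => sq_nonneg _
  refine (ENNReal.ofReal_le_ofReal_iff (by positivity)).1 ?_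
  rw [ofReal_integral_eq_lintegral_ofReal (honB (by fun_prop) _) (ae_of_all _ fun x => sq_nonneg _)]
  calc _ ≤ ∫⁻ x in ball (0 : E) (1 / 4), (ENNReal.ofReal (2 * δ ^ 2 / V) *
        (∫⁻ z in ball (0 : E) δ, ∫⁻ s in Ioc (0 : ℝ) 1, g (x - s • z)) +
          ENNReal.ofReal (2 * e ^ 2 / V ^ 2)) := setLIntegral_mono' measurableSet_ball hpt
    _ ≤ ENNReal.ofReal (2 * δ ^ 2 / V) * (volume (ball (0 : E) δ) *
        ENNReal.ofReal (∫ x in ball (0 : E) 1, ‖∇ φ x‖ ^ 2)) +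
          ENNReal.ofReal (2 * e ^ 2 / V ^ 2) * volume (ball (0 : E) (1 / 4)) := by
        rw [lintegral_add_right _ measurable_const, setLIntegral_const,
          lintegral_const_mul' _ _ ENNReal.ofReal_ne_top, ← hgI]
        gcongr
        exact lintegral_segment_le' hgm _ _
    _ = _ := by
        rw [← ENNReal.ofReal_toReal (measure_ball_lt_top (μ := volume) (x := (0 : E)) (r := δ)).ne,
          ← ENNReal.ofReal_toReal
            (measure_ball_lt_top (μ := volume) (x := (0 : E)) (r := 1 / 4)).ne,
          ← ENNReal.ofReal_mul (by positivity), ← ENNReal.ofReal_mul (by positivity),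
          ← ENNReal.ofReal_mul (by positivity),
          ← ENNReal.ofReal_add (by positivity) (by positivity)]
        change ENNReal.ofReal (2 * δ ^ 2 / V * (V * _) +
          2 * e ^ 2 / V ^ 2 * volume.real (ball (0 : E) (1 / 4))) = _
        congr 1
        field_simp

/-- Poincaré's inequality on the unit ball. -/
theorem exists_integral_abs_sub_le (E : Type*) [NormedAddCommGroup E] [InnerProductSpace ℝ E]
    [FiniteDimensional ℝ E] [MeasurableSpace E] [BorelSpace E] :
    ∃ C : ℝ, 0 < C ∧ ∀ φ : E → ℝ, ContDiff ℝ ∞ φ →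
      ∃ c : ℝ, ∫ x in ball (0 : E) 1, |φ x - c| ≤ C * ∫ x in ball (0 : E) 1, ‖∇ φ x‖ := by
  set V := volume.real (ball (0 : E) 1) with hV
  set V2 := volume.real (ball (0 : E) 2) with hV2
  have hVpos : 0 < V := ENNReal.toReal_pos (measure_ball_pos _ _ one_pos).ne' measure_ball_lt_top.ne
  have hV2pos : 0 < V2 :=
    ENNReal.toReal_pos (measure_ball_pos _ _ two_pos).ne' measure_ball_lt_top.ne
  refine ⟨2 * V2 / V, by positivity, fun φ hφ => ?_⟩
  have hg := continuous_gradient hφ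
  have hφc := hφ.continuous
  have honB : ∀ {f : E → ℝ}, Continuous f → ∀ ρ, IntegrableOn f (ball (0 : E) ρ) :=
    fun hf ρ => (hf.continuousOn.integrableOn_compact (isCompact_closedBall _ _)).mono_set
      ball_subset_closedBall
  set g : E → ENNReal := (ball (0 : E) 1).indicator fun x => ENNReal.ofReal ‖∇ φ x‖ with hgd
  have hgm : Measurable g :=
    (ENNReal.continuous_ofReal.comp (by fun_prop :
      Continuous fun x => ‖∇ φ x‖)).measurable.indicator measurableSet_ball
  have hgI : ∫⁻ x, g x = ENNReal.ofReal (∫ x in ball (0 : E) 1, ‖∇ φ x‖) := by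
    rw [hgd, lintegral_indicator measurableSet_ball, ofReal_integral_eq_lintegral_ofReal
      (honB (by fun_prop) _) (ae_of_all _ fun x => norm_nonneg _)]
  set m := V⁻¹ * ∫ y in ball (0 : E) 1, φ y with hm
  refine ⟨m, ?_⟩
  have hpt : ∀ x ∈ ball (0 : E) 1, ENNReal.ofReal |φ x - m| ≤
      ENNReal.ofReal (2 / V) * ∫⁻ z in ball (0 : E) 2, ∫⁻ s in Ioc (0 : ℝ) 1, g (x - s • z) := by
    intro x hx
    have hx' : ‖x‖ < 1 := by simpa using hx
    have c1 : Continuous fun y => φ x - φ y := by fun_prop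
    have h1 : φ x - m = V⁻¹ * ∫ y in ball (0 : E) 1, (φ x - φ y) := by
      rw [integral_sub (honB continuous_const _) (honB hφc _), hm]
      simp only [integral_const, measureReal_restrict_apply_univ, smul_eq_mul, ← hV]
      field_simp
    have h2 : |φ x - m| ≤ V⁻¹ * ∫ y in ball (0 : E) 1, |φ x - φ y| := by
      rw [h1, abs_mul, abs_of_pos (inv_pos.2 hVpos)]
      gcongr
      exact abs_integral_le_integral_abs
    have h3 : ENNReal.ofReal (∫ y in ball (0 : E) 1, |φ x - φ y|) ≤
        ENNReal.ofReal 2 * ∫⁻ z in ball (0 : E) 2, ∫⁻ s in Ioc (0 : ℝ) 1, g (x - s • z) := by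
      rw [ofReal_integral_eq_lintegral_ofReal
        (honB (f := fun y => |φ x - φ y|) (by fun_prop) 1) (ae_of_all _ fun _ => abs_nonneg _),
        ← lintegral_indicator measurableSet_ball,
        ← lintegral_sub_left_eq_self _ x,
        ← lintegral_const_mul' _ _ ENNReal.ofReal_ne_top, ← lintegral_indicator measurableSet_ball]
      refine lintegral_mono fun z => ?_
      by_cases hz : x - z ∈ ball (0 : E) 1
      · have hz1 : ‖x - z‖ < 1 := by simpa using hz
        have hz2 : ‖z‖ < 2 := by
          have := norm_sub_le x (x - z)
          rw [sub_sub_cancel] at this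
          linarith
        have hz3 : z ∈ ball (0 : E) 2 := by simpa using hz2
        simp only [indicator_of_mem hz, indicator_of_mem hz3]
        have b1 : |φ x - φ (x - z)| ≤ 2 * ∫ s in Ioc (0 : ℝ) 1, ‖∇ φ (x - s • z)‖ := by
          refine (abs_sub_le_integral_gradient hφ x z).trans ?_
          gcongr
        refine (ENNReal.ofReal_le_ofReal b1).trans ?_
        rw [ENNReal.ofReal_mul (by positivity), ofReal_integral_eq_lintegral_ofReal]
        · refine mul_le_mul_right ?_ _
          refine setLIntegral_mono' measurableSet_Ioc fun s hs => ?_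
          have : x - s • z ∈ ball (0 : E) 1 := by
            have := (convex_ball (0 : E) 1) hx hz (sub_nonneg.2 hs.2) hs.1.le (by ring)
            convert this using 1
            module
          rw [hgd, indicator_of_mem this]
        · have : Continuous fun s : ℝ => ‖∇ φ (x - s • z)‖ := by fun_prop
          exact (this.continuousOn.integrableOn_compact
            (isCompact_Icc (a := (0 : ℝ)) (b := 1))).mono_set Ioc_subset_Icc_self
        · exact ae_of_all _ fun s => norm_nonneg _
      · simp only [indicator_of_notMem hz, zero_le]
    calc ENNReal.ofReal |φ x - m|
        ≤ ENNReal.ofReal (V⁻¹ * ∫ y in ball (0 : E) 1, |φ x - φ y|) := ENNReal.ofReal_le_ofReal h2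
      _ = ENNReal.ofReal V⁻¹ * ENNReal.ofReal (∫ y in ball (0 : E) 1, |φ x - φ y|) :=
          ENNReal.ofReal_mul (by positivity)
      _ ≤ ENNReal.ofReal V⁻¹ * (ENNReal.ofReal 2 * _) := by gcongr
      _ = _ := by
          rw [← mul_assoc, ← ENNReal.ofReal_mul (by positivity)]
          congr 2
          field_simp
  have hD0 : 0 ≤ ∫ x in ball (0 : E) 1, ‖∇ φ x‖ := integral_nonneg fun _ => norm_nonneg _
  refine (ENNReal.ofReal_le_ofReal_iff (by positivity)).1 ?_
  rw [ofReal_integral_eq_lintegral_ofReal (honB (by fun_prop) _)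
    (ae_of_all _ fun x => abs_nonneg _)]
  calc _ ≤ ∫⁻ x in ball (0 : E) 1, ENNReal.ofReal (2 / V) *
        (∫⁻ z in ball (0 : E) 2, ∫⁻ s in Ioc (0 : ℝ) 1, g (x - s • z)) :=
        setLIntegral_mono' measurableSet_ball hpt
    _ ≤ ENNReal.ofReal (2 / V) * (volume (ball (0 : E) 2) *
        ENNReal.ofReal (∫ x in ball (0 : E) 1, ‖∇ φ x‖)) := by
        rw [lintegral_const_mul' _ _ ENNReal.ofReal_ne_top, ← hgI]
        gcongr
        exact lintegral_segment_le' hgm _ _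
    _ = _ := by
        rw [← ENNReal.ofReal_toReal (measure_ball_lt_top (μ := volume) (x := (0 : E)) (r := 2)).ne,
          ← ENNReal.ofReal_mul (by positivity), ← ENNReal.ofReal_mul (by positivity)]
        change ENNReal.ofReal (2 / V * (V2 * _)) = _
        congr 1
        ring

theorem continuous_integrableOn_ball {F : Type*} [NormedAddCommGroup F] {f : E → F}
    (hf : Continuous f) (c : E) (ρ : ℝ) : IntegrableOn f (ball c ρ) :=
  (hf.continuousOn.integrableOn_compact (isCompact_closedBall c ρ)).mono_set
    ball_subset_closedBall

theorem setIntegral_le_of_sq {S : Set E} (hS : volume S < ⊤) {f : E → ℝ} {r : ℝ} (hr : 0 ≤ r)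
    (hf : AEStronglyMeasurable f (volume.restrict S)) (hf2 : IntegrableOn (fun x => f x ^ 2) S)
    (h : ∫ x in S, f x ^ 2 ≤ r ^ 2) : ∫ x in S, f x ≤ (volume.real S + 1) * r := by
  have : IsFiniteMeasure (volume.restrict S) := ⟨by rwa [Measure.restrict_apply_univ]⟩
  have h1 := sq_integral_le hf hf2
  rw [measureReal_restrict_apply_univ] at h1
  refine abs_le_of_sq_le_sq' (h1.trans ?_) (by positivity) |>.2
  have hV : 0 ≤ volume.real S := measureReal_nonneg
  calc _ ≤ volume.real S * r ^ 2 := by gcongr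
    _ ≤ _ := by
      rw [mul_pow]
      gcongr
      nlinarith

theorem IsEllipticField.integral_norm_defect_le {l L : ℝ} {a : E → E →L[ℝ] E}
    (ha : IsEllipticField l L a) (hL : 0 < L) {φ : E → ℝ} (hφ : ContDiff ℝ ∞ φ) (q : E)
    {R : E → E} (hR : MemLp R 2) {M : E →L[ℝ] E} (hM : ‖M‖ ≤ L) {D r s : ℝ} (hD0 : 0 ≤ D)
    (hr0 : 0 ≤ r) (hs0 : 0 ≤ s) (hD : ∫ x in ball (0 : E) 1, ‖∇ φ x‖ ^ 2 ≤ D ^ 2)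
    (hr : ∫ x in ball (0 : E) 1, ‖R x‖ ^ 2 ≤ r ^ 2)
    (hs : ∫ x in ball (0 : E) 1, ‖M - a x‖ ≤ s ^ 2) :
    ∫ x, ‖defect M a φ q R x‖ ≤
      (2 * L + 1) * s * D + ‖q‖ * s ^ 2 + (volume.real (ball (0 : E) 1) + 1) * r := by
  have hg := continuous_gradient hφ
  have hA : AEStronglyMeasurable (fun x => ‖M - a x‖) (volume.restrict (ball (0 : E) 1)) :=
    (stronglyMeasurable_const.sub ha.stronglyMeasurable).norm.aestronglyMeasurable
  have hMa : ∀ x, ‖M - a x‖ ≤ 2 * L := fun x =>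
    (norm_sub_le _ _).trans (by linarith [ha.norm_le x])
  have iA := ha.integrableOn_norm_sub M 0 1
  have iA2 : IntegrableOn (fun x => ‖M - a x‖ ^ 2) (ball (0 : E) 1) := by
    refine (iA.const_mul (2 * L)).mono' (hA.pow 2) (ae_of_all _ fun x => ?_)
    rw [Real.norm_of_nonneg (sq_nonneg _), sq]
    gcongr
    exact hMa x
  have iG2 : IntegrableOn (fun x => ‖∇ φ x‖ ^ 2) (ball (0 : E) 1) :=
    continuous_integrableOn_ball (by fun_prop) _ _
  have iAG : IntegrableOn (fun x => ‖M - a x‖ * ‖∇ φ x‖) (ball (0 : E) 1) := by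
    refine (iA2.add iG2).mono' (hA.mul hg.norm.aestronglyMeasurable) (ae_of_all _ fun x => ?_)
    simp only [Pi.add_apply]
    rw [Real.norm_of_nonneg (by positivity)]
    nlinarith [sq_nonneg (‖M - a x‖ - ‖∇ φ x‖), sq_nonneg (‖M - a x‖ + ‖∇ φ x‖)]
  have iR2 : IntegrableOn (fun x => ‖R x‖ ^ 2) (ball (0 : E) 1) :=
    (MemLp.integrable_norm_sq hR).integrableOn
  have iR : IntegrableOn (fun x => ‖R x‖) (ball (0 : E) 1) := by
    have : IsFiniteMeasure (volume.restrict (ball (0 : E) 1)) :=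
      ⟨by rw [Measure.restrict_apply_univ]; exact measure_ball_lt_top⟩
    exact ((hR.restrict _).integrable (by norm_num)).norm
  have hAG : ∫ x in ball (0 : E) 1, ‖M - a x‖ * ‖∇ φ x‖ ≤ (2 * L + 1) * s * D := by
    refine abs_le_of_sq_le_sq' ((sq_integral_mul_le hA hg.norm.aestronglyMeasurable iA2
      iG2).trans ?_) (by positivity) |>.2
    have h1 : ∫ x in ball (0 : E) 1, ‖M - a x‖ ^ 2 ≤ 2 * L * s ^ 2 := by
      calc _ ≤ ∫ x in ball (0 : E) 1, 2 * L * ‖M - a x‖ := by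
            refine integral_mono iA2 (iA.const_mul _) fun x => ?_
            change ‖M - a x‖ ^ 2 ≤ 2 * L * ‖M - a x‖
            rw [sq]
            gcongr
            exact hMa x
        _ ≤ _ := by rw [integral_const_mul]; gcongr
    calc _ ≤ 2 * L * s ^ 2 * D ^ 2 := by
          gcongr
      _ ≤ (2 * L + 1) ^ 2 * s ^ 2 * D ^ 2 := by gcongr; nlinarith
      _ = _ := by ring
  have hRr := setIntegral_le_of_sq measure_ball_lt_top hr0 iR.aestronglyMeasurable iR2 hr
  have e : ∀ x, ‖defect M a φ q R x‖ ≤ (ball (0 : E) 1).indicator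
      (fun x => ‖M - a x‖ * ‖∇ φ x‖ + ‖q‖ * ‖M - a x‖ + ‖R x‖) x := by
    intro x
    by_cases hx : x ∈ ball (0 : E) 1
    · rw [defect, indicator_of_mem hx, indicator_of_mem hx]
      have h1 : M (∇ φ x + q) - (a x (∇ φ x + q) + R x) =
          (M - a x) (∇ φ x) + (M - a x) q - R x := by
        simp only [_root_.sub_apply, map_add]
        abel
      rw [h1]
      refine (norm_sub_le _ _).trans
        (add_le_add ((norm_add_le _ _).trans (add_le_add ?_ ?_)) le_rfl)
      · exact (M - a x).le_opNorm _
      · rw [mul_comm]; exact (M - a x).le_opNorm _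
    · rw [defect, indicator_of_notMem hx, indicator_of_notMem hx, norm_zero]
  have iq : IntegrableOn (fun x => ‖q‖ * ‖M - a x‖) (ball (0 : E) 1) := iA.const_mul _
  have iAGq : IntegrableOn (fun x => ‖M - a x‖ * ‖∇ φ x‖ + ‖q‖ * ‖M - a x‖) (ball (0 : E) 1) :=
    iAG.add iq
  calc ∫ x, ‖defect M a φ q R x‖
      _ ≤ ∫ x, (ball (0 : E) 1).indicator
          (fun x => ‖M - a x‖ * ‖∇ φ x‖ + ‖q‖ * ‖M - a x‖ + ‖R x‖) x := by
        refine integral_mono (ha.integrable_defect hφ q hR M).norm ?_ e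
        exact (integrable_indicator_iff measurableSet_ball).2 (iAGq.add iR)
      _ ≤ _ := by
        rw [integral_indicator measurableSet_ball, integral_add iAGq iR, integral_add iAG iq,
          integral_const_mul]
        gcongr

theorem setIntegral_ball_comp_affine (c : E) {ρ : ℝ} (hρ : 0 < ρ) (g : E → ℝ) :
    ∫ x in ball (0 : E) 1, g (c + ρ • x) =
      (ρ ^ Module.finrank ℝ E)⁻¹ * ∫ x in ball c ρ, g x := by
  rw [← integral_indicator measurableSet_ball, ← integral_indicator measurableSet_ball]
  have h1 : ∀ x, (ball (0 : E) 1).indicator (fun x => g (c + ρ • x)) x =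
      (fun z => (ball c ρ).indicator g (c + z)) (ρ • x) := by
    intro x
    have : c + ρ • x ∈ ball c ρ ↔ x ∈ ball (0 : E) 1 := by
      rw [mem_ball_iff_norm, add_sub_cancel_left, norm_smul, Real.norm_of_nonneg hρ.le,
        mem_ball_zero_iff, mul_lt_iff_lt_one_right hρ]
    by_cases hx : x ∈ ball (0 : E) 1
    · simp only [indicator_of_mem hx, indicator_of_mem (this.2 hx)]
    · simp only [indicator_of_notMem hx, indicator_of_notMem (mt this.1 hx)]
  simp only [h1]
  rw [Measure.integral_comp_smul volume (fun z => (ball c ρ).indicator g (c + z)),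
    integral_add_left_eq_self (fun z => (ball c ρ).indicator g z), smul_eq_mul,
    abs_of_pos (by positivity)]

theorem gradient_sub_affine {φ : E → ℝ} (hφ : ContDiff ℝ ∞ φ) (m : ℝ) (p x : E) :
    ∇ (fun x => φ x - m - ⟪p, x⟫) x = ∇ φ x - p := by
  refine HasGradientAt.gradient ?_
  rw [hasGradientAt_iff_hasFDerivAt]
  have h1 : HasFDerivAt φ (fderiv ℝ φ x) x :=
    (hφ.differentiable (by simp) x).hasFDerivAt
  have h2 : HasFDerivAt (fun x => ⟪p, x⟫) (innerSL ℝ p) x := (innerSL ℝ p).hasFDerivAt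
  refine ((h1.sub_const m).sub h2).congr_fderiv ?_
  ext w
  simp [inner_sub_left, inner_gradient_left]

theorem contDiff_sub_affine {φ : E → ℝ} (hφ : ContDiff ℝ ∞ φ) (m : ℝ) (p : E) :
    ContDiff ℝ ∞ fun x => φ x - m - ⟪p, x⟫ :=
  (hφ.sub contDiff_const).sub (contDiff_const.inner ℝ contDiff_id)

theorem quadratic_le_sq {N t D C c e x r : ℝ} (hN : N * t ≤ 1 / 16) (hC : N * (c + 2) ≤ C)
    (hN1 : 1 ≤ N) (hc : 0 ≤ c) (hC1 : 1 ≤ C) (hD : 0 ≤ D) (he : 0 ≤ e) (hx : 0 ≤ x) (hr : 0 ≤ r) :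
    N * (t * D ^ 2 + c * e ^ 2 + 2 * x ^ 2 + r ^ 2) ≤ (D / 4 + C * (e + x + r)) ^ 2 := by
  have h1 : N * t * D ^ 2 ≤ 1 / 16 * D ^ 2 := by gcongr
  have h2 : N * (c * e ^ 2 + 2 * x ^ 2 + r ^ 2) ≤ C * (e ^ 2 + x ^ 2 + r ^ 2) := by
    refine le_trans ?_ (mul_le_mul_of_nonneg_right hC (by positivity))
    rw [mul_assoc]
    refine mul_le_mul_of_nonneg_left ?_ (by linarith)
    have b1 : 0 ≤ c * (x ^ 2 + r ^ 2) := by positivity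
    nlinarith [sq_nonneg e, sq_nonneg r]
  have h3 : e ^ 2 + x ^ 2 + r ^ 2 ≤ (e + x + r) ^ 2 := by
    nlinarith [mul_nonneg he hx, mul_nonneg he hr, mul_nonneg hx hr]
  have h4 : C * (e ^ 2 + x ^ 2 + r ^ 2) ≤ C ^ 2 * (e + x + r) ^ 2 := by
    have : C ≤ C ^ 2 := by nlinarith
    gcongr
  have h5 : 0 ≤ D / 4 * (C * (e + x + r)) := by positivity
  nlinarith

set_option maxHeartbeats 1000000 in
theorem exists_unit_step (E : Type*) [NormedAddCommGroup E] [InnerProductSpace ℝ E]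
    [FiniteDimensional ℝ E] [MeasurableSpace E] [BorelSpace E] {l L C₀ : ℝ} (hl : 0 < l)
    (hL : 0 < L) (hC₀ : 1 ≤ C₀) :
    ∃ σ C : ℝ, 0 < σ ∧ σ ≤ 1 / 16 ∧ 1 ≤ C ∧
      ∀ (a : E → E →L[ℝ] E) (φ : E → ℝ) (q : E) (R : E → E) (M : E →L[ℝ] E) (η Ψ : E → ℝ),
      IsEllipticField l L a → ContDiff ℝ ∞ φ → MemLp R 2 → StronglyMeasurable R →
      IsWeakSol a φ q R 0 1 → ‖M‖ ≤ L → IsAdaptedKernel C₀ M η Ψ →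
      ∀ e D r s : ℝ, 0 ≤ e → 0 ≤ D → 0 ≤ r → 0 ≤ s → s ≤ 1 →
      ∫ x in ball (0 : E) 1, |φ x| ≤ e → ∫ x in ball (0 : E) 1, ‖∇ φ x‖ ^ 2 ≤ D ^ 2 →
      ∫ x in ball (0 : E) 1, ‖R x‖ ^ 2 ≤ r ^ 2 → ∫ x in ball (0 : E) 1, ‖M - a x‖ ≤ s ^ 2 →
      ‖∫ z, η z • ∇ φ (-z)‖ ≤ C * e ∧ ∃ m : ℝ, ∀ y : E, ‖y‖ ≤ σ →
        ∫ x in ball (0 : E) 1,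
          |(φ (y + σ • x) - m - ⟪∫ z, η z • ∇ φ (-z), y + σ • x⟫) / σ| ≤
            e / 4 + C * (s * D + ‖q‖ * s ^ 2 + r) ∧
        ∫ x in ball (0 : E) 1, ‖∇ φ (y + σ • x) - ∫ z, η z • ∇ φ (-z)‖ ^ 2 ≤
            (D / 4 + C * (e + ‖q‖ * s + r)) ^ 2 := by
  set d := Module.finrank ℝ E with hd
  set V := volume.real (ball (0 : E) 1) with hV
  have hVpos : 0 < V := ENNReal.toReal_pos (measure_ball_pos _ _ one_pos).ne' measure_ball_lt_top.ne
  set σ : ℝ := min (1 / 16) (1 / (16 * 2 ^ d * C₀ * V)) with hσ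
  have hσ0 : 0 < σ := lt_min (by norm_num) (by positivity)
  have hσ1 : σ ≤ 1 / 16 := min_le_left _ _
  have hσ2 : σ * (16 * 2 ^ d * C₀ * V) ≤ 1 := by
    have : σ ≤ 1 / (16 * 2 ^ d * C₀ * V) := min_le_right _ _
    rwa [le_div_iff₀ (by positivity)] at this
  obtain ⟨K, hK0, hK⟩ := exists_caccioppoli E hl hL (τ := 2 * σ) (by linarith) (by linarith)
  set N : ℝ := (σ ^ d)⁻¹ * K + 1 with hN
  have hN1 : 1 ≤ N := by
    have : 0 < (σ ^ d)⁻¹ * K := by positivity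
    linarith
  set δ : ℝ := 1 / (8 * N) with hδ
  have hδ0 : 0 < δ := by positivity
  have hδ1 : δ ≤ 1 / 4 := by
    rw [hδ]
    gcongr
    linarith
  have hδN : N * (4 * δ ^ 2) ≤ 1 / 16 := by
    rw [hδ]
    have : N * (4 * (1 / (8 * N)) ^ 2) = 1 / (16 * N) := by field_simp; norm_num
    rw [this]
    gcongr
    linarith
  set Kδ : ℝ := 2 * volume.real (ball (0 : E) (1 / 4)) / volume.real (ball (0 : E) δ) ^ 2 with hKδ
  have hKδ0 : 0 ≤ Kδ := by positivity
  set c1 : ℝ := 1 + 2 * C₀ * V with hc1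
  set V2 := volume.real (ball (0 : E) (1 / 2)) with hV2
  set Ce : ℝ := 4 * δ ^ 2 * C₀ ^ 2 * V + Kδ * c1 ^ 2 + 2 * C₀ ^ 2 with hCe
  set G : ℝ := (σ ^ d)⁻¹ * (C₀ * V2) / σ with hG
  have hG0 : 0 ≤ G := by positivity
  set C : ℝ := C₀ + N * (Ce + 2) + G * ((2 * L + 1) + 1 + (V + 1)) with hC
  have hC0 : C₀ ≤ C := by
    have : 0 ≤ N * (Ce + 2) + G * ((2 * L + 1) + 1 + (V + 1)) := by positivity
    linarith
  have hC1 : N * (Ce + 2) ≤ C := by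
    have : 0 ≤ C₀ + G * ((2 * L + 1) + 1 + (V + 1)) := by positivity
    linarith
  have hC2 : G * ((2 * L + 1) + 1 + (V + 1)) ≤ C := by
    have : 0 ≤ C₀ + N * (Ce + 2) := by positivity
    linarith
  have hCe0 : 0 ≤ Ce := by positivity
  have hV20 : 0 ≤ V2 := measureReal_nonneg
  have hVd : volume.real (ball (0 : E) (2 * σ)) = 2 ^ d * σ ^ d * V := by
    rw [← mul_pow, measureReal_def, Measure.addHaar_ball_of_pos _ _ (by positivity),
      ENNReal.toReal_mul, ENNReal.toReal_ofReal (by positivity), hV, measureReal_def]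
  clear_value C G Ce V2 c1 Kδ δ N σ V d
  refine ⟨σ, C, hσ0, hσ1, hC₀.trans hC0, ?_⟩
  intro a φ q R M η Ψ ha hφ hR hRm hw hM hη e D r s he0 hD0 hr0 hs0 hs1 he hD hr hs
  obtain ⟨-, hm, hp⟩ := hη.abs_average_sub_affine_le hφ
  have hC₀' : 0 ≤ C₀ := by linarith
  set p := ∫ z, η z • ∇ φ (-z) with hpdef
  set m := ∫ z, η z * φ (-z) with hmdef
  have hp' : ‖p‖ ≤ C₀ * e := hp.trans (by gcongr)
  have hm' : |m| ≤ C₀ * e := hm.trans (by gcongr)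
  have hg := continuous_gradient hφ
  have hφc := hφ.continuous
  have hball : ∀ y : E, ‖y‖ ≤ σ → ball y σ ⊆ ball 0 (2 * σ) := fun y hy =>
    ball_subset_ball' (by rw [dist_zero_right]; linarith)
  refine ⟨hp'.trans (by gcongr), m, fun y hy => ⟨?_, ?_⟩⟩
  · have h1 := hη.integral_abs_sub_affine_le ha hφ hR hRm hw (τ := 2 * σ) (by linarith)
      (by linarith)
    have h2 := ha.integral_norm_defect_le hL hφ q hR hM hD0 hr0 hs0 hD hr hs
    rw [setIntegral_ball_comp_affine y hσ0 fun x => |(φ x - m - ⟪p, x⟫) / σ|, ← hd]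
    have h3 : ∫ x in ball y σ, |(φ x - m - ⟪p, x⟫) / σ| ≤
        (∫ x in ball 0 (2 * σ), |φ x - m - ⟪p, x⟫|) / σ := by
      rw [← integral_div]
      simp only [abs_div, abs_of_pos hσ0]
      refine setIntegral_mono_set (continuous_integrableOn_ball (by fun_prop) _ _)
        (ae_of_all _ fun x => by positivity) (hball y hy).eventuallyLE
    rw [hVd, ← hV2] at h1
    rw [← hV] at h2
    calc _ ≤ (σ ^ d)⁻¹ * ((C₀ * V2 * ((2 * L + 1) * s * D + ‖q‖ * s ^ 2 + (V + 1) * r) +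
          C₀ * (2 * σ) ^ 2 * e * (2 ^ d * σ ^ d * V)) / σ) := by
          refine mul_le_mul_of_nonneg_left (h3.trans ?_) (by positivity)
          refine div_le_div_of_nonneg_right (h1.trans ?_) hσ0.le
          gcongr
      _ = G * ((2 * L + 1) * (s * D) + 1 * (‖q‖ * s ^ 2) + (V + 1) * r) +
          e / 4 * (σ * (16 * 2 ^ d * C₀ * V)) := by
          rw [hG]
          field_simp
          ring
      _ ≤ C * (s * D + ‖q‖ * s ^ 2 + r) + e / 4 * 1 := by
          refine add_le_add ?_ (mul_le_mul_of_nonneg_left hσ2 (by positivity))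
          · have a1 : 0 ≤ s * D := by positivity
            have a2 : 0 ≤ ‖q‖ * s ^ 2 := by positivity
            refine le_trans ?_ (mul_le_mul_of_nonneg_right hC2 (by positivity))
            rw [mul_assoc]
            refine mul_le_mul_of_nonneg_left ?_ hG0
            have b1 : 0 ≤ (2 * L + 1) * (‖q‖ * s ^ 2 + r) := by positivity
            have b2 : 0 ≤ 1 * (s * D + r) := by positivity
            have b3 : 0 ≤ (V + 1) * (s * D + ‖q‖ * s ^ 2) := by positivity
            linarith
      _ = _ := by ring
  · set φ' : E → ℝ := fun x => φ x - m - ⟪p, x⟫ with hφ'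
    have hφ's : ContDiff ℝ ∞ φ' := contDiff_sub_affine hφ m p
    have hgr : ∀ x, ∇ φ' x = ∇ φ x - p := gradient_sub_affine hφ m p
    have hw' : IsWeakSol a φ' (q + p) R 0 1 := by
      intro ψ h1 h2 h3
      rw [← hw ψ h1 h2 h3]
      refine integral_congr_ae (ae_of_all _ fun x => ?_)
      simp only [hgr]
      congr 3
      abel_nf
    have h1 := hK a φ' (q + p) R M ha hφ's hR hw' hM
    have h2 := integral_sq_le_of_gradient δ hδ0 hδ1 hφ's
    rw [← hKδ] at h2
    have h3 : ∫ x in ball (0 : E) 1, |φ' x| ≤ c1 * e := by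
      calc _ ≤ ∫ x in ball (0 : E) 1, (|φ x| + (|m| + ‖p‖)) := by
            refine setIntegral_mono_on (continuous_integrableOn_ball (by fun_prop) _ _)
              (continuous_integrableOn_ball (by fun_prop) _ _) measurableSet_ball fun x hx => ?_
            have hx' : ‖x‖ < 1 := by simpa using hx
            have b1 : |⟪p, x⟫| ≤ ‖p‖ := (abs_real_inner_le_norm p x).trans
              (mul_le_of_le_one_right (norm_nonneg _) hx'.le)
            calc |φ x - m - ⟪p, x⟫| ≤ |φ x - m| + |⟪p, x⟫| := abs_sub _ _
              _ ≤ |φ x| + |m| + ‖p‖ := add_le_add (abs_sub _ _) b1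
              _ = _ := by ring
        _ = (∫ x in ball (0 : E) 1, |φ x|) + V * (|m| + ‖p‖) := by
            rw [integral_add (continuous_integrableOn_ball (by fun_prop) _ _)
              (continuous_integrableOn_ball (by fun_prop) _ _)]
            simp [hV]
        _ ≤ e + V * (C₀ * e + C₀ * e) := by gcongr
        _ = _ := by rw [hc1]; ring
    have h4 : ∫ x in ball (0 : E) 1, ‖∇ φ' x‖ ^ 2 ≤ 2 * D ^ 2 + 2 * C₀ ^ 2 * V * e ^ 2 := by
      simp only [hgr]
      calc _ ≤ ∫ x in ball (0 : E) 1, (2 * ‖∇ φ x‖ ^ 2 + 2 * ‖p‖ ^ 2) := by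
            refine setIntegral_mono_on (continuous_integrableOn_ball (by fun_prop) _ _)
              (continuous_integrableOn_ball (by fun_prop) _ _) measurableSet_ball fun x hx => ?_
            have := norm_sub_le (∇ φ x) p
            calc ‖∇ φ x - p‖ ^ 2 ≤ (‖∇ φ x‖ + ‖p‖) ^ 2 := by gcongr
              _ ≤ _ := by nlinarith [sq_nonneg (‖∇ φ x‖ - ‖p‖)]
        _ = 2 * (∫ x in ball (0 : E) 1, ‖∇ φ x‖ ^ 2) + V * (2 * ‖p‖ ^ 2) := by
            rw [integral_add (continuous_integrableOn_ball (by fun_prop) _ _)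
              (continuous_integrableOn_ball (by fun_prop) _ _), integral_const_mul]
            simp [hV]
        _ ≤ 2 * D ^ 2 + V * (2 * (C₀ * e) ^ 2) := by gcongr
        _ = _ := by ring
    have h5 : ‖q + p‖ ^ 2 * (∫ x in ball (0 : E) 1, ‖M - a x‖) ≤
        2 * (‖q‖ * s) ^ 2 + 2 * C₀ ^ 2 * e ^ 2 := by
      have b1 : ‖q + p‖ ^ 2 ≤ 2 * ‖q‖ ^ 2 + 2 * (C₀ * e) ^ 2 := by
        calc ‖q + p‖ ^ 2 ≤ (‖q‖ + C₀ * e) ^ 2 := by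
              gcongr
              exact (norm_add_le _ _).trans (by gcongr)
          _ ≤ _ := by nlinarith [sq_nonneg (‖q‖ - C₀ * e)]
      calc _ ≤ (2 * ‖q‖ ^ 2 + 2 * (C₀ * e) ^ 2) * s ^ 2 := by gcongr
        _ ≤ 2 * (‖q‖ * s) ^ 2 + 2 * (C₀ * e) ^ 2 * 1 := by
            have : s ^ 2 ≤ 1 := pow_le_one₀ hs0 hs1
            have : 2 * (C₀ * e) ^ 2 * s ^ 2 ≤ 2 * (C₀ * e) ^ 2 * 1 := by gcongr
            linarith
        _ = _ := by ring
    have h6 : ∫ x in ball (0 : E) (2 * (2 * σ)), φ' x ^ 2 ≤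
        4 * δ ^ 2 * D ^ 2 + (4 * δ ^ 2 * C₀ ^ 2 * V + Kδ * c1 ^ 2) * e ^ 2 := by
      have b0 : ∫ x in ball (0 : E) (2 * (2 * σ)), φ' x ^ 2 ≤
          ∫ x in ball (0 : E) (1 / 4), φ' x ^ 2 :=
        setIntegral_mono_set (continuous_integrableOn_ball (hφ's.continuous.pow 2) _ _)
          (ae_of_all _ fun x => sq_nonneg _) (ball_subset_ball (by linarith)).eventuallyLE
      refine (b0.trans h2).trans ?_
      calc _ ≤ 2 * δ ^ 2 * (2 * D ^ 2 + 2 * C₀ ^ 2 * V * e ^ 2) + Kδ * (c1 * e) ^ 2 := by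
            gcongr
        _ = _ := by ring
    rw [setIntegral_ball_comp_affine y hσ0 fun x => ‖∇ φ x - p‖ ^ 2, ← hd]
    have h7 : ∫ x in ball y σ, ‖∇ φ x - p‖ ^ 2 ≤ ∫ x in ball 0 (2 * σ), ‖∇ φ' x‖ ^ 2 := by
      simp only [hgr]
      exact setIntegral_mono_set (continuous_integrableOn_ball (by fun_prop) _ _)
        (ae_of_all _ fun x => sq_nonneg _) (hball y hy).eventuallyLE
    have hT : 0 ≤ 4 * δ ^ 2 * D ^ 2 + Ce * e ^ 2 + 2 * (‖q‖ * s) ^ 2 + r ^ 2 := by positivity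
    calc _ ≤ (σ ^ d)⁻¹ * (K * (4 * δ ^ 2 * D ^ 2 + Ce * e ^ 2 + 2 * (‖q‖ * s) ^ 2 + r ^ 2)) := by
          refine mul_le_mul_of_nonneg_left ((h7.trans h1).trans ?_) (by positivity)
          refine mul_le_mul_of_nonneg_left ?_ hK0.le
          rw [hCe]
          linarith
      _ ≤ N * (4 * δ ^ 2 * D ^ 2 + Ce * e ^ 2 + 2 * (‖q‖ * s) ^ 2 + r ^ 2) := by
          rw [← mul_assoc]
          exact mul_le_mul_of_nonneg_right (by rw [hN]; linarith) hT
      _ ≤ _ := quadratic_le_sq hδN hC1 hN1 hCe0 (hC₀.trans hC0) hD0 he0 (by positivity) hr0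

theorem integral_comp_affine (c : E) (ρ : ℝ) (F : E → ℝ) :
    ∫ x, F (c + ρ • x) = |(ρ ^ Module.finrank ℝ E)⁻¹| * ∫ x, F x := by
  rw [Measure.integral_comp_smul volume (fun z => F (c + z)), integral_add_left_eq_self F,
    smul_eq_mul]

theorem MemLp.comp_affine {R : E → E} {p : ENNReal} (hR : MemLp R p) (c : E) {ρ : ℝ} (hρ : ρ ≠ 0) :
    MemLp (fun x => R (c + ρ • x)) p := by
  have h1 : MemLp (fun z => R (c + z)) p :=
    hR.comp_measurePreserving (measurePreserving_add_left volume c)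
  have h2 : Measure.map (fun x : E => ρ • x) volume =
      ENNReal.ofReal |(ρ ^ Module.finrank ℝ E)⁻¹| • volume := Measure.map_addHaar_smul volume hρ
  have h3 : MemLp (fun z => R (c + z)) p (Measure.map (fun x : E => ρ • x) volume) := by
    rw [h2]
    exact h1.smul_measure ENNReal.ofReal_ne_top
  exact h3.comp_of_map (by fun_prop)

theorem IsEllipticField.comp_affine {l L : ℝ} {a : E → E →L[ℝ] E} (ha : IsEllipticField l L a)
    (c : E) (ρ : ℝ) : IsEllipticField l L fun x => a (c + ρ • x) :=
  ⟨ha.stronglyMeasurable.comp_measurable (by fun_prop), fun _ => ha.le_inner _,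
    fun _ => ha.norm_le _⟩

/-- The function `φ - b - ⟪q, ·⟫` on `ball c ρ`, rescaled to the unit ball. -/
noncomputable def rescaled (φ : E → ℝ) (c : E) (ρ b : ℝ) (q : E) : E → ℝ :=
  fun x => (φ (c + ρ • x) - b - ⟪q, c + ρ • x⟫) / ρ

theorem contDiff_rescaled {φ : E → ℝ} (hφ : ContDiff ℝ ∞ φ) (c : E) (ρ b : ℝ) (q : E) :
    ContDiff ℝ ∞ (rescaled φ c ρ b q) :=
  (contDiff_comp_affine (contDiff_sub_affine hφ b q) c ρ).div_const ρ

theorem gradient_rescaled {φ : E → ℝ} (hφ : ContDiff ℝ ∞ φ) (c : E) {ρ : ℝ} (hρ : ρ ≠ 0) (b : ℝ)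
    (q x : E) : ∇ (rescaled φ c ρ b q) x = ∇ φ (c + ρ • x) - q := by
  have h1 := gradient_comp_affine (contDiff_sub_affine hφ b q) c ρ x
  rw [gradient_sub_affine hφ] at h1
  have h2 := (contDiff_comp_affine (contDiff_sub_affine hφ b q) c ρ).hasGradientAt x
  rw [h1] at h2
  refine HasGradientAt.gradient ?_
  rw [hasGradientAt_iff_hasFDerivAt] at h2 ⊢
  refine (h2.mul_const ρ⁻¹).congr_fderiv ?_
  ext w
  simp [inner_sub_left, inner_smul_left]
  field_simp

theorem IsWeakSol.rescaled {a : E → E →L[ℝ] E} {φ : E → ℝ} {R : E → E} {c : E} {ρ : ℝ}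
    (h : IsWeakSol a φ 0 R c ρ) (hφ : ContDiff ℝ ∞ φ) (hρ : 0 < ρ) (b : ℝ) (q : E) :
    IsWeakSol (fun x => a (c + ρ • x)) (rescaled φ c ρ b q) q (fun x => R (c + ρ • x)) 0 1 := by
  intro ψ h1 h2 h3
  set χ : E → ℝ := fun y => ψ (-(ρ⁻¹ • c) + ρ⁻¹ • y) with hχ
  have hχs : ContDiff ℝ ∞ χ := contDiff_comp_affine h1 _ _
  have hinv : ∀ x, -(ρ⁻¹ • c) + ρ⁻¹ • (c + ρ • x) = x := by
    intro x
    rw [smul_add, smul_smul, inv_mul_cancel₀ hρ.ne', one_smul]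
    abel
  have hχg : ∀ x, ∇ χ (c + ρ • x) = ρ⁻¹ • ∇ ψ x := by
    intro x
    rw [hχ, gradient_comp_affine h1, hinv]
  have hts : tsupport χ ⊆ (fun x => c + ρ • x) '' tsupport ψ := by
    refine closure_minimal ?_ ?_
    · intro y hy
      refine ⟨-(ρ⁻¹ • c) + ρ⁻¹ • y, subset_tsupport _ hy, ?_⟩
      simp only [smul_add, smul_neg, smul_smul, mul_inv_cancel₀ hρ.ne', one_smul]
      abel
    · exact (h2.isCompact.image (by fun_prop)).isClosed
  have hsub : tsupport χ ⊆ ball c ρ := by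
    intro y hy
    obtain ⟨x, hx, rfl⟩ := hts hy
    have := h3 hx
    simp only [mem_ball_zero_iff] at this
    simp only [mem_ball_iff_norm, add_sub_cancel_left, norm_smul, Real.norm_of_nonneg hρ.le]
    nlinarith
  have hcs : HasCompactSupport χ :=
    (h2.isCompact.image (f := fun x => c + ρ • x) (by fun_prop)).of_isClosed_subset
      (isClosed_tsupport _) hts
  have h4 := h χ hχs hcs hsub
  have h5 := integral_comp_affine c ρ fun x => ⟪a x (∇ φ x + 0) + R x, ∇ χ x⟫
  rw [h4, mul_zero] at h5
  simp only [hχg, inner_smul_right, integral_const_mul, add_zero] at h5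
  simp only [gradient_rescaled hφ c hρ.ne', sub_add_cancel]
  exact (mul_eq_zero.1 h5).resolve_left (inv_pos.2 hρ).ne'

/-- `φ` is close to an affine function with gradient `q` on `ball c ρ`. -/
def IsApprox (φ : E → ℝ) (c : E) (ρ : ℝ) (q : E) (e D : ℝ) : Prop :=
  (∃ b : ℝ, ∫ x in ball (0 : E) 1, |rescaled φ c ρ b q x| ≤ e) ∧
    ∫ x in ball (0 : E) 1, ‖∇ φ (c + ρ • x) - q‖ ^ 2 ≤ D ^ 2

theorem IsAdaptedKernel.integrable_η {C : ℝ} {M : E →L[ℝ] E} {η Ψ : E → ℝ}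
    (h : IsAdaptedKernel C M η Ψ) : Integrable η :=
  h.contDiff_η.continuous.integrable_of_hasCompactSupport h.hasCompactSupport_η

theorem exists_approx_step (E : Type*) [NormedAddCommGroup E] [InnerProductSpace ℝ E]
    [FiniteDimensional ℝ E] [MeasurableSpace E] [BorelSpace E] {l L C₀ : ℝ} (hl : 0 < l)
    (hL : 0 < L) (hC₀ : 1 ≤ C₀) :
    ∃ σ C : ℝ, 0 < σ ∧ σ ≤ 1 / 16 ∧ 1 ≤ C ∧
      ∀ (a : E → E →L[ℝ] E) (φ : E → ℝ) (R : E → E) (M : E →L[ℝ] E) (η Ψ : E → ℝ) (c : E) (ρ : ℝ),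
      IsEllipticField l L a → ContDiff ℝ ∞ φ → MemLp R 2 → StronglyMeasurable R →
      0 < ρ → IsWeakSol a φ 0 R c ρ → ‖M‖ ≤ L → IsAdaptedKernel C₀ M η Ψ →
      ∀ (q : E) (e D r s : ℝ), 0 ≤ e → 0 ≤ D → 0 ≤ r → 0 ≤ s → s ≤ 1 →
      ∫ x in ball (0 : E) 1, ‖R (c + ρ • x)‖ ^ 2 ≤ r ^ 2 →
      ∫ x in ball (0 : E) 1, ‖M - a (c + ρ • x)‖ ≤ s ^ 2 → IsApprox φ c ρ q e D →
      ‖(∫ z, η z • ∇ φ (c - ρ • z)) - q‖ ≤ C * e ∧ ∀ c' : E, ‖c' - c‖ ≤ σ * ρ →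
        IsApprox φ c' (σ * ρ) (∫ z, η z • ∇ φ (c - ρ • z)) (e / 4 + C * (s * D + ‖q‖ * s ^ 2 + r))
          (D / 4 + C * (e + ‖q‖ * s + r)) := by
  obtain ⟨σ, C, hσ0, hσ1, hC, H⟩ := exists_unit_step E hl hL hC₀
  refine ⟨σ, C, hσ0, hσ1, hC, ?_⟩
  intro a φ R M η Ψ c ρ ha hφ hR hRm hρ hw hM hη q e D r s he0 hD0 hr0 hs0 hs1 hr hs hap
  obtain ⟨⟨b, hb⟩, hD⟩ := hap
  have hg := continuous_gradient hφ
  have h1 := H (fun x => a (c + ρ • x)) (rescaled φ c ρ b q) q (fun x => R (c + ρ • x)) M η Ψ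
    (ha.comp_affine c ρ) (contDiff_rescaled hφ _ _ _ _) (MemLp.comp_affine hR c hρ.ne')
    (hRm.comp_measurable (by fun_prop)) (hw.rescaled hφ hρ b q) hM hη e D r s he0 hD0 hr0 hs0 hs1
    hb (by simpa only [gradient_rescaled hφ c hρ.ne'] using hD) hr hs
  set q' := ∫ z, η z • ∇ φ (c - ρ • z) with hq'
  have hp : ∫ z, η z • ∇ (rescaled φ c ρ b q) (-z) = q' - q := by
    simp only [gradient_rescaled hφ c hρ.ne', smul_neg, ← sub_eq_add_neg, smul_sub]
    rw [integral_sub, integral_smul_const, hη.integral_η, one_smul]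
    · refine Continuous.integrable_of_hasCompactSupport ?_ ?_
      · exact hη.contDiff_η.continuous.smul (hg.comp (by fun_prop))
      · exact hη.hasCompactSupport_η.smul_right
    · exact hη.integrable_η.smul_const q
  rw [hp] at h1
  obtain ⟨h1, m, h2⟩ := h1
  refine ⟨h1, fun c' hc' => ?_⟩
  have hy : ‖ρ⁻¹ • (c' - c)‖ ≤ σ := by
    rw [norm_smul, Real.norm_of_nonneg (by positivity), inv_mul_le_iff₀ hρ, mul_comm]
    exact hc'
  obtain ⟨h3, h4⟩ := h2 _ hy
  have hpt : ∀ x : E, c + ρ • (ρ⁻¹ • (c' - c) + σ • x) = c' + (σ * ρ) • x := by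
    intro x
    rw [smul_add, smul_smul, smul_smul, mul_inv_cancel₀ hρ.ne', one_smul, mul_comm ρ]
    abel
  refine ⟨⟨b + ρ * m - ⟪q' - q, c⟫, ?_⟩, ?_⟩
  · convert h3 using 4 with x
    simp only [rescaled, hpt]
    have e1 : ρ⁻¹ • (c' - c) + σ • x = ρ⁻¹ • ((c' + (σ * ρ) • x) - c) := by
      rw [← hpt x, add_sub_cancel_left, smul_smul, inv_mul_cancel₀ hρ.ne', one_smul]
    rw [e1, inner_smul_right, inner_sub_right, inner_sub_left, inner_sub_left]
    field_simp
    ring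
  · simp only [gradient_rescaled hφ c hρ.ne', hpt, sub_sub_sub_cancel_right, sub_sub] at h4
    convert h4 using 5 with x
    abel

theorem exists_isApprox_zero (E : Type*) [NormedAddCommGroup E] [InnerProductSpace ℝ E]
    [FiniteDimensional ℝ E] [MeasurableSpace E] [BorelSpace E] :
    ∃ C : ℝ, 0 < C ∧ ∀ (φ : E → ℝ) (c : E) (ρ D : ℝ), ContDiff ℝ ∞ φ → 0 < ρ → 0 ≤ D →
      ∫ x in ball (0 : E) 1, ‖∇ φ (c + ρ • x)‖ ^ 2 ≤ D ^ 2 → IsApprox φ c ρ 0 (C * D) D := by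
  obtain ⟨C, hC, H⟩ := exists_integral_abs_sub_le E
  refine ⟨C * (volume.real (ball (0 : E) 1) + 1), by positivity, ?_⟩
  intro φ c ρ D hφ hρ hD h
  have hs := contDiff_rescaled hφ c ρ 0 (0 : E)
  have hg := continuous_gradient hφ
  obtain ⟨m, hm⟩ := H _ hs
  refine ⟨⟨ρ * m, ?_⟩, by simpa using h⟩
  have h1 : ∀ x, rescaled φ c ρ (ρ * m) 0 x = rescaled φ c ρ 0 0 x - m := by
    intro x
    simp only [rescaled, inner_zero_left]
    field_simp
    ring
  simp only [h1]
  refine hm.trans ?_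
  rw [mul_assoc]
  refine mul_le_mul_of_nonneg_left ?_ hC.le
  simp only [gradient_rescaled hφ c hρ.ne', sub_zero]
  refine setIntegral_le_of_sq measure_ball_lt_top hD ?_ ?_ h
  · exact (hg.comp (by fun_prop)).norm.aestronglyMeasurable
  · exact continuous_integrableOn_ball (by fun_prop) _ _

theorem one_div_sq_le_sub {L₀ t : ℝ} (ht : 0 < t) (hL : 2 * t ≤ L₀) (k : ℕ) :
    (1 / (L₀ + k * t)) ^ 2 ≤ 2 / t * (1 / (L₀ + k * t) - 1 / (L₀ + (k + 1 : ℕ) * t)) := by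
  have hk : 0 ≤ (k : ℝ) * t := by positivity
  push_cast
  have h1 : 0 < L₀ + k * t := by linarith
  have h2 : 0 < L₀ + (k + 1) * t := by linarith
  have : 2 / t * (1 / (L₀ + k * t) - 1 / (L₀ + (k + 1) * t)) =
      2 / ((L₀ + k * t) * (L₀ + (k + 1) * t)) := by
    rw [div_sub_div _ _ h1.ne' h2.ne', div_mul_div_comm, div_eq_div_iff (by positivity)
      (by positivity)]
    ring
  rw [this, div_pow, one_pow, div_le_div_iff₀ (by positivity) (by positivity)]
  nlinarith

theorem exists_sum_le_of_recurrence {A t : ℝ} (hA : 0 < A) (ht : 0 < t) :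
    ∃ B : ℝ, 0 < B ∧ ∀ (L₀ D : ℝ) (X Q : ℕ → ℝ) (N : ℕ), 2 * t ≤ L₀ → 1 ≤ L₀ → 0 ≤ D →
      (∀ k, 0 ≤ X k) → (∀ k, 0 ≤ Q k) → X 0 ≤ A * D → Q 0 = 0 →
      (∀ k < N, X (k + 1) ≤ X k / 2 + A * ((Q k + D) * (1 / (L₀ + k * t)) ^ 2)) →
      (∀ k < N, Q (k + 1) ≤ Q k + A * X k) → ∀ m ≤ N,
      ∑ k ∈ Finset.Ico m N, X k ≤ B * D * ((1 / 2) ^ m + 1 / (L₀ + m * t)) := by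
  set P : ℝ := Real.exp (4 * A ^ 2 / t) * (2 * A ^ 2 + 1) with hP
  have hP0 : 0 < P := by positivity
  set G : ℝ := A * P with hG
  have hG0 : 0 < G := by positivity
  refine ⟨2 * A + 12 * G + 4 * G / t, by positivity, ?_⟩
  intro L₀ D X Q N hLt hL1 hD hX hQ hX0 hQ0 hXs hQs m hm
  set v : ℕ → ℝ := fun k => 1 / (L₀ + k * t) with hv
  have hv0 : ∀ k, 0 < v k := fun k => by
    have : 0 ≤ (k : ℝ) * t := by positivity
    simp only [hv]
    positivity
  have hv1 : ∀ k, v k ≤ 1 := fun k => by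
    have : 0 ≤ (k : ℝ) * t := by positivity
    simp only [hv]
    rw [div_le_one (by linarith)]
    linarith
  have hvs : ∀ k, v k ^ 2 ≤ 2 / t * (v k - v (k + 1)) := fun k => one_div_sq_le_sub ht hLt k
  have hvr : ∀ k, v k ≤ 3 / 2 * v (k + 1) := fun k => by
    have hk : 0 ≤ (k : ℝ) * t := by positivity
    simp only [hv]
    push_cast
    rw [mul_one_div, div_le_div_iff₀ (by linarith) (by linarith)]
    linarith
  have hPk : ∀ k ≤ N, Q k + 2 * A * X k + D ≤
      Real.exp (4 * A ^ 2 / t * (v 0 - v k)) * ((2 * A ^ 2 + 1) * D) := by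
    intro k
    induction k with
    | zero =>
      intro _
      rw [hQ0, sub_self, mul_zero, Real.exp_zero]
      nlinarith
    | succ k ih =>
      intro hk
      have h1 := ih (by omega)
      have h2 := hXs k (by omega)
      have h3 := hQs k (by omega)
      change X (k + 1) ≤ X k / 2 + A * ((Q k + D) * v k ^ 2) at h2
      have h4 : Q (k + 1) + 2 * A * X (k + 1) + D ≤
          (1 + 2 * A ^ 2 * v k ^ 2) * (Q k + 2 * A * X k + D) := by
        have a1 : 2 * A * X (k + 1) ≤ 2 * A * (X k / 2 + A * ((Q k + D) * v k ^ 2)) := by gcongr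
        have a2 : 0 ≤ 2 * A ^ 2 * v k ^ 2 * (2 * A * X k) := by
          have := hX k
          positivity
        nlinarith
      have h5 : 1 + 2 * A ^ 2 * v k ^ 2 ≤ Real.exp (4 * A ^ 2 / t * (v k - v (k + 1))) := by
        have a1 : 2 * A ^ 2 * v k ^ 2 ≤ 4 * A ^ 2 / t * (v k - v (k + 1)) := by
          calc _ ≤ 2 * A ^ 2 * (2 / t * (v k - v (k + 1))) := by
                gcongr
                exact hvs k
            _ = _ := by ring
        have a2 := Real.add_one_le_exp (4 * A ^ 2 / t * (v k - v (k + 1)))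
        linarith
      calc _ ≤ _ := h4
        _ ≤ Real.exp (4 * A ^ 2 / t * (v k - v (k + 1))) *
            (Real.exp (4 * A ^ 2 / t * (v 0 - v k)) * ((2 * A ^ 2 + 1) * D)) := by
            have := hX k
            have := hQ k
            gcongr
        _ = _ := by
            rw [← mul_assoc, ← Real.exp_add]
            congr 2
            ring
  have hPP : ∀ k ≤ N, Q k + D ≤ P * D := by
    intro k hk
    have h1 := hPk k hk
    have h2 : Real.exp (4 * A ^ 2 / t * (v 0 - v k)) ≤ Real.exp (4 * A ^ 2 / t) := by
      refine Real.exp_le_exp.2 (mul_le_of_le_one_right (by positivity) ?_)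
      linarith [hv1 0, hv0 k]
    have h3 : Real.exp (4 * A ^ 2 / t * (v 0 - v k)) * ((2 * A ^ 2 + 1) * D) ≤
        Real.exp (4 * A ^ 2 / t) * ((2 * A ^ 2 + 1) * D) := by gcongr
    have h4 : 0 ≤ 2 * A * X k := by
      have := hX k
      positivity
    rw [hP]
    linarith
  have hX1 : ∀ k < N, X (k + 1) ≤ X k / 2 + G * D * v k ^ 2 := by
    intro k hk
    have h1 := hPP k hk.le
    refine (hXs k hk).trans ?_
    change X k / 2 + A * ((Q k + D) * v k ^ 2) ≤ _
    have : A * ((Q k + D) * v k ^ 2) ≤ A * (P * D * v k ^ 2) := by gcongr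
    rw [hG]
    linarith
  have hX2 : ∀ k ≤ N, X k ≤ A * D * (1 / 2) ^ k + 6 * G * D * v k := by
    intro k
    induction k with
    | zero =>
      intro _
      have : 0 ≤ 6 * G * D * v 0 := by
        have := hv0 0
        positivity
      rw [pow_zero]
      linarith
    | succ k ih =>
      intro hk
      have h1 := ih (by omega)
      have h2 := hX1 k (by omega)
      have h3 : v k ^ 2 ≤ v k := by nlinarith [hv0 k, hv1 k]
      have h4 : G * D * v k ^ 2 ≤ G * D * v k := by gcongr
      have h5 : 4 * G * D * v k ≤ 4 * G * D * (3 / 2 * v (k + 1)) := by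
        gcongr
        exact hvr k
      rw [pow_succ]
      linarith
  have hS : ∀ n, m ≤ n → n ≤ N → ∑ k ∈ Finset.Ico m n, X k + 2 * X n ≤
      2 * X m + 4 * G * D / t * (v m - v n) := by
    intro n hmn
    induction n, hmn using Nat.le_induction with
    | base => intro _; simp
    | succ n hmn ih =>
      intro hn
      rw [Finset.sum_Ico_succ_top hmn]
      have h1 := ih (by omega)
      have h2 := hX1 n (by omega)
      have h3 : 2 * (G * D * v n ^ 2) ≤ 4 * G * D / t * (v n - v (n + 1)) := by
        calc _ ≤ 2 * (G * D * (2 / t * (v n - v (n + 1)))) := by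
              gcongr
              exact hvs n
          _ = _ := by ring
      linarith
  have h1 := hS N hm le_rfl
  have h2 := hX2 m hm
  have h3 := hX N
  have h4 : 0 ≤ 4 * G * D / t * v N := by
    have := hv0 N
    positivity
  have h5 : 0 ≤ (12 * G + 4 * G / t) * D * (1 / 2) ^ m := by positivity
  have h6 : 0 ≤ 2 * A * D * v m := by
    have := hv0 m
    positivity
  have h7 : 4 * G * D / t * v m = 4 * G / t * D * v m := by ring
  change _ ≤ (2 * A + 12 * G + 4 * G / t) * D * ((1 / 2) ^ m + v m)
  linarith

/-- Scale-invariant smallness of the oscillation of the coefficients on balls inside the unit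
ball, with logarithmic rate. -/
def LogDini (l L κ : ℝ) (a : E → E →L[ℝ] E) : Prop :=
  ∀ (c : E) (ρ : ℝ), 0 < ρ → ρ < 1 / 2 → ball c ρ ⊆ ball (0 : E) 1 →
    ∃ M : E →L[ℝ] E, (∀ x, l * ‖x‖ ^ 2 ≤ ⟪M x, x⟫) ∧ ‖M‖ ≤ L ∧
      ∫ x in ball (0 : E) 1, ‖M - a (c + ρ • x)‖ ≤ (κ / Real.log (1 / ρ)) ^ 2

theorem IsWeakSol.mono {a : E → E →L[ℝ] E} {φ : E → ℝ} {q : E} {R : E → E} {c c' : E} {ρ ρ' : ℝ}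
    (h : IsWeakSol a φ q R c ρ) (hs : ball c' ρ' ⊆ ball c ρ) : IsWeakSol a φ q R c' ρ' :=
  fun ψ h1 h2 h3 => h ψ h1 h2 (h3.trans hs)

theorem add_mul_step_le {C e D s s' Q D₀ : ℝ} (hC : 1 ≤ C) (he : 0 ≤ e) (hD : 0 ≤ D) (hs : 0 ≤ s)
    (hQ : 0 ≤ Q) (hD₀ : 0 ≤ D₀) (hss : s' ≤ s) (hsC : 16 * C ^ 2 * s ≤ 1) :
    (e / 4 + C * (s * D + Q * s ^ 2 + D₀ * s ^ 2)) +
      4 * C * s' * (D / 4 + C * (e + Q * s + D₀ * s ^ 2)) ≤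
      (e + 4 * C * s * D) / 2 + 5 * C ^ 2 * ((Q + D₀) * s ^ 2) := by
  have hC0 : 0 ≤ C := by linarith
  have h1 : 4 * C * s' * (D / 4 + C * (e + Q * s + D₀ * s ^ 2)) ≤
      4 * C * s * (D / 4 + C * (e + Q * s + D₀ * s ^ 2)) := by gcongr
  have h2 : 16 * C ^ 2 * s * e ≤ 1 * e := by gcongr
  have hs1 : s ≤ 1 := by nlinarith
  have h3 : 4 * C ^ 2 * (D₀ * s ^ 2) * s ≤ 4 * C ^ 2 * (D₀ * s ^ 2) * 1 := by gcongr
  have h4 : C * ((Q + D₀) * s ^ 2) ≤ C ^ 2 * ((Q + D₀) * s ^ 2) := by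
    gcongr
    nlinarith
  nlinarith

theorem exists_smooth_oscillation (E : Type*) [NormedAddCommGroup E] [InnerProductSpace ℝ E]
    [FiniteDimensional ℝ E] [MeasurableSpace E] [BorelSpace E] {l L κ : ℝ} (hl : 0 < l)
    (hL : 0 < L) (hκ : 0 < κ) :
    ∃ C₀ σ B R₀ : ℝ, 1 ≤ C₀ ∧ 0 < σ ∧ σ ≤ 1 / 16 ∧ 0 < B ∧ 0 < R₀ ∧ R₀ ≤ 1 / 3 ∧
      ∀ a : E → E →L[ℝ] E, IsEllipticField l L a → LogDini l L κ a →
      ∃ (M : E → ℝ → E →L[ℝ] E) (η Ψ : E → ℝ → E → ℝ),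
        (∀ c ρ, 0 < ρ → ρ < 1 / 2 → ball c ρ ⊆ ball (0 : E) 1 →
          IsAdaptedKernel C₀ (M c ρ) (η c ρ) (Ψ c ρ)) ∧
        ∀ (x₀ y : E) (R : ℝ) (n N : ℕ) (φ : E → ℝ) (S : E → E) (D : ℝ), 0 < R → R ≤ R₀ →
          ball x₀ R ⊆ ball (0 : E) 1 → ‖y - x₀‖ ≤ σ ^ (n + 1) * R → n + 1 ≤ N →
          ContDiff ℝ ∞ φ → MemLp S 2 → StronglyMeasurable S → IsWeakSol a φ 0 S x₀ R → 0 ≤ D →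
          ∫ x in ball (0 : E) 1, ‖∇ φ (x₀ + R • x)‖ ^ 2 ≤ D ^ 2 →
          (∀ k ≤ N, ∫ x, ‖S x‖ ^ 2 ≤ (σ ^ k * R) ^ Module.finrank ℝ E *
            (D * (κ / Real.log (1 / (σ ^ k * R))) ^ 2) ^ 2) →
          ‖(∫ z, η y (σ ^ N * R) z • ∇ φ (y - (σ ^ N * R) • z)) -
            ∫ z, η x₀ (σ ^ n * R) z • ∇ φ (x₀ - (σ ^ n * R) • z)‖ ≤
            B * D * ((1 / 2) ^ n + 1 / Real.log (1 / (σ ^ n * R))) := by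
  obtain ⟨C₀, hC₀, hker⟩ := exists_isAdaptedKernel E hl hL
  obtain ⟨σ, C, hσ0, hσ1, hC, hstep⟩ := exists_approx_step E hl hL hC₀
  obtain ⟨C₁, hC₁, hzero⟩ := exists_isApprox_zero E
  have hC0 : 0 < C := by linarith
  set t := Real.log (1 / σ) with ht
  have ht0 : 0 < t := Real.log_pos (by rw [lt_div_iff₀ hσ0]; linarith)
  set A : ℝ := 5 * C ^ 2 * κ ^ 2 + C + C₁ + 4 * C with hA
  have hA0 : 0 < A := by positivity
  obtain ⟨B, hB, hsum⟩ := exists_sum_le_of_recurrence hA0 ht0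
  set T : ℝ := 2 * t + 2 + 16 * C ^ 2 * κ with hT
  have hT2 : 2 ≤ T := by
    have : 0 < 2 * t + 16 * C ^ 2 * κ := by positivity
    linarith
  refine ⟨C₀, σ, C * (2 * B), Real.exp (-T), hC₀, hσ0, hσ1, by positivity, Real.exp_pos _, ?_, ?_⟩
  · rw [Real.exp_neg, ← one_div]
    refine one_div_le_one_div_of_le (by norm_num) ?_
    linarith [Real.add_one_le_exp T]
  intro a ha hdini
  have hchoice : ∀ (c : E) (ρ : ℝ), ∃ (M : E →L[ℝ] E) (η Ψ : E → ℝ), 0 < ρ → ρ < 1 / 2 →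
      ball c ρ ⊆ ball (0 : E) 1 → IsAdaptedKernel C₀ M η Ψ ∧ ‖M‖ ≤ L ∧
        ∫ x in ball (0 : E) 1, ‖M - a (c + ρ • x)‖ ≤ (κ / Real.log (1 / ρ)) ^ 2 := by
    intro c ρ
    by_cases h : 0 < ρ ∧ ρ < 1 / 2 ∧ ball c ρ ⊆ ball (0 : E) 1
    · obtain ⟨M, h1, h2, h3⟩ := hdini c ρ h.1 h.2.1 h.2.2
      obtain ⟨η, Ψ, h4⟩ := hker M h1 h2
      exact ⟨M, η, Ψ, fun _ _ _ => ⟨h4, h2, h3⟩⟩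
    · exact ⟨0, 0, 0, fun h1 h2 h3 => (h ⟨h1, h2, h3⟩).elim⟩
  choose M η Ψ hM using hchoice
  refine ⟨M, η, Ψ, fun c ρ h1 h2 h3 => (hM c ρ h1 h2 h3).1, ?_⟩
  intro x₀ y R n N φ S D hR0 hR hball hy hnN hφ hS hSm hw hD hDφ hres
  set L₀ := Real.log (1 / R) with hL₀
  have hLT : T ≤ L₀ := by
    rw [hL₀, one_div, Real.log_inv]
    have := (Real.log_le_iff_le_exp hR0).2 hR
    linarith
  have hR13 : R < 1 / 2 := by
    refine hR.trans_lt ?_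
    rw [Real.exp_neg, ← one_div]
    refine one_div_lt_one_div_of_lt (by norm_num) ?_
    linarith [Real.add_one_le_exp T]
  set ρ : ℕ → ℝ := fun k => σ ^ k * R with hρ
  have hρ0 : ∀ k, 0 < ρ k := fun k => by positivity
  have hσle : ∀ k, σ ^ k ≤ 1 := fun k => pow_le_one₀ hσ0.le (by linarith)
  have hρR : ∀ k, ρ k ≤ R := fun k => mul_le_of_le_one_left hR0.le (hσle k)
  have hlog : ∀ k, Real.log (1 / ρ k) = L₀ + k * t := by
    intro k
    simp only [hρ, hL₀, ht, one_div, Real.log_inv]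
    rw [Real.log_mul (by positivity) hR0.ne', Real.log_pow]
    ring
  have hLk : ∀ k : ℕ, T ≤ L₀ + k * t := fun k => by
    have : 0 ≤ (k : ℝ) * t := by positivity
    linarith
  set s : ℕ → ℝ := fun k => κ / (L₀ + k * t) with hs
  have hs0 : ∀ k, 0 ≤ s k := fun k => div_nonneg hκ.le (by linarith [hLk k])
  have hsC : ∀ k, 16 * C ^ 2 * s k ≤ 1 := by
    intro k
    have h1 : 0 < L₀ + k * t := by linarith [hLk k]
    rw [hs, ← mul_div_assoc, div_le_one h1]
    linarith [hLk k]
  have hs1 : ∀ k, s k ≤ 1 := fun k => by nlinarith [hsC k, hs0 k]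
  have hsmono : ∀ k, s (k + 1) ≤ s k := by
    intro k
    have h1 : 0 < L₀ + k * t := by linarith [hLk k]
    simp only [hs]
    refine div_le_div_of_nonneg_left hκ.le h1 ?_
    push_cast
    linarith
  set c : ℕ → E := fun k => if k ≤ n then x₀ else y with hc
  have hcball : ∀ k, ball (c k) (ρ k) ⊆ ball x₀ R := by
    intro k
    by_cases hk : k ≤ n
    · simp only [hc, if_pos hk]
      exact ball_subset_ball (hρR k)
    · simp only [hc, if_neg hk]
      refine ball_subset_ball' ?_
      rw [dist_eq_norm]
      have h1 : σ ^ k ≤ σ := pow_le_of_le_one hσ0.le (by linarith) (by omega)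
      have h2 : σ ^ (n + 1) ≤ σ := pow_le_of_le_one hσ0.le (by linarith) (by omega)
      have h3 : ρ k ≤ σ * R := mul_le_mul_of_nonneg_right h1 hR0.le
      have h4 : σ ^ (n + 1) * R ≤ σ * R := mul_le_mul_of_nonneg_right h2 hR0.le
      nlinarith
  have hcstep : ∀ k, ‖c (k + 1) - c k‖ ≤ σ * ρ k := by
    intro k
    have h0 : 0 ≤ σ * ρ k := (mul_pos hσ0 (hρ0 k)).le
    rcases lt_trichotomy k n with hk | rfl | hk
    · simp only [hc, if_pos hk.le, if_pos (Nat.succ_le_of_lt hk), sub_self, norm_zero, h0]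
    · simp only [hc, le_refl, if_true, if_neg (Nat.not_succ_le_self k)]
      refine hy.trans (le_of_eq ?_)
      simp only [hρ]
      ring
    · simp only [hc, if_neg (by omega : ¬ k ≤ n), if_neg (by omega : ¬ k + 1 ≤ n), sub_self,
        norm_zero, h0]
  have hρs : ∀ k, ρ (k + 1) = σ * ρ k := fun k => by simp only [hρ]; ring
  set q : ℕ → E := fun k => Nat.rec 0
    (fun k _ => ∫ z, η (c k) (ρ k) z • ∇ φ (c k - ρ k • z)) k with hq
  have hq0 : q 0 = 0 := rfl
  have hqs : ∀ k, q (k + 1) = ∫ z, η (c k) (ρ k) z • ∇ φ (c k - ρ k • z) := fun k => rfl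
  set st : ℕ → ℝ × ℝ := fun k => Nat.rec (C₁ * D, D) (fun k p =>
    (p.1 / 4 + C * (s k * p.2 + ‖q k‖ * s k ^ 2 + D * s k ^ 2),
      p.2 / 4 + C * (p.1 + ‖q k‖ * s k + D * s k ^ 2))) k with hst
  have hst0 : st 0 = (C₁ * D, D) := rfl
  have hsts : ∀ k, st (k + 1) =
    ((st k).1 / 4 + C * (s k * (st k).2 + ‖q k‖ * s k ^ 2 + D * s k ^ 2),
      (st k).2 / 4 + C * ((st k).1 + ‖q k‖ * s k + D * s k ^ 2)) := fun k => rfl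
  have hst_nonneg : ∀ k, 0 ≤ (st k).1 ∧ 0 ≤ (st k).2 := by
    intro k
    induction k with
    | zero => rw [hst0]; exact ⟨by positivity, hD⟩
    | succ k ih =>
      obtain ⟨h1, h2⟩ := ih
      have := hs0 k
      rw [hsts]
      constructor <;> positivity
  clear_value st q c s ρ t A T L₀
  have hker' : ∀ k, IsAdaptedKernel C₀ (M (c k) (ρ k)) (η (c k) (ρ k)) (Ψ (c k) (ρ k)) ∧
      ‖M (c k) (ρ k)‖ ≤ L ∧ ∫ x in ball (0 : E) 1, ‖M (c k) (ρ k) - a (c k + ρ k • x)‖ ≤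
        (s k) ^ 2 := by
    intro k
    have := hM (c k) (ρ k) (hρ0 k) ((hρR k).trans_lt hR13) ((hcball k).trans hball)
    rwa [hlog, ← congrFun hs k] at this
  have hstep' : ∀ k ≤ N, IsApprox φ (c k) (ρ k) (q k) (st k).1 (st k).2 →
      ‖q (k + 1) - q k‖ ≤ C * (st k).1 ∧
      IsApprox φ (c (k + 1)) (ρ (k + 1)) (q (k + 1)) (st (k + 1)).1 (st (k + 1)).2 := by
    intro k hk hap
    obtain ⟨h1, h2, h3⟩ := hker' k
    have hr : ∫ x in ball (0 : E) 1, ‖S (c k + ρ k • x)‖ ^ 2 ≤ (D * s k ^ 2) ^ 2 := by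
      rw [setIntegral_ball_comp_affine (c k) (hρ0 k) fun x => ‖S x‖ ^ 2]
      have e1 : ∫ x in ball (c k) (ρ k), ‖S x‖ ^ 2 ≤ ∫ x, ‖S x‖ ^ 2 :=
        setIntegral_le_integral (MemLp.integrable_norm_sq hS) (ae_of_all _ fun _ => sq_nonneg _)
      have e2 := hres k hk
      rw [← congrFun hρ k, hlog, ← congrFun hs k] at e2
      have e3 : 0 < ρ k ^ Module.finrank ℝ E := pow_pos (hρ0 k) _
      rw [inv_mul_le_iff₀ e3]
      exact e1.trans e2
    have := hstep a φ S (M (c k) (ρ k)) (η (c k) (ρ k)) (Ψ (c k) (ρ k)) (c k) (ρ k) ha hφ hS hSm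
      (hρ0 k) (hw.mono (hcball k)) h2 h1 (q k) (st k).1 (st k).2 (D * s k ^ 2) (s k)
      (hst_nonneg k).1 (hst_nonneg k).2 (by positivity) (hs0 k) (hs1 k) hr h3 hap
    rw [← hqs] at this
    refine ⟨this.1, ?_⟩
    rw [hρs, hsts]
    exact this.2 _ (hcstep k)
  have hc0 : c 0 = x₀ := by simp [hc]
  have hρz : ρ 0 = R := by simp [hρ]
  have hap : ∀ k ≤ N + 1, IsApprox φ (c k) (ρ k) (q k) (st k).1 (st k).2 := by
    intro k
    induction k with
    | zero =>
      intro _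
      rw [hc0, hρz, hq0, hst0]
      exact hzero φ x₀ R D hφ hR0 hD hDφ
    | succ k ih =>
      intro hk
      exact (hstep' k (by omega) (ih (by omega))).2
  have hdiff : ∀ k ≤ N, ‖q (k + 1) - q k‖ ≤ C * (st k).1 := fun k hk =>
    (hstep' k hk (hap k (by omega))).1
  set X : ℕ → ℝ := fun k => (st k).1 + 4 * C * s k * (st k).2 with hX
  have hXe : ∀ k, (st k).1 ≤ X k := fun k => by
    have := (hst_nonneg k).2
    have := hs0 k
    simp only [hX]
    have : 0 ≤ 4 * C * s k * (st k).2 := by positivity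
    linarith
  have hX0 : ∀ k, 0 ≤ X k := fun k => (hst_nonneg k).1.trans (hXe k)
  have hSum := hsum L₀ D X (fun k => ‖q k‖) (N + 1) (by
      have : 0 < 16 * C ^ 2 * κ := by positivity
      linarith) (by linarith) hD hX0
    (fun k => norm_nonneg _) (by
      simp only [hX, hst0]
      have h1 : 4 * C * s 0 * D ≤ 4 * C * 1 * D := by
        have := hs1 0
        gcongr
      have h2 : 0 ≤ (5 * C ^ 2 * κ ^ 2 + C) * D := by positivity
      rw [hA]
      linarith) (by rw [hq0, norm_zero])
    (by
      intro k hk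
      have h1 := add_mul_step_le hC (hst_nonneg k).1 (hst_nonneg k).2 (hs0 k) (norm_nonneg (q k)) hD
        (hsmono k) (hsC k)
      simp only [hX]
      rw [hsts]
      refine h1.trans (add_le_add le_rfl ?_)
      have h2 : s k ^ 2 = κ ^ 2 * (1 / (L₀ + k * t)) ^ 2 := by rw [hs]; ring
      have h3 : 5 * C ^ 2 * κ ^ 2 ≤ A := by rw [hA]; linarith
      have h4 : 0 ≤ (‖q k‖ + D) * (1 / (L₀ + k * t)) ^ 2 := by positivity
      calc _ = 5 * C ^ 2 * κ ^ 2 * ((‖q k‖ + D) * (1 / (L₀ + k * t)) ^ 2) := by rw [h2]; ring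
        _ ≤ _ := mul_le_mul_of_nonneg_right h3 h4)
    (by
      intro k hk
      have h1 := hdiff k (by omega)
      have h2 : ‖q (k + 1)‖ ≤ ‖q k‖ + ‖q (k + 1) - q k‖ := by
        have := norm_add_le (q k) (q (k + 1) - q k)
        rwa [add_sub_cancel] at this
      have h3 : C * (st k).1 ≤ A * X k := by
        have : C ≤ A := by
          have : 0 ≤ 5 * C ^ 2 * κ ^ 2 + C₁ + 4 * C := by positivity
          rw [hA]; linarith
        have := hXe k
        have := (hst_nonneg k).1
        gcongr
      change ‖q (k + 1)‖ ≤ ‖q k‖ + A * X k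
      linarith) (n + 1) (by omega)
  have hcn : c n = x₀ := by simp [hc]
  have hcN : c N = y := by simp [hc]; omega
  have e1 : ∫ z, η y (σ ^ N * R) z • ∇ φ (y - (σ ^ N * R) • z) = q (N + 1) := by
    rw [hqs, hcN, hρ]
  have e2 : ∫ z, η x₀ (σ ^ n * R) z • ∇ φ (x₀ - (σ ^ n * R) • z) = q (n + 1) := by
    rw [hqs, hcn, hρ]
  have e3 : Real.log (1 / (σ ^ n * R)) = L₀ + n * t := by rw [← hlog, hρ]
  rw [e1, e2, e3, ← Finset.sum_Ico_sub q (by omega : n + 1 ≤ N + 1)]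
  have hn0 : 0 < L₀ + n * t := by linarith [hLk n]
  calc _ ≤ ∑ k ∈ Finset.Ico (n + 1) (N + 1), ‖q (k + 1) - q k‖ := norm_sum_le _ _
    _ ≤ ∑ k ∈ Finset.Ico (n + 1) (N + 1), C * X k := by
        refine Finset.sum_le_sum fun k hk => ?_
        have hk' : k ≤ N := by have := (Finset.mem_Ico.1 hk).2; omega
        exact (hdiff k hk').trans (mul_le_mul_of_nonneg_left (hXe k) hC0.le)
    _ = C * ∑ k ∈ Finset.Ico (n + 1) (N + 1), X k := (Finset.mul_sum _ _ _).symm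
    _ ≤ C * (B * D * ((1 / 2) ^ (n + 1) + 1 / (L₀ + (n + 1 : ℕ) * t))) := by gcongr
    _ ≤ C * (B * D * (2 * ((1 / 2) ^ n + 1 / (L₀ + n * t)))) := by
        have h1 : 1 / (L₀ + (n + 1 : ℕ) * t) ≤ 1 / (L₀ + n * t) := by
          refine one_div_le_one_div_of_le hn0 ?_
          push_cast
          linarith
        have h2 : (1 / 2 : ℝ) ^ (n + 1) ≤ (1 / 2) ^ n :=
          pow_le_pow_of_le_one (by norm_num) (by norm_num) (by omega)
        have h3 : 0 ≤ (1 / 2 : ℝ) ^ n := by positivity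
        have h4 : 0 ≤ 1 / (L₀ + n * t) := by positivity
        gcongr
        linarith
    _ = _ := by ring

theorem IsAdaptedKernel.integrable_smul_comp {C : ℝ} {M : E →L[ℝ] E} {η Ψ : E → ℝ}
    (h : IsAdaptedKernel C M η Ψ) {G : E → E} (hG : MemLp G 2) (y : E) {ρ : ℝ} (hρ : 0 < ρ) :
    Integrable fun z => η z • G (y - ρ • z) := by
  have h1 : MemLp (fun z => G (y - ρ • z)) 2 := by
    have := MemLp.comp_affine hG y (neg_ne_zero.2 hρ.ne')
    simpa [neg_smul, sub_eq_add_neg] using this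
  have h2 : MemLp η 2 := h.contDiff_η.continuous.memLp_of_hasCompactSupport h.hasCompactSupport_η
  exact memLp_one_iff_integrable.1 (h1.smul (r := 1) h2)

theorem IsAdaptedKernel.sq_norm_integral_smul_comp_le {C : ℝ} {M : E →L[ℝ] E} {η Ψ : E → ℝ}
    (h : IsAdaptedKernel C M η Ψ) {G : E → E} (hG : MemLp G 2) (y : E) {ρ : ℝ} (hρ : 0 < ρ) :
    ‖∫ z, η z • G (y - ρ • z)‖ ^ 2 ≤ C * (ρ ^ Module.finrank ℝ E)⁻¹ * ∫ x, ‖G x‖ ^ 2 := by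
  have h1 : MemLp (fun z => G (y - ρ • z)) 2 := by
    have := MemLp.comp_affine hG y (neg_ne_zero.2 hρ.ne')
    simpa [neg_smul, sub_eq_add_neg] using this
  have h2 : MemLp η 2 := h.contDiff_η.continuous.memLp_of_hasCompactSupport h.hasCompactSupport_η
  have hη2 : Integrable fun z => η z ^ 2 := h2.integrable_sq
  have h3 : ‖∫ z, η z • G (y - ρ • z)‖ ≤ ∫ z, η z * ‖G (y - ρ • z)‖ := by
    refine (norm_integral_le_integral_norm _).trans_eq (integral_congr_ae (.of_forall fun z => ?_))
    simp [norm_smul, abs_of_nonneg (h.η_nonneg z)]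
  have h4 : ∫ z, η z ^ 2 ≤ C := by
    calc ∫ z, η z ^ 2 ≤ ∫ z, C * η z := by
          refine integral_mono hη2 (h.integrable_η.const_mul _) fun z => ?_
          have := h.η_le z
          have := h.η_nonneg z
          simp only
          nlinarith
      _ = C := by rw [integral_const_mul, h.integral_η, mul_one]
  have h5 : ∫ z, ‖G (y - ρ • z)‖ ^ 2 = (ρ ^ Module.finrank ℝ E)⁻¹ * ∫ x, ‖G x‖ ^ 2 := by
    have := integral_comp_affine y (-ρ) fun x => ‖G x‖ ^ 2
    rw [abs_inv, abs_pow, abs_neg, abs_of_pos hρ] at this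
    rw [← this]
    simp [neg_smul, sub_eq_add_neg]
  calc _ ≤ (∫ z, η z * ‖G (y - ρ • z)‖) ^ 2 := by gcongr
    _ ≤ (∫ z, η z ^ 2) * ∫ z, ‖G (y - ρ • z)‖ ^ 2 :=
        sq_integral_mul_le h2.aestronglyMeasurable h1.norm.aestronglyMeasurable hη2
          (MemLp.integrable_norm_sq h1)
    _ ≤ C * ∫ z, ‖G (y - ρ • z)‖ ^ 2 := by
        refine mul_le_mul_of_nonneg_right h4 (integral_nonneg fun z => by positivity)
    _ = _ := by rw [h5]; ring

/-- At Lebesgue points, averages against adapted kernels at scales tending to zero converge. -/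
theorem ae_tendsto_integral_adaptedKernel {C : ℝ} {W : E → E} (hW : MemLp W 2) {ρ : ℕ → ℝ}
    (hρ : ∀ n, 0 < ρ n) (hρ0 : Tendsto ρ atTop (𝓝 0)) :
    ∀ᵐ y, ∀ (M : ℕ → E →L[ℝ] E) (η Ψ : ℕ → E → ℝ),
      (∀ n, IsAdaptedKernel C (M n) (η n) (Ψ n)) →
      Tendsto (fun n => ∫ z, η n z • W (y - ρ n • z)) atTop (𝓝 (W y)) := by
  have hloc : LocallyIntegrable W := hW.locallyIntegrable (by norm_num)
  filter_upwards [(Besicovitch.vitaliFamily (volume : Measure E)).ae_tendsto_average_norm_sub hloc]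
    with y hy M η Ψ hη
  have h1 : Tendsto (fun n => ⨍ z in closedBall y (ρ n), ‖W z - W y‖) atTop (𝓝 0) :=
    hy.comp ((Besicovitch.tendsto_filterAt volume y).comp
      (tendsto_nhdsWithin_iff.2 ⟨hρ0, .of_forall hρ⟩))
  have hC : 0 ≤ C := ((hη 0).η_nonneg 0).trans ((hη 0).η_le 0)
  have h2 := h1.const_mul (C * volume.real (ball (0 : E) 1))
  rw [mul_zero] at h2
  rw [tendsto_iff_norm_sub_tendsto_zero]
  refine squeeze_zero (fun _ => norm_nonneg _) (fun n => ?_) h2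
  have hn := hρ n
  have e1 : W y = ∫ z, η n z • W y := by
    rw [integral_smul_const, (hη n).integral_η, one_smul]
  have e2 : (∫ z, η n z • W (y - ρ n • z)) - W y = ∫ z, η n z • (W (y - ρ n • z) - W y) := by
    conv_lhs => rw [e1]
    rw [← integral_sub ((hη n).integrable_smul_comp hW y hn) ((hη n).integrable_η.smul_const _)]
    simp only [smul_sub]
  have hI : IntegrableOn (fun z => ‖W z - W y‖) (closedBall y (ρ n)) :=
    ((hloc.integrableOn_isCompact (isCompact_closedBall _ _)).sub
      (integrableOn_const measure_closedBall_lt_top.ne)).norm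
  set g : E → ℝ := (closedBall y (ρ n)).indicator fun z => ‖W z - W y‖ with hg
  have hg1 : Integrable g := (integrable_indicator_iff measurableSet_closedBall).2 hI
  have hgc : Integrable fun z => g (y + (-ρ n) • z) := by
    have := (hg1.comp_add_left y).comp_smul (neg_ne_zero.2 hn.ne')
    exact this
  have hvol : volume.real (closedBall y (ρ n)) =
      ρ n ^ Module.finrank ℝ E * volume.real (ball (0 : E) 1) := by
    rw [Measure.real, Measure.addHaar_closedBall _ _ hn.le, ENNReal.toReal_mul,
      ENNReal.toReal_ofReal (by positivity)]
    rfl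
  rw [e2]
  calc _ ≤ ∫ z, ‖η n z • (W (y - ρ n • z) - W y)‖ := norm_integral_le_integral_norm _
    _ ≤ ∫ z, C * g (y + (-ρ n) • z) := by
        refine integral_mono_of_nonneg (.of_forall fun z => norm_nonneg _) (hgc.const_mul C)
          (.of_forall fun z => ?_)
        simp only
        rcases lt_or_ge ‖z‖ 1 with hz | hz
        · have : y + (-ρ n) • z ∈ closedBall y (ρ n) := by
            rw [mem_closedBall, dist_eq_norm]
            simp only [add_sub_cancel_left, norm_smul, norm_neg, Real.norm_eq_abs, abs_of_pos hn]
            nlinarith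
          rw [hg, indicator_of_mem this, norm_smul, Real.norm_eq_abs,
            abs_of_nonneg ((hη n).η_nonneg z), neg_smul, ← sub_eq_add_neg]
          exact mul_le_mul_of_nonneg_right ((hη n).η_le z) (norm_nonneg _)
        · rw [(hη n).η_eq_zero z (by linarith), zero_smul, norm_zero]
          exact mul_nonneg hC (indicator_nonneg (fun _ _ => norm_nonneg _) _)
    _ = C * ((ρ n ^ Module.finrank ℝ E)⁻¹ * ∫ z in closedBall y (ρ n), ‖W z - W y‖) := by
        rw [integral_const_mul, integral_comp_affine, abs_inv, abs_pow, abs_neg, abs_of_pos hn, hg,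
          integral_indicator measurableSet_closedBall]
    _ = _ := by
        rw [setAverage_eq, hvol, smul_eq_mul]
        have : 0 < volume.real (ball (0 : E) 1) :=
          ENNReal.toReal_pos (measure_ball_pos _ _ one_pos).ne' measure_ball_lt_top.ne
        have : 0 < ρ n ^ Module.finrank ℝ E := by positivity
        field_simp

/-- `W` is an `L²` limit of gradients of test functions. -/
def IsGradientLimit (W : E → E) : Prop :=
  ∀ ε : ℝ, 0 < ε → ∃ φ : E → ℝ, ContDiff ℝ ∞ φ ∧ HasCompactSupport φ ∧
    ∫ x, ‖W x - ∇ φ x‖ ^ 2 ≤ ε ^ 2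

theorem integral_sq_norm_le_of_sub {V W : E → E} (hV : MemLp V 2) (hW : MemLp W 2) :
    ∫ x, ‖V x‖ ^ 2 ≤ 2 * (∫ x, ‖W x‖ ^ 2) + 2 * ∫ x, ‖W x - V x‖ ^ 2 := by
  have h1 := MemLp.integrable_norm_sq hW
  have h2 := MemLp.integrable_norm_sq (hW.sub hV)
  simp only [Pi.sub_apply] at h2
  rw [← integral_const_mul, ← integral_const_mul,
    ← integral_add (h1.const_mul _) (h2.const_mul _)]
  refine integral_mono (MemLp.integrable_norm_sq hV) ((h1.const_mul _).add (h2.const_mul _))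
    fun x => ?_
  have h3 : ‖V x‖ ≤ ‖W x‖ + ‖W x - V x‖ := by
    have := norm_sub_le (W x) (W x - V x)
    rwa [sub_sub_cancel] at this
  have h4 : ‖V x‖ ^ 2 ≤ (‖W x‖ + ‖W x - V x‖) ^ 2 := by gcongr
  simp only [Pi.add_apply]
  nlinarith [sq_nonneg (‖W x‖ - ‖W x - V x‖)]

theorem exists_ae_norm_sub_le (E : Type*) [NormedAddCommGroup E] [InnerProductSpace ℝ E]
    [FiniteDimensional ℝ E] [MeasurableSpace E] [BorelSpace E] {l L κ : ℝ} (hl : 0 < l)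
    (hL : 0 < L) (hκ : 0 < κ) :
    ∃ σ B R₀ : ℝ, 0 < σ ∧ σ ≤ 1 / 16 ∧ 0 < B ∧ 0 < R₀ ∧ R₀ ≤ 1 / 3 ∧
      ∀ a : E → E →L[ℝ] E, IsEllipticField l L a → LogDini l L κ a →
      ∀ (W : E → E) (x₀ : E) (R : ℝ) (n : ℕ) (D : ℝ), 0 < R → R ≤ R₀ → ball x₀ R ⊆ ball (0 : E) 1 →
        0 < D → StronglyMeasurable W → MemLp W 2 → IsGradientLimit W →
        (∀ ψ : E → ℝ, ContDiff ℝ ∞ ψ → HasCompactSupport ψ → tsupport ψ ⊆ ball x₀ R →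
          ∫ x, ⟪a x (W x), ∇ ψ x⟫ = 0) →
        ∫ x, ‖W x‖ ^ 2 ≤ R ^ Module.finrank ℝ E * D ^ 2 →
        ∃ q : E, ∀ᵐ y, ‖y - x₀‖ ≤ σ ^ (n + 1) * R →
          ‖W y - q‖ ≤ B * D * ((1 / 2) ^ n + 1 / Real.log (1 / (σ ^ n * R))) := by
  obtain ⟨C₀, σ, B, R₀, hC₀, hσ, hσ1, hB, hR₀, hR₀1, H⟩ := exists_smooth_oscillation E hl hL hκ
  refine ⟨σ, 2 * B, R₀, hσ, hσ1, by positivity, hR₀, hR₀1, ?_⟩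
  intro a ha hlog W x₀ R n D hR hRR hball hD hWm hW hlim hsol hWD
  obtain ⟨M, η, Ψ, hη, H⟩ := H a ha hlog
  have hσk : ∀ k : ℕ, 0 < σ ^ k * R ∧ σ ^ k * R ≤ R := fun k =>
    ⟨by positivity, mul_le_of_le_one_left hR.le (pow_le_one₀ hσ.le (by linarith))⟩
  have hlogk : ∀ k : ℕ, 0 < Real.log (1 / (σ ^ k * R)) := fun k =>
    Real.log_pos (by rw [lt_div_iff₀ (hσk k).1]; linarith [(hσk k).2])
  set X : ℝ := (1 / 2) ^ n + 1 / Real.log (1 / (σ ^ n * R)) with hX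
  set q : E := ∫ z, η x₀ (σ ^ n * R) z • W (x₀ - (σ ^ n * R) • z) with hq
  have hηx : IsAdaptedKernel C₀ (M x₀ (σ ^ n * R)) (η x₀ (σ ^ n * R)) (Ψ x₀ (σ ^ n * R)) :=
    hη _ _ (hσk n).1 (by linarith [(hσk n).2])
      ((ball_subset_ball (hσk n).2).trans hball)
  have hσn1 : ∀ N, n + 1 ≤ N → σ ^ N * R ≤ 1 / 16 * R := by
    intro N hN
    have : σ ^ N ≤ σ ^ 1 := pow_le_pow_of_le_one hσ.le (by linarith) (by omega)
    rw [pow_one] at this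
    exact mul_le_mul_of_nonneg_right (this.trans hσ1) hR.le
  have hηy : ∀ y, ‖y - x₀‖ ≤ σ ^ (n + 1) * R → ∀ N, n + 1 ≤ N →
      IsAdaptedKernel C₀ (M y (σ ^ N * R)) (η y (σ ^ N * R)) (Ψ y (σ ^ N * R)) := by
    intro y hy N hN
    refine hη _ _ (hσk N).1 (by linarith [(hσk N).2]) (Subset.trans ?_ hball)
    refine ball_subset_ball' ?_
    rw [dist_eq_norm]
    have := hσn1 N hN
    have := hσn1 (n + 1) le_rfl
    linarith
  -- the bound at a fixed finest scale
  have key : ∀ y, ‖y - x₀‖ ≤ σ ^ (n + 1) * R → ∀ N, n + 1 ≤ N →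
      ‖(∫ z, η y (σ ^ N * R) z • W (y - (σ ^ N * R) • z)) - q‖ ≤ 2 * B * D * X := by
    intro y hy N hN
    set ρ := σ ^ N * R with hρ
    set ρ' := σ ^ n * R with hρ'
    have hρ0 : 0 < ρ := (hσk N).1
    have hρ'0 : 0 < ρ' := (hσk n).1
    set d := Module.finrank ℝ E
    set K : ℝ := √(C₀ * (ρ ^ d)⁻¹) + √(C₀ * (ρ' ^ d)⁻¹) with hK
    have hK0 : 0 ≤ K := by positivity
    -- smallness required of the approximation error
    have hsmall : ∀ᶠ ε : ℝ in 𝓝[>] 0, ε ^ 2 ≤ R ^ d * D ^ 2 ∧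
        ∀ k ∈ Finset.range (N + 1), L ^ 2 * ε ^ 2 ≤ (σ ^ k * R) ^ d *
          (2 * D * (κ / Real.log (1 / (σ ^ k * R))) ^ 2) ^ 2 := by
      have ht : ∀ c : ℝ, Tendsto (fun ε : ℝ => c * ε ^ 2) (𝓝[>] 0) (𝓝 0) := by
        intro c
        have : Tendsto (fun ε : ℝ => c * ε ^ 2) (𝓝 0) (𝓝 (c * 0 ^ 2)) :=
          (by fun_prop : Continuous fun ε : ℝ => c * ε ^ 2).tendsto 0
        simp only [ne_eq, OfNat.ofNat_ne_zero, not_false_eq_true, zero_pow, mul_zero] at this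
        exact this.mono_left nhdsWithin_le_nhds
      refine Filter.Eventually.and ?_ ?_
      · have := (ht 1).eventually_le_const (show 0 < R ^ d * D ^ 2 by positivity)
        simpa only [one_mul] using this
      · rw [Finset.eventually_all]
        intro k _
        have h1 := (hσk k).1
        have h2 := hlogk k
        exact (ht (L ^ 2)).eventually_le_const (by positivity)
    have hev : ∀ᶠ ε : ℝ in 𝓝[>] 0, ‖(∫ z, η y ρ z • W (y - ρ • z)) - q‖ ≤
        2 * B * D * X + K * ε := by
      filter_upwards [hsmall, self_mem_nhdsWithin] with ε hε hε0
      obtain ⟨hε1, hε2⟩ := hε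
      have hε0 : 0 < ε := hε0
      obtain ⟨φ, hφ, hφc, hφW⟩ := hlim ε hε0
      have hgr : MemLp (∇ φ) 2 :=
        (continuous_gradient hφ).memLp_of_hasCompactSupport hφc.gradient
      have hG : MemLp (fun x => W x - ∇ φ x) 2 := hW.sub hgr
      set S : E → E := fun x => a x (W x - ∇ φ x) with hS
      have hSm : StronglyMeasurable S :=
        isBoundedBilinearMap_apply.continuous.comp_stronglyMeasurable
          (ha.stronglyMeasurable.prodMk (hWm.sub (continuous_gradient hφ).stronglyMeasurable))
      have hSL : MemLp S 2 := hG.of_le_mul (c := L) hSm.aestronglyMeasurable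
        (.of_forall fun x => ha.norm_apply_le _ _)
      have hSi : ∫ x, ‖S x‖ ^ 2 ≤ L ^ 2 * ε ^ 2 := by
        calc ∫ x, ‖S x‖ ^ 2 ≤ ∫ x, L ^ 2 * ‖W x - ∇ φ x‖ ^ 2 := by
              refine integral_mono (MemLp.integrable_norm_sq hSL)
                ((MemLp.integrable_norm_sq hG).const_mul _) fun x => ?_
              have := ha.norm_apply_le x (W x - ∇ φ x)
              simp only
              rw [← mul_pow]
              gcongr
          _ ≤ _ := by
              rw [integral_const_mul]
              gcongr
      have hws : IsWeakSol a φ 0 S x₀ R := by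
        intro ψ h1 h2 h3
        rw [← hsol ψ h1 h2 h3]
        refine integral_congr_ae (.of_forall fun x => ?_)
        simp [hS]
      have hD' : ∫ x in ball (0 : E) 1, ‖∇ φ (x₀ + R • x)‖ ^ 2 ≤ (2 * D) ^ 2 := by
        rw [setIntegral_ball_comp_affine x₀ hR fun x => ‖∇ φ x‖ ^ 2]
        have h1 := integral_sq_norm_le_of_sub hgr hW
        have h2 : ∫ x in ball x₀ R, ‖∇ φ x‖ ^ 2 ≤ ∫ x, ‖∇ φ x‖ ^ 2 :=
          setIntegral_le_integral (MemLp.integrable_norm_sq hgr) (.of_forall fun x => by positivity)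
        have hRd : 0 < R ^ d := by positivity
        rw [inv_mul_le_iff₀ hRd]
        nlinarith
      have h1 := H x₀ y R n N φ S (2 * D) hR hRR hball hy hN hφ hSL hSm hws (by positivity) hD'
        fun k hk => hSi.trans (hε2 k (Finset.mem_range.2 (by omega)))
      have hdiff : ∀ (c : E) (r : ℝ) (M' : E →L[ℝ] E) (η' Ψ' : E → ℝ), 0 < r →
          IsAdaptedKernel C₀ M' η' Ψ' →
          ‖(∫ z, η' z • W (c - r • z)) - ∫ z, η' z • ∇ φ (c - r • z)‖ ≤
            √(C₀ * (r ^ d)⁻¹) * ε := by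
        intro c r M' η' Ψ' hr h'
        rw [← integral_sub (h'.integrable_smul_comp hW c hr) (h'.integrable_smul_comp hgr c hr)]
        have h2 := h'.sq_norm_integral_smul_comp_le hG c hr
        have h3 : 0 ≤ C₀ * (r ^ d)⁻¹ := by positivity
        simp only [← smul_sub]
        refine abs_le_of_sq_le_sq' ?_ (by positivity) |>.2
        rw [mul_pow, Real.sq_sqrt h3]
        exact h2.trans (mul_le_mul_of_nonneg_left hφW h3)
      have h2 := hdiff y ρ _ _ _ hρ0 (hηy y hy N hN)
      have h3 := hdiff x₀ ρ' _ _ _ hρ'0 hηx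
      have h4 : ∀ p p' r r' : E, ‖p - r‖ ≤ ‖p - p'‖ + ‖p' - r'‖ + ‖r - r'‖ := by
        intro p p' r r'
        have : p - r = (p - p') + (p' - r') - (r - r') := by abel
        rw [this]
        exact (norm_sub_le _ _).trans (add_le_add_left (norm_add_le _ _) _)
      refine (h4 _ _ _ _).trans ((add_le_add (add_le_add h2 h1) h3).trans (le_of_eq ?_))
      rw [hK]
      ring
    have hlim2 : Tendsto (fun ε : ℝ => 2 * B * D * X + K * ε) (𝓝[>] 0) (𝓝 (2 * B * D * X)) := by
      have : Tendsto (fun ε : ℝ => 2 * B * D * X + K * ε) (𝓝 0) (𝓝 (2 * B * D * X + K * 0)) :=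
        (by fun_prop : Continuous fun ε : ℝ => 2 * B * D * X + K * ε).tendsto 0
      rw [mul_zero, add_zero] at this
      exact this.mono_left nhdsWithin_le_nhds
    exact ge_of_tendsto hlim2 hev
  refine ⟨q, ?_⟩
  have hρt : Tendsto (fun N : ℕ => σ ^ (n + 1 + N) * R) atTop (𝓝 0) := by
    have h1 := (tendsto_pow_atTop_nhds_zero_of_lt_one hσ.le (by linarith : σ < 1)).const_mul
      (σ ^ (n + 1) * R)
    rw [mul_zero] at h1
    refine h1.congr fun N => ?_
    rw [pow_add]
    ring
  filter_upwards [ae_tendsto_integral_adaptedKernel (C := C₀) hW (fun N => (hσk (n + 1 + N)).1) hρt]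
    with y hy hyx
  have h1 := hy (fun N => M y (σ ^ (n + 1 + N) * R)) (fun N => η y (σ ^ (n + 1 + N) * R))
    (fun N => Ψ y (σ ^ (n + 1 + N) * R)) fun N => hηy y hyx _ (by omega)
  exact le_of_tendsto (h1.sub_const q).norm (.of_forall fun N => key y hyx _ (by omega))

/-- Gradients of test functions supported in the unit ball, as elements of `L²`. -/
def testGradients (E : Type*) [NormedAddCommGroup E] [InnerProductSpace ℝ E]
    [FiniteDimensional ℝ E] [MeasurableSpace E] [BorelSpace E] :
    Submodule ℝ (Lp E 2 (volume : Measure E)) where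
  carrier := {g | ∃ φ : E → ℝ, ContDiff ℝ ∞ φ ∧ HasCompactSupport φ ∧ tsupport φ ⊆ ball 0 1 ∧
    g =ᵐ[volume] ∇ φ}
  zero_mem' := by
    refine ⟨fun _ => 0, contDiff_const, .zero, by simp [tsupport], ?_⟩
    filter_upwards [Lp.coeFn_zero E 2 (volume : Measure E)] with x hx
    rw [hx]
    simp
  add_mem' := by
    rintro f g ⟨φ, h1, h2, h3, h4⟩ ⟨ψ, k1, k2, k3, k4⟩
    refine ⟨φ + ψ, h1.add k1, h2.add k2,
      (tsupport_add φ ψ).trans (union_subset h3 k3), ?_⟩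
    filter_upwards [Lp.coeFn_add f g, h4, k4] with x hx hf hg
    rw [hx, Pi.add_apply, hf, hg]
    refine (HasGradientAt.gradient ?_).symm
    have e1 := h1.hasGradientAt x
    have e2 := k1.hasGradientAt x
    rw [hasGradientAt_iff_hasFDerivAt] at *
    refine (e1.add e2).congr_fderiv ?_
    simp
  smul_mem' := by
    rintro c f ⟨φ, h1, h2, h3, h4⟩
    refine ⟨c • φ, h1.const_smul c, h2.smul_left (f := fun _ => c),
      (closure_mono (Function.support_const_smul_subset c φ)).trans h3, ?_⟩
    filter_upwards [Lp.coeFn_smul c f, h4] with x hx hf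
    rw [hx, Pi.smul_apply, hf]
    refine (HasGradientAt.gradient ?_).symm
    have e1 := h1.hasGradientAt x
    rw [hasGradientAt_iff_hasFDerivAt] at *
    refine (e1.const_smul c).congr_fderiv ?_
    simp

/-- The closure in `L²` of the gradients of test functions supported in the unit ball. -/
noncomputable def gradSpace (E : Type*) [NormedAddCommGroup E] [InnerProductSpace ℝ E]
    [FiniteDimensional ℝ E] [MeasurableSpace E] [BorelSpace E] :
    Submodule ℝ (Lp E 2 (volume : Measure E)) :=
  (testGradients E).topologicalClosure

theorem sq_norm_Lp_two (f : Lp E 2 (volume : Measure E)) : ‖f‖ ^ 2 = ∫ x, ‖f x‖ ^ 2 := by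
  rw [← real_inner_self_eq_norm_sq, L2.inner_def]
  simp

theorem isGradientLimit_of_mem_gradSpace {f : Lp E 2 (volume : Measure E)} (hf : f ∈ gradSpace E) :
    IsGradientLimit f := by
  intro ε hε
  obtain ⟨g, ⟨φ, h1, h2, -, h4⟩, hg⟩ := Metric.mem_closure_iff.1 hf ε hε
  refine ⟨φ, h1, h2, ?_⟩
  rw [dist_eq_norm] at hg
  calc ∫ x, ‖f x - ∇ φ x‖ ^ 2 = ∫ x, ‖(f - g) x‖ ^ 2 := by
        refine integral_congr_ae ?_
        filter_upwards [Lp.coeFn_sub f g, h4] with x hx hx'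
        rw [hx, Pi.sub_apply, hx']
    _ = ‖f - g‖ ^ 2 := (sq_norm_Lp_two _).symm
    _ ≤ ε ^ 2 := by gcongr

theorem IsEllipticField.memLp_apply {l L : ℝ} {a : E → E →L[ℝ] E} (ha : IsEllipticField l L a)
    {f : E → E} (hf : MemLp f 2) : MemLp (fun x => a x (f x)) 2 :=
  hf.of_le_mul (c := L) (ha.aestronglyMeasurable_apply hf.aestronglyMeasurable)
    (.of_forall fun x => ha.norm_apply_le _ _)

/-- Pointwise application of an elliptic field on `L²`. -/
noncomputable def IsEllipticField.mulOp {l L : ℝ} {a : E → E →L[ℝ] E} (ha : IsEllipticField l L a) :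
    Lp E 2 (volume : Measure E) →L[ℝ] Lp E 2 (volume : Measure E) :=
  LinearMap.mkContinuous
    { toFun := fun f => (ha.memLp_apply (Lp.memLp f)).toLp
      map_add' := by
        intro f g
        rw [← MemLp.toLp_add]
        refine MemLp.toLp_congr _ _ ?_
        filter_upwards [Lp.coeFn_add f g] with x hx
        simp only [hx, Pi.add_apply, map_add]
      map_smul' := by
        intro c f
        rw [RingHom.id_apply, ← MemLp.toLp_const_smul]
        refine MemLp.toLp_congr _ _ ?_
        filter_upwards [Lp.coeFn_smul c f] with x hx
        simp [hx] } L (by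
    intro f
    refine Lp.norm_le_mul_norm_of_ae_le_mul ?_
    filter_upwards [(ha.memLp_apply (Lp.memLp f)).coeFn_toLp] with x hx
    simp only [LinearMap.coe_mk, AddHom.coe_mk]
    rw [hx]
    exact ha.norm_apply_le _ _)

theorem IsEllipticField.coeFn_mulOp {l L : ℝ} {a : E → E →L[ℝ] E} (ha : IsEllipticField l L a)
    (f : Lp E 2 (volume : Measure E)) : ha.mulOp f =ᵐ[volume] fun x => a x (f x) :=
  (ha.memLp_apply (Lp.memLp f)).coeFn_toLp

theorem IsEllipticField.inner_mulOp {l L : ℝ} {a : E → E →L[ℝ] E} (ha : IsEllipticField l L a)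
    (f g : Lp E 2 (volume : Measure E)) : ⟪ha.mulOp f, g⟫ = ∫ x, ⟪a x (f x), g x⟫ := by
  rw [L2.inner_def]
  refine integral_congr_ae ?_
  filter_upwards [ha.coeFn_mulOp f] with x hx
  rw [hx]

theorem IsEllipticField.le_inner_mulOp {l L : ℝ} {a : E → E →L[ℝ] E} (ha : IsEllipticField l L a)
    (f : Lp E 2 (volume : Measure E)) : l * ‖f‖ ^ 2 ≤ ⟪ha.mulOp f, f⟫ := by
  rw [ha.inner_mulOp, sq_norm_Lp_two, ← integral_const_mul]
  have h1 := Lp.memLp f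
  refine integral_mono ((MemLp.integrable_norm_sq h1).const_mul l) ?_ fun x => ha.le_inner _ _
  have h2 : Integrable fun x => ⟪ha.mulOp f x, f x⟫ := L2.integrable_inner (𝕜 := ℝ) _ _
  refine h2.congr ?_
  filter_upwards [ha.coeFn_mulOp f] with x hx
  rw [hx]

/-- The transposed field. -/
theorem IsEllipticField.adjoint {l L : ℝ} {a : E → E →L[ℝ] E} (ha : IsEllipticField l L a) :
    IsEllipticField l L fun x => ContinuousLinearMap.adjoint (a x) :=
  ⟨(ContinuousLinearMap.adjoint (𝕜 := ℝ) (E := E) (F := E)).continuous.comp_stronglyMeasurable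
    ha.stronglyMeasurable, fun x ξ => by
      rw [ContinuousLinearMap.adjoint_inner_left, real_inner_comm]
      exact ha.le_inner x ξ, fun x => by
      rw [LinearIsometryEquiv.norm_map]
      exact ha.norm_le x⟩

theorem IsEllipticField.inner_mulOp_adjoint {l L : ℝ} {a : E → E →L[ℝ] E}
    (ha : IsEllipticField l L a) (f g : Lp E 2 (volume : Measure E)) :
    ⟪ha.adjoint.mulOp f, g⟫ = ⟪ha.mulOp g, f⟫ := by
  rw [ha.inner_mulOp, ha.adjoint.inner_mulOp]
  refine integral_congr_ae (.of_forall fun x => ?_)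
  simp only
  rw [ContinuousLinearMap.adjoint_inner_left, real_inner_comm]

theorem IsEllipticField.exists_solutionOperator {l L : ℝ} {a : E → E →L[ℝ] E}
    (ha : IsEllipticField l L a) (hl : 0 < l) :
    ∃ T : Lp E 2 (volume : Measure E) →ₗ[ℝ] Lp E 2 (volume : Measure E),
      (∀ f, T f ∈ gradSpace E) ∧ (∀ f, ∀ w ∈ gradSpace E, ⟪ha.mulOp (T f), w⟫ = ⟪f, w⟫) := by
  have : CompleteSpace (gradSpace E) :=
    (Submodule.isClosed_topologicalClosure _).completeSpace_coe
  set P : gradSpace E →L[ℝ] Lp E 2 (volume : Measure E) := (gradSpace E).subtypeL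
  set B : gradSpace E →L[ℝ] gradSpace E →L[ℝ] ℝ :=
    (innerSL ℝ).bilinearComp (ha.mulOp ∘L P) P with hB
  have hBap : ∀ v w, B v w = ⟪ha.mulOp (P v), P w⟫ := fun v w => rfl
  have hco : IsCoercive B := by
    refine ⟨l, hl, fun u => ?_⟩
    rw [hBap, mul_assoc, ← sq]
    exact ha.le_inner_mulOp _
  set e := hco.continuousLinearEquivOfBilin
  refine ⟨(P ∘L (e.symm : gradSpace E →L[ℝ] gradSpace E) ∘L
    ContinuousLinearMap.adjoint P).toLinearMap, fun f => Subtype.coe_prop _, fun f w hw => ?_⟩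
  have h1 := hco.continuousLinearEquivOfBilin_apply
    (e.symm (ContinuousLinearMap.adjoint P f)) ⟨w, hw⟩
  rw [hBap] at h1
  refine h1.symm.trans ?_
  change ⟪e (e.symm _), _⟫ = _
  rw [ContinuousLinearEquiv.apply_symm_apply, ContinuousLinearMap.adjoint_inner_left]
  rfl

theorem IsEllipticField.eq_of_mem_gradSpace {l L : ℝ} {a : E → E →L[ℝ] E}
    (ha : IsEllipticField l L a) (hl : 0 < l) {v w : Lp E 2 (volume : Measure E)}
    (hv : v ∈ gradSpace E) (hw : w ∈ gradSpace E)
    (h : ∀ g ∈ testGradients E, ⟪ha.mulOp v, g⟫ = ⟪ha.mulOp w, g⟫) : v = w := by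
  have h1 : ∀ g ∈ gradSpace E, ⟪ha.mulOp v, g⟫ = ⟪ha.mulOp w, g⟫ := by
    intro g hg
    refine closure_minimal (s := (testGradients E : Set (Lp E 2 (volume : Measure E)))) h ?_ hg
    exact isClosed_eq (by fun_prop) (by fun_prop)
  have h2 := ha.le_inner_mulOp (v - w)
  rw [map_sub, inner_sub_left, h1 _ (Submodule.sub_mem _ hv hw), sub_self] at h2
  have h3 : ‖v - w‖ ^ 2 ≤ 0 := by
    by_contra! h'
    have := mul_pos hl h'
    linarith
  exact sub_eq_zero.1 (norm_eq_zero.1 (pow_eq_zero_iff two_ne_zero |>.1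
    (le_antisymm h3 (by positivity))))

theorem IsEllipticField.norm_le_of_inner_mulOp {l L : ℝ} {a : E → E →L[ℝ] E}
    (ha : IsEllipticField l L a) {v f : Lp E 2 (volume : Measure E)}
    (h : ⟪ha.mulOp v, v⟫ = ⟪f, v⟫) : l * ‖v‖ ≤ ‖f‖ := by
  have h1 := ha.le_inner_mulOp v
  rw [h] at h1
  have h2 := real_inner_le_norm f v
  rcases (norm_nonneg v).eq_or_lt with h0 | h0
  · rw [← h0, mul_zero]
    exact norm_nonneg f
  · nlinarith

theorem LogDini.adjoint {l L κ : ℝ} {a : E → E →L[ℝ] E} (h : LogDini l L κ a) :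
    LogDini l L κ fun x => ContinuousLinearMap.adjoint (a x) := by
  intro c ρ h1 h2 h3
  obtain ⟨M, hM1, hM2, hM3⟩ := h c ρ h1 h2 h3
  refine ⟨ContinuousLinearMap.adjoint M, fun x => ?_, ?_, ?_⟩
  · rw [ContinuousLinearMap.adjoint_inner_left, real_inner_comm]
    exact hM1 x
  · rwa [LinearIsometryEquiv.norm_map]
  · simpa only [← map_sub, LinearIsometryEquiv.norm_map] using hM3

/-- Away from the support of a mean-zero datum `b`, the solution `V` of `div (a V) = div b` is
controlled by the `L¹` norm of `b`. -/
theorem exists_setIntegral_solution_le (E : Type*) [NormedAddCommGroup E] [InnerProductSpace ℝ E]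
    [FiniteDimensional ℝ E] [MeasurableSpace E] [BorelSpace E] {l L κ : ℝ} (hl : 0 < l)
    (hL : 0 < L) (hκ : 0 < κ) :
    ∃ σ B R₀ : ℝ, 0 < σ ∧ σ ≤ 1 / 16 ∧ 0 < B ∧ 0 < R₀ ∧ R₀ ≤ 1 / 3 ∧
      ∀ (a : E → E →L[ℝ] E) (ha : IsEllipticField l L a), LogDini l L κ a →
      ∀ (b V : Lp E 2 (volume : Measure E)), V ∈ gradSpace E →
        (∀ w ∈ gradSpace E, ⟪ha.mulOp V, w⟫ = ⟪b, w⟫) →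
      ∀ (x₀ : E) (r R : ℝ) (n : ℕ) (S : Set E), 0 < R → R ≤ R₀ → ball x₀ R ⊆ ball (0 : E) 1 →
        r ≤ σ ^ (n + 1) * R → (∀ᵐ x, x ∉ ball x₀ r → b x = 0) → ∫ x, b x = 0 →
        MeasurableSet S → Disjoint S (ball x₀ R) → volume S < ⊤ →
        volume.real S ≤
          volume.real (ball (0 : E) 1) * ((σ * R₀) ^ Module.finrank ℝ E)⁻¹ *
            R ^ Module.finrank ℝ E →
        ∫ x in S, ‖V x‖ ≤ B * ((1 / 2) ^ n + 1 / Real.log (1 / (σ ^ n * R))) * ∫ x, ‖b x‖ := by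
  obtain ⟨σ, B, R₀, hσ, hσ1, hB, hR₀, hR₀1, H⟩ := exists_ae_norm_sub_le E hl hL hκ
  set d := Module.finrank ℝ E
  set Q : ℝ := √(volume.real (ball (0 : E) 1) * ((σ * R₀) ^ d)⁻¹) with hQ
  have hV1 : 0 < volume.real (ball (0 : E) 1) :=
    ENNReal.toReal_pos (measure_ball_pos _ _ one_pos).ne' measure_ball_lt_top.ne
  have hQ0 : 0 < Q := by positivity
  refine ⟨σ, Q * (B / l), R₀, hσ, hσ1, by positivity, hR₀, hR₀1, ?_⟩
  intro a ha hlog b V hV hsol x₀ r R n S hR hRR hball hr hb hb0 hS hSd hSf hSv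
  have hσn : 0 < σ ^ n * R ∧ σ ^ n * R ≤ R :=
    ⟨by positivity, mul_le_of_le_one_left hR.le (pow_le_one₀ hσ.le (by linarith))⟩
  have hlogn : 0 < Real.log (1 / (σ ^ n * R)) :=
    Real.log_pos (by rw [lt_div_iff₀ hσn.1]; linarith [hσn.2])
  set X : ℝ := (1 / 2) ^ n + 1 / Real.log (1 / (σ ^ n * R)) with hX
  have hX0 : 0 < X := by positivity
  set K : ℝ := ∫ x, ‖b x‖ with hK
  have hK0 : 0 ≤ K := integral_nonneg fun _ => norm_nonneg _
  have hbi : Integrable b := by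
    have h1 : IntegrableOn b (ball x₀ r) :=
      (Lp.memLp b).locallyIntegrable (by norm_num) |>.integrableOn_isCompact
        (isCompact_closedBall x₀ r) |>.mono_set ball_subset_closedBall
    exact h1.integrable_of_ae_notMem_eq_zero hb
  -- the dual problem
  obtain ⟨T', hT'1, hT'2⟩ := ha.adjoint.exists_solutionOperator hl
  have hm : MemLp (S.indicator V) 2 := (Lp.memLp V).indicator hS
  set h : Lp E 2 (volume : Measure E) := hm.toLp with hh
  have hhe : h =ᵐ[volume] S.indicator V := hm.coeFn_toLp
  set W := T' h with hW
  have hWn : l * ‖W‖ ≤ ‖h‖ := ha.adjoint.norm_le_of_inner_mulOp (hT'2 h _ (hT'1 h))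
  have hhsq : ‖h‖ ^ 2 = ∫ x in S, ‖V x‖ ^ 2 := by
    rw [sq_norm_Lp_two, ← integral_indicator hS]
    refine integral_congr_ae ?_
    filter_upwards [hhe] with x hx
    rw [hx]
    by_cases h' : x ∈ S <;> simp [h']
  have hdual : ‖h‖ ^ 2 = ⟪b, W⟫ := by
    rw [← hsol W (hT'1 h), ← ha.inner_mulOp_adjoint, hT'2 h V hV, hhsq, L2.inner_def,
      ← integral_indicator hS]
    refine integral_congr_ae ?_
    filter_upwards [hhe] with x hx
    rw [hx]
    by_cases h' : x ∈ S <;> simp [h']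
  have hRd : 0 < R ^ d := by positivity
  have hmain : ‖h‖ ≤ B / l * X * K * √((R ^ d)⁻¹) := by
    rcases (norm_nonneg h).eq_or_lt with h0 | h0
    · rw [← h0]
      positivity
    set D : ℝ := ‖h‖ / l * √((R ^ d)⁻¹) with hD
    have hD0 : 0 < D := by positivity
    obtain ⟨q, hq⟩ := H _ ha.adjoint hlog.adjoint W x₀ R n D hR hRR hball hD0
      (Lp.stronglyMeasurable W) (Lp.memLp W) (isGradientLimit_of_mem_gradSpace (hT'1 h)) (by
        intro ψ h1 h2 h3
        have hg : MemLp (∇ ψ) 2 :=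
          (continuous_gradient h1).memLp_of_hasCompactSupport h2.gradient
        have hgm : hg.toLp ∈ testGradients E := ⟨ψ, h1, h2, h3.trans hball, hg.coeFn_toLp⟩
        have h4 := hT'2 h _ ((testGradients E).le_topologicalClosure hgm)
        rw [ha.adjoint.inner_mulOp, L2.inner_def] at h4
        have h5 : ∫ x, ⟪ContinuousLinearMap.adjoint (a x) (W x), ∇ ψ x⟫ =
            ∫ x, ⟪ContinuousLinearMap.adjoint (a x) (W x), (hg.toLp : E → E) x⟫ := by
          refine integral_congr_ae ?_
          filter_upwards [hg.coeFn_toLp] with x hx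
          rw [hx]
        rw [h5, h4, ← integral_zero E ℝ (μ := volume)]
        refine integral_congr_ae ?_
        filter_upwards [hg.coeFn_toLp, hhe] with x hx hx'
        rw [hx, hx']
        by_cases hxS : x ∈ S
        · have h6 : x ∉ tsupport ψ := fun h' => disjoint_left.1 hSd hxS (h3 h')
          have h7 : ∇ ψ x = 0 := by
            have : fderiv ℝ ψ x = 0 := by
              by_contra h'
              exact h6 (support_fderiv_subset ℝ (by simpa using h'))
            simp [gradient, this]
          rw [h7, inner_zero_right]
        · simp [hxS]) (by
        rw [← sq_norm_Lp_two, hD, mul_pow, Real.sq_sqrt (by positivity)]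
        have : ‖W‖ ≤ ‖h‖ / l := by
          rw [le_div_iff₀ hl]
          linarith
        calc ‖W‖ ^ 2 ≤ (‖h‖ / l) ^ 2 := by gcongr
          _ = _ := by field_simp)
    have h1 : ⟪b, W⟫ = ∫ x, ⟪b x, W x - q⟫ := by
      have h2 : Integrable fun x => ⟪b x, W x⟫ := L2.integrable_inner (𝕜 := ℝ) b W
      have h3 : Integrable fun x => ⟪b x, q⟫ := hbi.inner_const q
      simp only [inner_sub_right]
      rw [integral_sub h2 h3, L2.inner_def]
      have : ∫ x, ⟪b x, q⟫ = 0 := by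
        have h4 := integral_inner (𝕜 := ℝ) hbi q
        simp only [real_inner_comm] at h4 ⊢
        rw [h4, hb0, inner_zero_right]
      rw [this, sub_zero]
    have h2 : ‖h‖ ^ 2 ≤ B * D * X * K := by
      rw [hdual, h1, hK, ← integral_const_mul]
      refine (le_abs_self _).trans ((abs_integral_le_integral_abs).trans ?_)
      refine integral_mono_of_nonneg (.of_forall fun _ => abs_nonneg _) (hbi.norm.const_mul _) ?_
      filter_upwards [hq, hb] with x hx hx'
      by_cases hxr : x ∈ ball x₀ r
      · rw [mem_ball, dist_eq_norm] at hxr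
        calc |⟪b x, W x - q⟫| ≤ ‖b x‖ * ‖W x - q‖ := abs_real_inner_le_norm _ _
          _ ≤ ‖b x‖ * (B * D * X) := by
              gcongr
              exact hx (hxr.le.trans hr)
          _ = _ := by ring
      · rw [hx' hxr]
        simp
    have h3 : ‖h‖ * ‖h‖ ≤ ‖h‖ * (B / l * X * K * √((R ^ d)⁻¹)) := by
      rw [← sq]
      refine h2.trans (le_of_eq ?_)
      rw [hD]
      field_simp
    exact le_of_mul_le_mul_left h3 h0
  have hVi : Integrable fun x => ‖V x‖ ^ 2 := MemLp.integrable_norm_sq (Lp.memLp V)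
  have : IsFiniteMeasure (volume.restrict S) := ⟨by simpa using hSf⟩
  have h1 : (∫ x in S, ‖V x‖) ^ 2 ≤ volume.real S * ‖h‖ ^ 2 := by
    have := sq_integral_le (μ := volume.restrict S)
      (Lp.aestronglyMeasurable V).norm.restrict hVi.integrableOn
    rw [hhsq]
    simpa using this
  refine abs_le_of_sq_le_sq' (h1.trans ?_) (by positivity) |>.2
  have h2 : ‖h‖ ^ 2 ≤ (B / l * X * K) ^ 2 * (R ^ d)⁻¹ := by
    calc _ ≤ (B / l * X * K * √((R ^ d)⁻¹)) ^ 2 := by gcongr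
      _ = _ := by rw [mul_pow, Real.sq_sqrt (by positivity)]
  have hQsq : Q ^ 2 = volume.real (ball (0 : E) 1) * ((σ * R₀) ^ d)⁻¹ :=
    Real.sq_sqrt (by positivity)
  calc volume.real S * ‖h‖ ^ 2 ≤ (Q ^ 2 * R ^ d) * ((B / l * X * K) ^ 2 * (R ^ d)⁻¹) := by
        rw [hQsq]
        gcongr
    _ = _ := by field_simp

theorem sum_half_pow_add_le {N : ℕ} {ℓ : ℝ} (hℓ : (N + 1 : ℕ) ≤ ℓ) :
    ∑ n ∈ Finset.range (N + 1), ((1 / 2 : ℝ) ^ n + 1 / ℓ) ≤ 3 := by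
  have hℓ0 : 0 < ℓ := lt_of_lt_of_le (by positivity) hℓ
  rw [Finset.sum_add_distrib, Finset.sum_const, Finset.card_range, nsmul_eq_mul]
  have h1 : ∑ n ∈ Finset.range (N + 1), (1 / 2 : ℝ) ^ n ≤ 2 := by
    have h := summable_geometric_two.sum_le_tsum (Finset.range (N + 1)) fun _ _ => by positivity
    rwa [tsum_geometric_two] at h
  have h2 : ((N + 1 : ℕ) : ℝ) * (1 / ℓ) ≤ 1 := by
    rw [mul_one_div]
    exact (div_le_one hℓ0).2 hℓ
  linarith

theorem sdiff_eq_inter_sdiff_union {α : Type*} {s t u : Set α} (h : t ⊆ u) :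
    s \ t = s ∩ (u \ t) ∪ s \ u := by
  ext x
  have := @h x
  simp only [Set.mem_sdiff, mem_union, mem_inter_iff]
  tauto

theorem exists_hormander (E : Type*) [NormedAddCommGroup E] [InnerProductSpace ℝ E]
    [FiniteDimensional ℝ E] [MeasurableSpace E] [BorelSpace E] {l L κ : ℝ} (hl : 0 < l)
    (hL : 0 < L) (hκ : 0 < κ) :
    ∃ A C : ℝ, 0 < A ∧ 0 < C ∧
      ∀ (a : E → E →L[ℝ] E) (ha : IsEllipticField l L a), LogDini l L κ a →
      ∀ (b V : Lp E 2 (volume : Measure E)), V ∈ gradSpace E →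
        (∀ w ∈ gradSpace E, ⟪ha.mulOp V, w⟫ = ⟪b, w⟫) →
      ∀ (x₀ : E) (r : ℝ), 0 < r → ‖x₀‖ ≤ 2 / 3 → (∀ᵐ x, x ∉ ball x₀ r → b x = 0) →
        ∫ x, b x = 0 →
        ∫ x in ball (0 : E) 1 \ ball x₀ (A * r), ‖V x‖ ≤ C * ∫ x, ‖b x‖ := by
  obtain ⟨σ, B, R₀, hσ, hσ1, hB, hR₀, hR₀1, H⟩ := exists_setIntegral_solution_le E hl hL hκ
  set d := Module.finrank ℝ E
  refine ⟨2 / (σ * R₀), B * 3, by positivity, by positivity, ?_⟩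
  intro a ha hlog b V hV hsol x₀ r hr hx₀ hb hb0
  set K : ℝ := ∫ x, ‖b x‖ with hK
  have hK0 : 0 ≤ K := integral_nonneg fun _ => norm_nonneg _
  set V1 := volume.real (ball (0 : E) 1) with hV1
  have hV10 : 0 < V1 :=
    ENNReal.toReal_pos (measure_ball_pos _ _ one_pos).ne' measure_ball_lt_top.ne
  have hσR : σ * R₀ ≤ 1 := by nlinarith
  have hVi : IntegrableOn (fun x => ‖V x‖) (ball (0 : E) 1) :=
    (((Lp.memLp V).locallyIntegrable (by norm_num)).integrableOn_isCompact
      (isCompact_closedBall 0 1) |>.mono_set ball_subset_closedBall).norm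
  rcases lt_or_ge (σ * R₀) r with hlarge | hsmall
  · have : ball (0 : E) 1 \ ball x₀ (2 / (σ * R₀) * r) = ∅ := by
      rw [sdiff_eq_empty]
      refine ball_subset_ball' ?_
      rw [dist_eq_norm, zero_sub, norm_neg]
      have : 2 ≤ 2 / (σ * R₀) * r := by
        rw [div_mul_eq_mul_div, le_div_iff₀ (by positivity)]
        linarith
      linarith
    rw [this]
    simp only [Measure.restrict_empty, integral_zero_measure]
    positivity
  set ρ : ℕ → ℝ := fun n => r * σ⁻¹ ^ (n + 1) with hρ
  have hρ0 : ∀ n, 0 < ρ n := fun n => by positivity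
  have hσi : 16 ≤ σ⁻¹ := by
    rw [le_inv_comm₀ (by norm_num) hσ]
    linarith
  obtain ⟨N, hN1, hN2⟩ : ∃ N : ℕ, ρ N ≤ R₀ ∧ R₀ < ρ (N + 1) := by
    obtain ⟨N, h1, h2⟩ := exists_nat_pow_near (x := σ * R₀ / r) (y := σ⁻¹)
      ((one_le_div hr).2 hsmall) (by linarith)
    refine ⟨N, ?_, ?_⟩
    · rw [le_div_iff₀ hr] at h1
      calc ρ N = σ⁻¹ ^ N * r * σ⁻¹ := by rw [hρ]; ring
        _ ≤ σ * R₀ * σ⁻¹ := by gcongr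
        _ = R₀ := by field_simp
    · rw [div_lt_iff₀ hr] at h2
      calc R₀ = σ * R₀ * σ⁻¹ := by field_simp
        _ < σ⁻¹ ^ (N + 1) * r * σ⁻¹ := by gcongr
        _ = _ := by rw [hρ]; ring
  have hρm : ∀ n, ρ n ≤ ρ (n + 1) := by
    intro n
    simp only [hρ]
    have : 0 < r * σ⁻¹ ^ (n + 1) := by positivity
    rw [pow_succ _ (n + 1), ← mul_assoc]
    nlinarith
  have hρN : ∀ n ≤ N, ρ n ≤ R₀ := fun n hn =>
    (monotone_nat_of_le_succ hρm hn).trans hN1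
  set ℓ : ℝ := Real.log (σ / r) with hℓ
  have hℓN : ((N + 1 : ℕ) : ℝ) ≤ ℓ := by
    rw [hℓ, Real.le_log_iff_exp_le (by positivity)]
    have h1 : Real.exp ((N + 1 : ℕ) : ℝ) ≤ 3 ^ (N + 1) := by
      rw [← Real.exp_one_pow]
      have := Real.exp_one_lt_d9
      gcongr
      linarith
    refine h1.trans ?_
    rw [le_div_iff₀ hr]
    have h2 : (3 : ℝ) ^ N ≤ σ⁻¹ ^ N := by gcongr; linarith
    have h3 : r * σ⁻¹ ^ (N + 1) ≤ 1 / 3 := hN1.trans hR₀1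
    have h4 : r * σ⁻¹ ^ N ≤ 1 / 3 * σ := by
      calc r * σ⁻¹ ^ N = r * σ⁻¹ ^ (N + 1) * σ := by rw [pow_succ]; field_simp
        _ ≤ _ := by gcongr
    calc (3 : ℝ) ^ (N + 1) * r = 3 * (r * 3 ^ N) := by ring
      _ ≤ 3 * (r * σ⁻¹ ^ N) := by gcongr
      _ ≤ _ := by linarith
  have step : ∀ n ≤ N, ∀ S : Set E, MeasurableSet S → Disjoint S (ball x₀ (ρ n)) →
      S ⊆ ball 0 1 → volume.real S ≤ V1 * ((σ * R₀) ^ d)⁻¹ * ρ n ^ d →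
      ∫ x in S, ‖V x‖ ≤ B * K * ((1 / 2) ^ n + 1 / ℓ) := by
    intro n hn S hS hSd hSB hSv
    have hσρ : σ ^ (n + 1) * ρ n = r := by
      simp only [hρ]
      rw [inv_pow]
      field_simp
    have hσρ' : 1 / (σ ^ n * ρ n) = σ / r := by
      have : r = σ * (σ ^ n * ρ n) := by rw [← hσρ]; ring
      have := hρ0 n
      rw [‹r = _›]
      field_simp
    have hb' : ball x₀ (ρ n) ⊆ ball (0 : E) 1 := by
      refine ball_subset_ball' ?_
      rw [dist_zero_right]
      have := hρN n hn
      linarith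
    have := H a ha hlog b V hV hsol x₀ r (ρ n) n S (hρ0 n) (hρN n hn) hb' hσρ.ge hb hb0 hS hSd
      ((measure_mono hSB).trans_lt measure_ball_lt_top) hSv
    rw [hσρ'] at this
    refine this.trans (le_of_eq ?_)
    ring
  have hind : ∀ n ≤ N, ∫ x in ball (0 : E) 1 \ ball x₀ (ρ (N - n)), ‖V x‖ ≤
      ∑ k ∈ Finset.Ico (N - n) (N + 1), B * K * ((1 / 2) ^ k + 1 / ℓ) := by
    intro n
    induction n with
    | zero =>
      intro _
      rw [Nat.sub_zero, Nat.Ico_succ_singleton, Finset.sum_singleton]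
      refine step N le_rfl _ (measurableSet_ball.diff measurableSet_ball) disjoint_sdiff_left
        sdiff_subset ?_
      calc volume.real (ball (0 : E) 1 \ ball x₀ (ρ N)) ≤ V1 :=
            measureReal_mono sdiff_subset measure_ball_lt_top.ne
        _ ≤ V1 * (((σ * R₀) ^ d)⁻¹ * ρ N ^ d) := by
            refine le_mul_of_one_le_right hV10.le ?_
            rw [← inv_pow, ← mul_pow]
            refine one_le_pow₀ ?_
            rw [inv_mul_eq_div, one_le_div (by positivity)]
            calc σ * R₀ ≤ σ * ρ (N + 1) := by gcongr
              _ = ρ N := by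
                simp only [hρ]
                rw [pow_succ _ (N + 1)]
                field_simp
        _ = _ := by ring
    | succ n ih =>
      intro hn
      have ih := ih (by omega)
      set m := N - (n + 1) with hm
      have hm1 : N - n = m + 1 := by omega
      rw [hm1] at ih
      rw [Finset.sum_eq_sum_Ico_succ_bot (by omega : m < N + 1)]
      have hsub : ball (0 : E) 1 \ ball x₀ (ρ m) =
          (ball (0 : E) 1 ∩ (ball x₀ (ρ (m + 1)) \ ball x₀ (ρ m))) ∪
            (ball (0 : E) 1 \ ball x₀ (ρ (m + 1))) :=
        sdiff_eq_inter_sdiff_union (ball_subset_ball (hρm m))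
      have hdisj : Disjoint (ball (0 : E) 1 ∩ (ball x₀ (ρ (m + 1)) \ ball x₀ (ρ m)))
          (ball (0 : E) 1 \ ball x₀ (ρ (m + 1))) := by
        rw [disjoint_left]
        rintro x ⟨-, h1, -⟩ ⟨-, h2⟩
        exact h2 h1
      rw [hsub, setIntegral_union hdisj (measurableSet_ball.diff measurableSet_ball)
        (hVi.mono_set inter_subset_left) (hVi.mono_set sdiff_subset)]
      refine add_le_add (step m (by omega) _
        (measurableSet_ball.inter (measurableSet_ball.diff measurableSet_ball)) ?_
        inter_subset_left ?_) ih
      · exact disjoint_sdiff_left.mono_left inter_subset_right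
      · have h1 : volume.real (ball x₀ (ρ (m + 1))) = ρ (m + 1) ^ d * V1 := by
          rw [Measure.real, Measure.addHaar_ball_of_pos _ _ (hρ0 _), ENNReal.toReal_mul,
            ENNReal.toReal_ofReal (pow_nonneg (hρ0 _).le _)]
          rfl
        calc _ ≤ volume.real (ball x₀ (ρ (m + 1))) :=
              measureReal_mono (inter_subset_right.trans sdiff_subset) measure_ball_lt_top.ne
          _ = V1 * ((σ⁻¹ * ρ m) ^ d) := by
              rw [h1, mul_comm]
              simp only [hρ]
              ring
          _ ≤ V1 * (((σ * R₀)⁻¹ * ρ m) ^ d) := by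
              have := hρ0 m
              have h2 : σ⁻¹ ≤ (σ * R₀)⁻¹ := by
                gcongr
                nlinarith
              gcongr
          _ = _ := by rw [mul_pow, inv_pow]; ring
  have hfin := hind N le_rfl
  rw [Nat.sub_self, ← Finset.mul_sum, ← Finset.range_eq_Ico] at hfin
  have hsub : ball (0 : E) 1 \ ball x₀ (2 / (σ * R₀) * r) ⊆ ball (0 : E) 1 \ ball x₀ (ρ 0) := by
    refine sdiff_subset_sdiff_right (ball_subset_ball ?_)
    simp only [hρ, zero_add, pow_one]
    rw [mul_comm]
    gcongr
    rw [inv_eq_one_div, div_le_div_iff₀ hσ (by positivity)]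
    nlinarith
  calc _ ≤ ∫ x in ball (0 : E) 1 \ ball x₀ (ρ 0), ‖V x‖ :=
        setIntegral_mono_set (hVi.mono_set sdiff_subset) (.of_forall fun _ => norm_nonneg _)
          (HasSubset.Subset.eventuallyLE hsub)
    _ ≤ _ := hfin
    _ ≤ B * K * 3 := by
        gcongr
        exact sum_half_pow_add_le hℓN
    _ = _ := by ring

/-- The half-open cube with corner `c` and side `ℓ`. -/
def cube {d : ℕ} (c : Fin d → ℝ) (ℓ : ℝ) : Set (EuclideanSpace ℝ (Fin d)) :=
  {y | ∀ i, c i ≤ y i ∧ y i < c i + ℓ}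

theorem measurableSet_cube {d : ℕ} (c : Fin d → ℝ) (ℓ : ℝ) : MeasurableSet (cube c ℓ) := by
  have : cube c ℓ = ⋂ i, {y | c i ≤ y i} ∩ {y | y i < c i + ℓ} := by
    ext y
    simp [cube]
  rw [this]
  refine MeasurableSet.iInter fun i => ?_
  exact (measurableSet_le (by fun_prop) (by fun_prop)).inter
    (measurableSet_lt (by fun_prop) (by fun_prop))

theorem volume_cube {d : ℕ} (c : Fin d → ℝ) {ℓ : ℝ} (hℓ : 0 ≤ ℓ) :
    volume (cube c ℓ) = ENNReal.ofReal (ℓ ^ d) := by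
  have h := (EuclideanSpace.volume_preserving_symm_measurableEquiv_toLp (Fin d))
  have e : cube c ℓ = (MeasurableEquiv.toLp 2 (Fin d → ℝ)).symm ⁻¹'
      (Set.pi univ fun i => Ico (c i) (c i + ℓ)) := by
    ext y
    simp [cube]
  rw [e, h.measure_preimage_equiv, Real.volume_pi_Ico]
  simp [← ENNReal.ofReal_pow hℓ]

theorem cube_subset_ball {d : ℕ} (c : Fin d → ℝ) {ℓ : ℝ} (hℓ : 0 < ℓ) :
    cube c ℓ ⊆ ball (WithLp.toLp 2 c) ((d + 1) * ℓ) := by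
  intro y hy
  rw [mem_ball, dist_eq_norm]
  refine lt_of_pow_lt_pow_left₀ 2 (by positivity) ?_
  rw [EuclideanSpace.norm_sq_eq]
  calc _ ≤ ∑ _i : Fin d, ℓ ^ 2 := by
        refine Finset.sum_le_sum fun i _ => ?_
        have := hy i
        rw [Real.norm_eq_abs, sq_abs]
        simp only [PiLp.sub_apply]
        nlinarith
    _ = d * ℓ ^ 2 := by simp
    _ < _ := by
        have : 0 < ℓ ^ 2 := by positivity
        have : (0 : ℝ) ≤ d := by positivity
        nlinarith

/-- The corner of the dyadic child of `cube c ℓ` with label `b`. -/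
noncomputable def childCorner {d : ℕ} (c : Fin d → ℝ) (ℓ : ℝ) (b : Fin d → Bool) : Fin d → ℝ :=
  fun i => c i + if b i then ℓ / 2 else 0

theorem cube_childCorner_subset {d : ℕ} (c : Fin d → ℝ) {ℓ : ℝ} (hℓ : 0 < ℓ) (b : Fin d → Bool) :
    cube (childCorner c ℓ b) (ℓ / 2) ⊆ cube c ℓ := by
  intro y hy i
  have := hy i
  simp only [childCorner] at this
  split_ifs at this <;> constructor <;> linarith

theorem mem_cube_childCorner_iff {d : ℕ} {c : Fin d → ℝ} {ℓ : ℝ}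
    {y : EuclideanSpace ℝ (Fin d)} (hy : y ∈ cube c ℓ) (b : Fin d → Bool) :
    y ∈ cube (childCorner c ℓ b) (ℓ / 2) ↔ b = fun i => decide (c i + ℓ / 2 ≤ y i) := by
  constructor
  · intro h
    funext i
    have := h i
    simp only [childCorner] at this
    cases hb : b i <;> simp only [hb] at this <;> simp at this ⊢ <;> linarith
  · rintro rfl i
    have := hy i
    simp only [childCorner, decide_eq_true_eq]
    split_ifs with h <;> constructor <;> linarith

theorem sum_indicator_childCorner {d : ℕ} {F : Type*} [AddCommMonoid F] (c : Fin d → ℝ) {ℓ : ℝ}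
    (hℓ : 0 < ℓ) (f : EuclideanSpace ℝ (Fin d) → F) (y : EuclideanSpace ℝ (Fin d)) :
    ∑ b, (cube (childCorner c ℓ b) (ℓ / 2)).indicator f y = (cube c ℓ).indicator f y := by
  classical
  by_cases hy : y ∈ cube c ℓ
  · rw [Finset.sum_eq_single fun i => decide (c i + ℓ / 2 ≤ y i), indicator_of_mem hy,
      indicator_of_mem ((mem_cube_childCorner_iff hy _).2 rfl)]
    · intro b _ hb
      exact indicator_of_notMem (fun h => hb ((mem_cube_childCorner_iff hy _).1 h)) _
    · simp
  · rw [indicator_of_notMem hy]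
    exact Finset.sum_eq_zero fun b _ =>
      indicator_of_notMem (fun h => hy (cube_childCorner_subset c hℓ b h)) _

theorem sum_setIntegral_childCorner {d : ℕ} (c : Fin d → ℝ) {ℓ : ℝ} (hℓ : 0 < ℓ)
    {f : EuclideanSpace ℝ (Fin d) → ℝ} (hf : Integrable f) :
    ∑ b, ∫ y in cube (childCorner c ℓ b) (ℓ / 2), f y = ∫ y in cube c ℓ, f y := by
  simp only [← integral_indicator (measurableSet_cube _ _)]
  rw [← integral_finsetSum _ fun b _ => hf.indicator (measurableSet_cube _ _)]
  exact integral_congr_ae (.of_forall fun y => sum_indicator_childCorner c hℓ f y)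

/-- A Calderón–Zygmund decomposition at height `α` of `f` on the set `Q` into a good part `g` and
finitely many bad parts `b i`, supported in `ball (x i) (r i)`. -/
structure IsCalderonZygmund {d : ℕ} {F : Type*} [NormedAddCommGroup F] [NormedSpace ℝ F] (α : ℝ)
    (f : EuclideanSpace ℝ (Fin d) → F) (Q : Set (EuclideanSpace ℝ (Fin d))) {ι : Type} [Fintype ι]
    (x : ι → EuclideanSpace ℝ (Fin d)) (r : ι → ℝ) (b : ι → EuclideanSpace ℝ (Fin d) → F)
    (g : EuclideanSpace ℝ (Fin d) → F) : Prop where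
  eq : ∀ y, Q.indicator f y = g y + ∑ i, b i y
  r_pos : ∀ i, 0 < r i
  b_eq_zero : ∀ i, ∀ y ∉ ball (x i) (r i), b i y = 0
  memLp_b : ∀ i, MemLp (b i) 2
  integrable_b : ∀ i, Integrable (b i)
  integral_b : ∀ i, ∫ y, b i y = 0
  sum_b : ∑ i, ∫ y, ‖b i y‖ ≤ 2 * ∫ y in Q, ‖f y‖
  sum_r : ∑ i, r i ^ d ≤ (d + 1) ^ d / α * ∫ y in Q, ‖f y‖
  exists_ne : ∀ i, ∃ y ∈ ball (x i) (r i), f y ≠ 0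
  norm_g_le : ∀ y, ‖g y‖ ≤ 2 ^ (d + 1) * α
  g_eq_zero : ∀ y ∉ Q, g y = 0
  integrable_g : Integrable g
  integral_g_le : ∫ y, ‖g y‖ ≤ ∫ y in Q, ‖f y‖

theorem exists_isCalderonZygmund_of_lt {d : ℕ} {F : Type*} [NormedAddCommGroup F] [NormedSpace ℝ F]
    [CompleteSpace F] {α : ℝ} (hα : 0 < α) {f : EuclideanSpace ℝ (Fin d) → F} (hf : Integrable f)
    (hf2 : MemLp f 2) (c : Fin d → ℝ) {ℓ : ℝ} (hℓ : 0 < ℓ)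
    (h1 : α * ℓ ^ d < ∫ y in cube c ℓ, ‖f y‖) (h2 : ∫ y in cube c ℓ, ‖f y‖ ≤ 2 ^ d * α * ℓ ^ d) :
    ∃ (ι : Type) (_ : Fintype ι) (x : ι → EuclideanSpace ℝ (Fin d)) (r : ι → ℝ)
      (b : ι → EuclideanSpace ℝ (Fin d) → F) (g : EuclideanSpace ℝ (Fin d) → F),
      IsCalderonZygmund α f (cube c ℓ) x r b g := by
  set Q := cube c ℓ with hQ
  have hQm : MeasurableSet Q := measurableSet_cube c ℓ
  have hQv : volume.real Q = ℓ ^ d := by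
    rw [Measure.real, volume_cube c hℓ.le, ENNReal.toReal_ofReal (by positivity)]
  have hQf : volume Q ≠ ⊤ := by
    rw [volume_cube c hℓ.le]
    exact ENNReal.ofReal_ne_top
  set v : F := (ℓ ^ d)⁻¹ • ∫ y in Q, f y with hv
  have hℓd : 0 < ℓ ^ d := by positivity
  have hvn : ‖v‖ * ℓ ^ d ≤ ∫ y in Q, ‖f y‖ := by
    rw [hv, norm_smul, norm_inv, Real.norm_of_nonneg hℓd.le, mul_comm, ← mul_assoc,
      mul_inv_cancel₀ hℓd.ne', one_mul]
    exact norm_integral_le_integral_norm _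
  have hg2 : MemLp (Q.indicator fun _ => v) 2 := memLp_indicator_const 2 hQm v (Or.inr hQf)
  have hg1 : Integrable (Q.indicator fun _ => v) :=
    (integrable_indicator_iff hQm).2 (integrableOn_const hQf)
  have hgi : ∫ y, ‖Q.indicator (fun _ => v) y‖ = ‖v‖ * ℓ ^ d := by
    simp only [norm_indicator_eq_indicator_norm]
    rw [integral_indicator hQm, setIntegral_const, hQv, smul_eq_mul, mul_comm]
  have hfQ : Integrable (Q.indicator f) := hf.indicator hQm
  have hsub := cube_subset_ball c hℓ
  refine ⟨Unit, inferInstance, fun _ => WithLp.toLp 2 c, fun _ => (d + 1) * ℓ,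
    fun _ y => Q.indicator f y - Q.indicator (fun _ => v) y, Q.indicator fun _ => v, ?_⟩
  refine ⟨fun y => by simp, fun _ => by positivity, fun _ y hy => ?_,
    fun _ => (hf2.indicator hQm).sub hg2, fun _ => hfQ.sub hg1, fun _ => ?_, ?_, ?_, fun _ => ?_,
    fun y => ?_, fun y hy => indicator_of_notMem hy _, hg1, hgi.trans_le hvn⟩
  · have : y ∉ Q := fun h => hy (hsub h)
    simp [this]
  · rw [integral_sub hfQ hg1, integral_indicator hQm, integral_indicator hQm, setIntegral_const,
      hQv, hv, smul_smul, mul_inv_cancel₀ hℓd.ne', one_smul, sub_self]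
  · rw [Finset.univ_unique, Finset.sum_singleton]
    calc _ ≤ ∫ y, (‖Q.indicator f y‖ + ‖Q.indicator (fun _ => v) y‖) :=
          integral_mono (hfQ.sub hg1).norm (hfQ.norm.add hg1.norm) fun y => norm_sub_le _ _
      _ = (∫ y in Q, ‖f y‖) + ‖v‖ * ℓ ^ d := by
          rw [integral_add hfQ.norm hg1.norm, hgi]
          congr 1
          simp only [norm_indicator_eq_indicator_norm]
          rw [integral_indicator hQm]
      _ ≤ _ := by linarith
  · rw [Finset.univ_unique, Finset.sum_singleton, mul_pow, div_mul_eq_mul_div,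
      le_div_iff₀ hα]
    have : (0 : ℝ) < (d + 1) ^ d := by positivity
    nlinarith
  · by_contra! h
    have : ∫ y in Q, ‖f y‖ = 0 := by
      rw [← integral_zero (EuclideanSpace ℝ (Fin d)) ℝ (μ := volume.restrict Q)]
      refine setIntegral_congr_fun hQm fun y hy => ?_
      simp [h y (hsub hy)]
    have : 0 < α * ℓ ^ d := by positivity
    linarith
  · refine (norm_indicator_le_norm_self _ _).trans ?_
    have h3 : ‖v‖ * ℓ ^ d ≤ (2 ^ d * α) * ℓ ^ d := hvn.trans h2
    have h4 := le_of_mul_le_mul_right h3 hℓd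
    rw [pow_succ]
    have : 0 < 2 ^ d * α := by positivity
    linarith

theorem exists_isCalderonZygmund {d : ℕ} {F : Type*} [NormedAddCommGroup F] [NormedSpace ℝ F]
    [CompleteSpace F] {α : ℝ} (hα : 0 < α) {f : EuclideanSpace ℝ (Fin d) → F} (hf : Integrable f)
    (hf2 : MemLp f 2) {δ : ℝ} (hδ : ∀ y z, (∀ i, |y i - z i| ≤ δ) → ‖f y - f z‖ ≤ α) (m : ℕ)
    (c : Fin d → ℝ) {ℓ : ℝ} (hℓ : 0 < ℓ) (hℓm : ℓ ≤ 2 ^ m * δ)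
    (h1 : ∫ y in cube c ℓ, ‖f y‖ ≤ α * ℓ ^ d) :
    ∃ (ι : Type) (_ : Fintype ι) (x : ι → EuclideanSpace ℝ (Fin d)) (r : ι → ℝ)
      (b : ι → EuclideanSpace ℝ (Fin d) → F) (g : EuclideanSpace ℝ (Fin d) → F),
      IsCalderonZygmund α f (cube c ℓ) x r b g := by
  induction m generalizing c ℓ with
  | zero =>
    have hℓd : 0 < ℓ ^ d := by positivity
    have hQm := measurableSet_cube c ℓ
    refine ⟨Empty, inferInstance, fun i => i.elim, fun i => i.elim, fun i => i.elim,
      (cube c ℓ).indicator f, ⟨fun y => by simp, fun i => i.elim, fun i => i.elim, fun i => i.elim,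
      fun i => i.elim, fun i => i.elim, ?_, ?_, fun i => i.elim, fun y => ?_,
      fun y hy => indicator_of_notMem hy _, hf.indicator hQm, ?_⟩⟩
    · simp only [Finset.univ_eq_empty, Finset.sum_empty]
      positivity
    · simp only [Finset.univ_eq_empty, Finset.sum_empty]
      positivity
    · by_cases hy : y ∈ cube c ℓ
      · rw [indicator_of_mem hy]
        have h2 : ‖f y‖ ≤ 2 * α := by
          by_contra! h3
          have h4 : ∀ z ∈ cube c ℓ, ‖f y‖ - α ≤ ‖f z‖ := by
            intro z hz
            have h5 := hδ y z fun i => by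
              rw [pow_zero, one_mul] at hℓm
              have := hy i
              have := hz i
              rw [abs_le]
              constructor <;> linarith
            have := norm_sub_norm_le (f y) (f z)
            linarith
          have h5 : (‖f y‖ - α) * ℓ ^ d ≤ ∫ z in cube c ℓ, ‖f z‖ := by
            have hv : volume.real (cube c ℓ) = ℓ ^ d := by
              rw [Measure.real, volume_cube c hℓ.le, ENNReal.toReal_ofReal (by positivity)]
            have h6 : volume (cube c ℓ) ≠ ⊤ := by
              rw [volume_cube c hℓ.le]
              exact ENNReal.ofReal_ne_top
            calc _ = ∫ _z in cube c ℓ, (‖f y‖ - α) := by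
                  rw [setIntegral_const, hv, smul_eq_mul, mul_comm]
              _ ≤ _ := setIntegral_mono_on (integrableOn_const h6) hf.norm.integrableOn hQm h4
          nlinarith
        refine h2.trans ?_
        gcongr
        exact le_self_pow₀ (by norm_num) (by omega)
      · rw [indicator_of_notMem hy, norm_zero]
        positivity
    · simp only [norm_indicator_eq_indicator_norm]
      rw [integral_indicator hQm]
  | succ m ih =>
    have hchild : ∀ β : Fin d → Bool, ∃ (ι : Type) (_ : Fintype ι)
        (x : ι → EuclideanSpace ℝ (Fin d)) (r : ι → ℝ) (b : ι → EuclideanSpace ℝ (Fin d) → F)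
        (g : EuclideanSpace ℝ (Fin d) → F),
        IsCalderonZygmund α f (cube (childCorner c ℓ β) (ℓ / 2)) x r b g := by
      intro β
      rcases le_or_gt (∫ y in cube (childCorner c ℓ β) (ℓ / 2), ‖f y‖) (α * (ℓ / 2) ^ d) with h | h
      · refine ih _ (by positivity) ?_ h
        rw [pow_succ] at hℓm
        linarith
      · refine exists_isCalderonZygmund_of_lt hα hf hf2 _ (by positivity) h ?_
        calc _ ≤ ∫ y in cube c ℓ, ‖f y‖ :=
              setIntegral_mono_set hf.norm.integrableOn (.of_forall fun _ => norm_nonneg _)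
                (HasSubset.Subset.eventuallyLE (cube_childCorner_subset c hℓ β))
          _ ≤ α * ℓ ^ d := h1
          _ = _ := by rw [div_pow]; field_simp
    choose ι inst x r b g H using hchild
    have hsum := sum_setIntegral_childCorner c hℓ hf.norm
    refine ⟨Σ β, ι β, inferInstance, fun p => x p.1 p.2, fun p => r p.1 p.2, fun p => b p.1 p.2,
      fun y => ∑ β, g β y, ⟨fun y => ?_, fun p => (H p.1).r_pos _, fun p => (H p.1).b_eq_zero _,
      fun p => (H p.1).memLp_b _, fun p => (H p.1).integrable_b _, fun p => (H p.1).integral_b _,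
      ?_, ?_, fun p => (H p.1).exists_ne _, fun y => ?_, fun y hy => ?_,
      integrable_finsetSum _ fun β _ => (H β).integrable_g, ?_⟩⟩
    · rw [Fintype.sum_sigma, ← Finset.sum_add_distrib, ← sum_indicator_childCorner c hℓ]
      exact Finset.sum_congr rfl fun β _ => (H β).eq y
    · rw [Fintype.sum_sigma, ← hsum, Finset.mul_sum]
      exact Finset.sum_le_sum fun β _ => (H β).sum_b
    · rw [Fintype.sum_sigma, ← hsum, Finset.mul_sum]
      exact Finset.sum_le_sum fun β _ => (H β).sum_r
    · by_cases hy : y ∈ cube c ℓ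
      · rw [Finset.sum_eq_single fun i => decide (c i + ℓ / 2 ≤ y i)]
        · exact (H _).norm_g_le y
        · intro β _ hβ
          exact (H β).g_eq_zero y fun h => hβ ((mem_cube_childCorner_iff hy _).1 h)
        · simp
      · rw [Finset.sum_eq_zero fun β _ =>
          (H β).g_eq_zero y fun h => hy (cube_childCorner_subset c hℓ β h), norm_zero]
        positivity
    · exact Finset.sum_eq_zero fun β _ =>
        (H β).g_eq_zero y fun h => hy (cube_childCorner_subset c hℓ β h)
    · calc _ ≤ ∫ y, ∑ β, ‖g β y‖ := by
            refine integral_mono (integrable_finsetSum _ fun β _ => (H β).integrable_g).norm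
              (integrable_finsetSum _ fun β _ => (H β).integrable_g.norm) fun y => norm_sum_le _ _
        _ = ∑ β, ∫ y, ‖g β y‖ := integral_finsetSum _ fun β _ => (H β).integrable_g.norm
        _ ≤ _ := by
            rw [← hsum]
            exact Finset.sum_le_sum fun β _ => (H β).integral_g_le

/-- Uniform continuity of a compactly supported function, measured in the coordinatewise sup
norm. -/
theorem exists_forall_norm_sub_le {d : ℕ}
    {f : EuclideanSpace ℝ (Fin d) → EuclideanSpace ℝ (Fin d)} (hf : Continuous f)
    (hfc : HasCompactSupport f) {α : ℝ} (hα : 0 < α) :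
    ∃ δ : ℝ, 0 < δ ∧ ∀ y z : EuclideanSpace ℝ (Fin d),
      (∀ i, |y i - z i| ≤ δ) → ‖f y - f z‖ ≤ α := by
  obtain ⟨δ, h1, h2⟩ := Metric.uniformContinuous_iff.1
    (hfc.uniformContinuous_of_continuous hf) α hα
  refine ⟨δ / (d + 1), by positivity, fun y z h => ?_⟩
  rw [← dist_eq_norm]
  refine (h2 ?_).le
  rw [dist_eq_norm]
  refine lt_of_pow_lt_pow_left₀ 2 h1.le ?_
  rw [EuclideanSpace.norm_sq_eq]
  calc _ ≤ ∑ _i : Fin d, (δ / (d + 1)) ^ 2 := by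
        refine Finset.sum_le_sum fun i _ => ?_
        have := h i
        simp only [PiLp.sub_apply, Real.norm_eq_abs]
        gcongr
    _ = d / (d + 1) ^ 2 * δ ^ 2 := by
        rw [Finset.sum_const, Finset.card_univ, Fintype.card_fin, nsmul_eq_mul, div_pow]
        ring
    _ < δ ^ 2 := by
        refine mul_lt_of_lt_one_left (by positivity) ?_
        rw [div_lt_one (by positivity)]
        have : (0 : ℝ) ≤ d := by positivity
        nlinarith

set_option maxHeartbeats 1000000 in
/-- The weak type (1,1) estimate for the solution operator. -/
theorem exists_weak_type_bound (d : ℕ) (hd : 1 ≤ d) {l L κ : ℝ} (hl : 0 < l) (hL : 0 < L)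
    (hκ : 0 < κ) :
    ∃ C : ℝ, 0 < C ∧
      ∀ (a : EuclideanSpace ℝ (Fin d) → EuclideanSpace ℝ (Fin d) →L[ℝ] EuclideanSpace ℝ (Fin d))
        (ha : IsEllipticField l L a), LogDini l L κ a →
      ∀ f : EuclideanSpace ℝ (Fin d) → EuclideanSpace ℝ (Fin d), Continuous f →
        Function.support f ⊆ ball 0 (1 / 3) →
      ∀ V : Lp (EuclideanSpace ℝ (Fin d)) 2 (volume : Measure (EuclideanSpace ℝ (Fin d))),
        V ∈ gradSpace _ → (∀ w ∈ gradSpace _, ⟪ha.mulOp V, w⟫ = ∫ x, ⟪f x, w x⟫) →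
      ∀ α : ℝ, 0 < α →
        volume {x ∈ ball (0 : EuclideanSpace ℝ (Fin d)) 1 | α < ‖V x‖} ≤
          ENNReal.ofReal (C / α * ∫ x, ‖f x‖) := by
  obtain ⟨A, C, hA, hC, H⟩ := exists_hormander (EuclideanSpace ℝ (Fin d)) hl hL hκ
  set V1 := volume.real (ball (0 : EuclideanSpace ℝ (Fin d)) 1) with hV1
  have hV10 : 0 < V1 :=
    ENNReal.toReal_pos (measure_ball_pos _ _ one_pos).ne' measure_ball_lt_top.ne
  set c₁ : ℝ := (1 / (3 * (d + 1))) ^ d with hc₁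
  have hc₁0 : 0 < c₁ := by positivity
  refine ⟨V1 / c₁ + 2 ^ (d + 3) / l ^ 2 + A ^ d * V1 * (d + 1) ^ d + 4 * C, by positivity, ?_⟩
  intro a ha hlog f hf hsupp V hV hsol α hα
  set I : ℝ := ∫ x, ‖f x‖ with hI
  have hI0 : 0 ≤ I := integral_nonneg fun _ => norm_nonneg _
  set μ : Measure (EuclideanSpace ℝ (Fin d)) := volume.restrict (ball 0 1) with hμ
  have : IsFiniteMeasure μ := ⟨by simpa [hμ] using measure_ball_lt_top⟩
  have hμ1 : ∀ S, μ.real S ≤ V1 := fun S => by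
    rw [hμ, measureReal_restrict_apply' measurableSet_ball]
    exact measureReal_mono inter_subset_right measure_ball_lt_top.ne
  have hset : volume {x ∈ ball (0 : EuclideanSpace ℝ (Fin d)) 1 | α < ‖V x‖} =
      ENNReal.ofReal (μ.real {x | α < ‖V x‖}) := by
    rw [measureReal_def, ENNReal.ofReal_toReal (measure_ne_top _ _), hμ,
      Measure.restrict_apply' measurableSet_ball]
    congr 1
    ext x
    simp [and_comm]
  rw [hset]
  refine ENNReal.ofReal_le_ofReal ?_
  have hsplit : ∀ C' : ℝ, C' ≤ V1 / c₁ + 2 ^ (d + 3) / l ^ 2 + A ^ d * V1 * (d + 1) ^ d + 4 * C →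
      μ.real {x | α < ‖V x‖} ≤ C' * (I / α) → μ.real {x | α < ‖V x‖} ≤
        (V1 / c₁ + 2 ^ (d + 3) / l ^ 2 + A ^ d * V1 * (d + 1) ^ d + 4 * C) / α * I := by
    intro C' h1 h2
    refine h2.trans ?_
    rw [div_mul_eq_mul_div, ← mul_div_assoc]
    gcongr
  have hp1 : 0 ≤ V1 / c₁ := by positivity
  have hp2 : 0 ≤ (2 : ℝ) ^ (d + 3) / l ^ 2 := by positivity
  have hp3 : 0 ≤ A ^ d * V1 * (d + 1) ^ d := by positivity
  rcases lt_or_ge (c₁ * α) I with hlarge | hsmall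
  · refine hsplit (V1 / c₁) (by linarith) ((hμ1 _).trans ?_)
    rw [div_mul_div_comm, le_div_iff₀ (by positivity)]
    gcongr
  refine hsplit (2 ^ (d + 3) / l ^ 2 + A ^ d * V1 * (d + 1) ^ d + 4 * C) (by linarith) ?_
  -- the Calderón–Zygmund decomposition
  have hfc : HasCompactSupport f :=
    HasCompactSupport.intro (isCompact_closedBall 0 (1 / 3)) fun x hx => by
      by_contra h
      exact hx (ball_subset_closedBall (hsupp h))
  have hfi : Integrable f := hf.integrable_of_hasCompactSupport hfc
  have hf2 : MemLp f 2 := hf.memLp_of_hasCompactSupport hfc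
  obtain ⟨δ, hδ0, hδ⟩ := exists_forall_norm_sub_le hf hfc hα
  obtain ⟨m, hm⟩ := pow_unbounded_of_one_lt (2 / δ) (one_lt_two)
  have hc₁1 : c₁ ≤ 1 := by
    refine pow_le_one₀ (by positivity) ?_
    rw [div_le_one (by positivity)]
    have : (0 : ℝ) ≤ d := by positivity
    linarith
  obtain ⟨ι, inst, x, r, b, g, Z⟩ := exists_isCalderonZygmund hα hfi hf2 hδ m
    (fun _ => -1) two_pos ((div_lt_iff₀ hδ0).1 hm).le (by
      calc _ ≤ I := setIntegral_le_integral hfi.norm (.of_forall fun _ => norm_nonneg _)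
        _ ≤ 1 * α := hsmall.trans (by gcongr)
        _ ≤ α * 2 ^ d := by
          rw [mul_comm]
          gcongr
          exact one_le_pow₀ (by norm_num))
  have hQI : ∫ y in cube (fun _ => -1) 2, ‖f y‖ ≤ I :=
    setIntegral_le_integral hfi.norm (.of_forall fun _ => norm_nonneg _)
  have hfQ : (cube (fun _ => -1) 2).indicator f = f := by
    refine indicator_eq_self.2 fun y hy i => ?_
    have h1 := hsupp hy
    rw [mem_ball_zero_iff] at h1
    have h2 := PiLp.norm_apply_le y i
    rw [Real.norm_eq_abs] at h2
    have h3 := abs_le.1 (h2.trans h1.le)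
    constructor <;> linarith [h3.1, h3.2]
  have hr : ∀ i, r i ≤ 1 / 3 := by
    intro i
    have h1 : r i ^ d ≤ (1 / 3) ^ d := by
      calc r i ^ d ≤ ∑ j, r j ^ d :=
            Finset.single_le_sum (f := fun j => r j ^ d)
              (fun j _ => pow_nonneg (Z.r_pos j).le _) (Finset.mem_univ i)
        _ ≤ (d + 1) ^ d / α * (c₁ * α) := by
            refine Z.sum_r.trans ?_
            gcongr
            exact hQI.trans hsmall
        _ = _ := by
            rw [hc₁, div_pow, div_pow, mul_pow]
            field_simp
    exact (pow_le_pow_iff_left₀ (Z.r_pos i).le (by norm_num) (by omega)).1 h1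
  have hx : ∀ i, ‖x i‖ ≤ 2 / 3 := by
    intro i
    obtain ⟨y, hy, hy0⟩ := Z.exists_ne i
    have h1 := hsupp hy0
    rw [mem_ball_zero_iff] at h1
    rw [mem_ball, dist_comm, dist_eq_norm] at hy
    have h2 := norm_le_norm_add_norm_sub' (x i) y
    linarith [hr i]
  obtain ⟨T, hT1, hT2⟩ := ha.exists_solutionOperator hl
  have hg2 : MemLp g 2 := by
    refine (memLp_two_iff_integrable_sq_norm Z.integrable_g.aestronglyMeasurable).2 ?_
    refine (Z.integrable_g.norm.const_mul (2 ^ (d + 1) * α)).mono'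
      (Z.integrable_g.aestronglyMeasurable.norm.pow 2) (.of_forall fun y => ?_)
    rw [Real.norm_of_nonneg (by positivity), sq]
    gcongr
    exact Z.norm_g_le y
  set G := hg2.toLp with hG
  set b' := fun i => (Z.memLp_b i).toLp with hb'
  have hVT : V = T (G + ∑ i, b' i) := by
    refine ha.eq_of_mem_gradSpace hl hV (hT1 _) fun w hw => ?_
    have hw' := (testGradients _).le_topologicalClosure hw
    rw [hsol w hw', hT2 _ w hw', L2.inner_def]
    refine integral_congr_ae ?_
    have h1 : ∀ᵐ y, ∀ i, b' i y = b i y := ae_all_iff.2 fun i => (Z.memLp_b i).coeFn_toLp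
    filter_upwards [Lp.coeFn_add G (∑ i, b' i), Lp.coeFn_finsetSum Finset.univ b', h1,
      hg2.coeFn_toLp]
      with y e1 e2 e3 e4
    rw [e1, Pi.add_apply, e2, e4, ← congrFun hfQ y, Z.eq y, Finset.sum_apply]
    simp only [e3]
  have hVae : ∀ᵐ y, V y = T G y + ∑ i, T (b' i) y := by
    have e0 : V = T G + ∑ i, T (b' i) := by rw [hVT, map_add, map_sum]
    filter_upwards [Lp.coeFn_add (T G) (∑ i, T (b' i)),
      Lp.coeFn_finsetSum Finset.univ fun i => T (b' i)] with y e1 e2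
    rw [e0, e1, Pi.add_apply, e2, Finset.sum_apply]
  set U : Set (EuclideanSpace ℝ (Fin d)) := ⋃ i, ball (x i) (A * r i) with hU
  have hUm : MeasurableSet U := MeasurableSet.iUnion fun i => measurableSet_ball
  set Φ : EuclideanSpace ℝ (Fin d) → ℝ := fun y => ∑ i, Uᶜ.indicator (fun y => ‖T (b' i) y‖) y
    with hΦ
  have hincl : μ.real {x | α < ‖V x‖} ≤
      μ.real {y | (α / 2) ^ 2 ≤ ‖T G y‖ ^ 2} + μ.real U + μ.real {y | α / 2 ≤ Φ y} := by
    have h1 : ({x | α < ‖V x‖} : Set _) ≤ᵐ[μ]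
        ({y | (α / 2) ^ 2 ≤ ‖T G y‖ ^ 2} ∪ U ∪ {y | α / 2 ≤ Φ y} : Set _) := by
      filter_upwards [ae_restrict_of_ae hVae] with y hy hyα
      have hyα : α < ‖V y‖ := hyα
      by_contra h2
      have h2 : y ∉ ({y | (α / 2) ^ 2 ≤ ‖T G y‖ ^ 2} ∪ U ∪ {y | α / 2 ≤ Φ y} : Set _) := h2
      simp only [mem_union, mem_ofPred_eq, not_or, not_le] at h2
      obtain ⟨⟨h3, h4⟩, h5⟩ := h2
      have h6 : ‖T G y‖ < α / 2 := lt_of_pow_lt_pow_left₀ 2 (by positivity) h3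
      have h7 : ‖∑ i, T (b' i) y‖ ≤ Φ y := by
        refine (norm_sum_le _ _).trans_eq ?_
        refine Finset.sum_congr rfl fun i _ => ?_
        rw [indicator_of_mem (show y ∈ Uᶜ from h4)]
      rw [hy] at hyα
      have := norm_add_le (T G y) (∑ i, T (b' i) y)
      linarith
    rw [measureReal_def]
    calc _ ≤ μ.real ({y | (α / 2) ^ 2 ≤ ‖T G y‖ ^ 2} ∪ U ∪ {y | α / 2 ≤ Φ y}) :=
          ENNReal.toReal_mono (measure_ne_top _ _) (measure_mono_ae h1)
      _ ≤ _ := (measureReal_union_le _ _).trans (add_le_add_left (measureReal_union_le _ _) _)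
  have hS1 : μ.real {y | (α / 2) ^ 2 ≤ ‖T G y‖ ^ 2} ≤ 2 ^ (d + 3) / l ^ 2 * (I / α) := by
    have hTGi := MemLp.integrable_norm_sq (Lp.memLp (T G))
    have h1 := mul_meas_ge_le_integral_of_nonneg (μ := μ) (f := fun y => ‖T G y‖ ^ 2)
      (.of_forall fun y => by positivity) hTGi.restrict ((α / 2) ^ 2)
    have h2 : ∫ y, ‖T G y‖ ^ 2 ∂μ ≤ ‖T G‖ ^ 2 := by
      rw [sq_norm_Lp_two]
      exact setIntegral_le_integral hTGi (.of_forall fun y => by positivity)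
    have h3 : l * ‖T G‖ ≤ ‖G‖ := ha.norm_le_of_inner_mulOp (hT2 G _ (hT1 G))
    have h4 : ‖G‖ ^ 2 ≤ 2 ^ (d + 1) * α * I := by
      rw [sq_norm_Lp_two]
      calc ∫ y, ‖G y‖ ^ 2 = ∫ y, ‖g y‖ ^ 2 := by
            refine integral_congr_ae ?_
            filter_upwards [hg2.coeFn_toLp] with y hy
            rw [hy]
        _ ≤ ∫ y, 2 ^ (d + 1) * α * ‖g y‖ := by
            refine integral_mono (MemLp.integrable_norm_sq hg2)
              (Z.integrable_g.norm.const_mul _) fun y => ?_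
            simp only
            rw [sq]
            gcongr
            exact Z.norm_g_le y
        _ ≤ _ := by
            rw [integral_const_mul]
            gcongr
            exact Z.integral_g_le.trans hQI
    have h5 : l ^ 2 * ‖T G‖ ^ 2 ≤ 2 ^ (d + 1) * α * I := by
      rw [← mul_pow]
      refine (pow_le_pow_left₀ (by positivity) h3 2).trans h4
    have h6 : (α / 2) ^ 2 * μ.real {y | (α / 2) ^ 2 ≤ ‖T G y‖ ^ 2} * l ^ 2 ≤
        2 ^ (d + 1) * α * I := by
      refine le_trans ?_ h5
      rw [mul_comm (l ^ 2)]
      gcongr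
      exact h1.trans h2
    rw [div_mul_div_comm, le_div_iff₀ (by positivity)]
    have h7 : α * (μ.real {y | (α / 2) ^ 2 ≤ ‖T G y‖ ^ 2} * (l ^ 2 * α)) ≤
        α * (2 ^ (d + 3) * I) := by
      calc _ = 4 * ((α / 2) ^ 2 * μ.real {y | (α / 2) ^ 2 ≤ ‖T G y‖ ^ 2} * l ^ 2) := by ring
        _ ≤ 4 * (2 ^ (d + 1) * α * I) := by gcongr
        _ = _ := by ring
    exact le_of_mul_le_mul_left h7 hα
  have hS2 : μ.real U ≤ A ^ d * V1 * (d + 1) ^ d * (I / α) := by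
    calc μ.real U ≤ ∑ i, μ.real (ball (x i) (A * r i)) := measureReal_iUnion_fintype_le _
      _ ≤ ∑ i, A ^ d * V1 * r i ^ d := by
          refine Finset.sum_le_sum fun i _ => ?_
          have h0 := Z.r_pos i
          rw [hμ, measureReal_restrict_apply' measurableSet_ball]
          refine (measureReal_mono inter_subset_left measure_ball_lt_top.ne).trans_eq ?_
          rw [Measure.real, Measure.addHaar_ball_of_pos _ _ (by positivity), ENNReal.toReal_mul,
            ENNReal.toReal_ofReal (by positivity), finrank_euclideanSpace, Fintype.card_fin,
            ← Measure.real, ← hV1]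
          ring
      _ ≤ A ^ d * V1 * ((d + 1) ^ d / α * I) := by
          rw [← Finset.mul_sum]
          gcongr
          refine Z.sum_r.trans ?_
          gcongr
      _ = _ := by ring
  have hTbi : ∀ i, Integrable (fun y => ‖T (b' i) y‖) μ := fun i =>
    (((Lp.memLp (T (b' i))).locallyIntegrable (by norm_num)).integrableOn_isCompact
      (isCompact_closedBall 0 1) |>.mono_set ball_subset_closedBall).norm
  have hS3 : μ.real {y | α / 2 ≤ Φ y} ≤ 4 * C * (I / α) := by
    have hΦi : Integrable Φ μ := integrable_finsetSum _ fun i _ => (hTbi i).indicator hUm.compl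
    have h1 := mul_meas_ge_le_integral_of_nonneg (μ := μ) (f := Φ)
      (.of_forall fun y => Finset.sum_nonneg fun i _ =>
        indicator_nonneg (fun _ _ => norm_nonneg _) _) hΦi (α / 2)
    have h2 : ∫ y, Φ y ∂μ ≤ C * (2 * I) := by
      rw [hΦ, integral_finsetSum _ fun i _ => (hTbi i).indicator hUm.compl]
      calc _ ≤ ∑ i, C * ∫ y, ‖b i y‖ := by
            refine Finset.sum_le_sum fun i _ => ?_
            have e1 : ∫ y, ‖b i y‖ = ∫ y, ‖b' i y‖ := by
              refine integral_congr_ae ?_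
              filter_upwards [(Z.memLp_b i).coeFn_toLp] with y hy
              rw [hy]
            have e2 : ∫ y, b' i y = 0 := by
              rw [← Z.integral_b i]
              exact integral_congr_ae (Z.memLp_b i).coeFn_toLp
            rw [integral_indicator hUm.compl, hμ, Measure.restrict_restrict hUm.compl, e1]
            refine le_trans ?_ (H a ha hlog (b' i) (T (b' i)) (hT1 _) (hT2 _) (x i) (r i)
              (Z.r_pos i) (hx i) ?_ e2)
            · refine setIntegral_mono_set ((hTbi i).mono_measure (Measure.restrict_mono
                sdiff_subset le_rfl)) (.of_forall fun _ => norm_nonneg _) ?_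
              refine HasSubset.Subset.eventuallyLE ?_
              rintro y ⟨hy1, hy2⟩
              exact ⟨hy2, fun h => hy1 (mem_iUnion.2 ⟨i, h⟩)⟩
            · filter_upwards [(Z.memLp_b i).coeFn_toLp] with y hy hyb
              rw [hy, Z.b_eq_zero i y hyb]
        _ ≤ _ := by
            rw [← Finset.mul_sum]
            gcongr
            refine Z.sum_b.trans ?_
            gcongr
    rw [← mul_div_assoc, le_div_iff₀ hα]
    linarith
  calc _ ≤ _ := hincl
    _ ≤ 2 ^ (d + 3) / l ^ 2 * (I / α) + A ^ d * V1 * (d + 1) ^ d * (I / α) + 4 * C * (I / α) := by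
        gcongr
    _ = _ := by ring

theorem norm_setAverage_le {X F : Type*} [MeasurableSpace X] [NormedAddCommGroup F]
    [NormedSpace ℝ F] {μ : Measure X} {f : X → F} {s : Set X} {C : ℝ} (hC : 0 ≤ C)
    (hs : μ s < ⊤) (h : ∀ x ∈ s, ‖f x‖ ≤ C) : ‖⨍ x in s, f x ∂μ‖ ≤ C := by
  rw [setAverage_eq, norm_smul, norm_inv, Real.norm_of_nonneg measureReal_nonneg]
  have h1 := norm_setIntegral_le_of_norm_le_const hs h
  rcases eq_or_lt_of_le (measureReal_nonneg (μ := μ) (s := s)) with h0 | h0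
  · rw [← h0]
    simpa using hC
  · rw [inv_mul_le_iff₀ h0, mul_comm]
    exact h1

theorem setAverage_le_meanOscB {d : ℕ} {F : Type*} [NormedAddCommGroup F] [NormedSpace ℝ F]
    {h : EuclideanSpace ℝ (Fin d) → F} {K : ℝ} (hK : 0 ≤ K) (hh : ∀ x ∈ ball 0 1, ‖h x‖ ≤ K)
    {c : EuclideanSpace ℝ (Fin d)} {r : ℝ} (hr : 0 < r) (hc : ball c r ⊆ ball 0 1) :
    ⨍ y in ball c r, ‖h y - ⨍ z in ball c r, h z‖ ≤ meanOscB h r := by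
  have hbd : ∀ x : EuclideanSpace ℝ (Fin d), ⨍ y in ball x r ∩ ball 0 1,
      ‖h y - ⨍ z in ball x r ∩ ball 0 1, h z‖ ≤ 2 * K := by
    intro x
    have hfin : volume (ball x r ∩ ball (0 : EuclideanSpace ℝ (Fin d)) 1) < ⊤ :=
      (measure_mono inter_subset_left).trans_lt measure_ball_lt_top
    refine (Real.le_norm_self _).trans (norm_setAverage_le (by positivity) hfin fun y hy => ?_)
    rw [norm_norm, two_mul]
    exact (norm_sub_le _ _).trans (add_le_add (hh y hy.2)
      (norm_setAverage_le hK hfin fun z hz => hh z hz.2))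
  have h1 : BddAbove (range fun x : EuclideanSpace ℝ (Fin d) =>
      ⨆ _ : x ∈ ball (0 : EuclideanSpace ℝ (Fin d)) 1, ⨍ y in ball x r ∩ ball 0 1,
        ‖h y - ⨍ z in ball x r ∩ ball 0 1, h z‖) := by
    refine ⟨2 * K, ?_⟩
    rintro _ ⟨x, rfl⟩
    exact Real.iSup_le (fun _ => hbd x) (by positivity)
  refine le_trans ?_ (le_ciSup h1 c)
  refine le_trans ?_ (le_ciSup (finite_range _).bddAbove (hc (mem_ball_self hr)))
  rw [inter_eq_left.2 hc]

/-- The linear map turning an array of coefficients into an operator on Euclidean space. -/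
noncomputable def arrayCLM (d : ℕ) : (Fin d → Fin d → ℝ) →L[ℝ]
    (EuclideanSpace ℝ (Fin d) →L[ℝ] EuclideanSpace ℝ (Fin d)) :=
  LinearMap.toContinuousLinearMap
    { toFun := fun A => Matrix.toEuclideanCLM (𝕜 := ℝ) (Matrix.of A)
      map_add' := fun A B => by rw [← Matrix.of_add_of, map_add]
      map_smul' := fun c A => by rw [← Matrix.smul_of, map_smul]; rfl }

theorem inner_arrayCLM {d : ℕ} (A : Fin d → Fin d → ℝ) (x y : EuclideanSpace ℝ (Fin d)) :
    ⟪arrayCLM d A x, y⟫ = (Matrix.of A *ᵥ x.ofLp) ⬝ᵥ y.ofLp := by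
  have h : (arrayCLM d A x).ofLp = Matrix.of A *ᵥ x.ofLp := Matrix.ofLp_toEuclideanCLM _ _
  rw [EuclideanSpace.inner_eq_star_dotProduct, h, dotProduct_comm]
  simp

theorem norm_array_le {d : ℕ} {A : Fin d → Fin d → ℝ} {K : ℝ} (hK : 0 ≤ K)
    (h : ∑ i, ∑ j, (A i j) ^ 2 ≤ K ^ 2) : ‖A‖ ≤ K := by
  refine (pi_norm_le_iff_of_nonneg hK).2 fun i => (pi_norm_le_iff_of_nonneg hK).2 fun j => ?_
  refine abs_le_of_sq_le_sq (le_trans ?_ h) hK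
  calc (A i j) ^ 2 ≤ ∑ j, (A i j) ^ 2 :=
        Finset.single_le_sum (f := fun j => (A i j) ^ 2) (fun _ _ => sq_nonneg _)
          (Finset.mem_univ j)
    _ ≤ _ := Finset.single_le_sum (f := fun i => ∑ j, (A i j) ^ 2)
          (fun _ _ => Finset.sum_nonneg fun _ _ => sq_nonneg _) (Finset.mem_univ i)

/-- The coefficient field given by an array of functions in the unit ball, extended by a multiple
of the identity. -/
noncomputable def extendField {d : ℕ} (l : ℝ) (A : EuclideanSpace ℝ (Fin d) → Fin d → Fin d → ℝ)
    (x : EuclideanSpace ℝ (Fin d)) : EuclideanSpace ℝ (Fin d) →L[ℝ] EuclideanSpace ℝ (Fin d) :=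
  open Classical in
  if x ∈ ball (0 : EuclideanSpace ℝ (Fin d)) 1 then arrayCLM d (A x)
  else l • ContinuousLinearMap.id ℝ _

theorem extendField_of_mem {d : ℕ} (l : ℝ)
    (A : EuclideanSpace ℝ (Fin d) → Fin d → Fin d → ℝ) {x : EuclideanSpace ℝ (Fin d)}
    (hx : x ∈ ball (0 : EuclideanSpace ℝ (Fin d)) 1) : extendField l A x = arrayCLM d (A x) := by
  rw [extendField, if_pos hx]

theorem isEllipticField_extendField {d : ℕ} {l K : ℝ} (hl : 0 < l) (hK : 0 ≤ K)
    {A : EuclideanSpace ℝ (Fin d) → Fin d → Fin d → ℝ} (hA : Measurable A)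
    (hell : ∀ x ∈ ball (0 : EuclideanSpace ℝ (Fin d)) 1, ∀ ξ : Fin d → ℝ,
      l * ∑ i, ξ i ^ 2 ≤ (Matrix.of (A x) *ᵥ ξ) ⬝ᵥ ξ)
    (hbd : ∀ x ∈ ball (0 : EuclideanSpace ℝ (Fin d)) 1, ‖A x‖ ≤ K) :
    IsEllipticField l (‖arrayCLM d‖ * K + l) (extendField l A) where
  stronglyMeasurable := by
    classical
    exact StronglyMeasurable.ite measurableSet_ball
      ((arrayCLM d).continuous.comp_stronglyMeasurable hA.stronglyMeasurable)
      stronglyMeasurable_const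
  le_inner x ξ := by
    by_cases hx : x ∈ ball (0 : EuclideanSpace ℝ (Fin d)) 1
    · rw [extendField_of_mem l A hx, inner_arrayCLM, EuclideanSpace.real_norm_sq_eq]
      exact hell x hx _
    · rw [extendField, if_neg hx]
      simp [inner_smul_left]
  norm_le x := by
    by_cases hx : x ∈ ball (0 : EuclideanSpace ℝ (Fin d)) 1
    · rw [extendField_of_mem l A hx]
      refine ((arrayCLM d).le_opNorm _).trans ?_
      have := mul_le_mul_of_nonneg_left (hbd x hx) (norm_nonneg (arrayCLM d))
      linarith
    · rw [extendField, if_neg hx, norm_smul, Real.norm_of_nonneg hl.le]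
      have h1 : l * ‖ContinuousLinearMap.id ℝ (EuclideanSpace ℝ (Fin d))‖ ≤ l * 1 := by
        gcongr
        exact ContinuousLinearMap.norm_id_le
      have h2 : 0 ≤ ‖arrayCLM d‖ * K := by positivity
      linarith

theorem logDini_extendField {d : ℕ} {l K c₀ : ℝ} (hl : 0 < l) (hK : 0 ≤ K) (hc₀ : 0 < c₀)
    {A : EuclideanSpace ℝ (Fin d) → Fin d → Fin d → ℝ} (hA : Measurable A)
    (hell : ∀ x ∈ ball (0 : EuclideanSpace ℝ (Fin d)) 1, ∀ ξ : Fin d → ℝ,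
      l * ∑ i, ξ i ^ 2 ≤ (Matrix.of (A x) *ᵥ ξ) ⬝ᵥ ξ)
    (hbd : ∀ x ∈ ball (0 : EuclideanSpace ℝ (Fin d)) 1, ‖A x‖ ≤ K)
    (hosc : ∀ r : ℝ, 0 < r → r < 1 / 2 → meanOscB A r ≤ c₀ / Real.log (1 / r) ^ 2) :
    LogDini l (‖arrayCLM d‖ * K + l)
      √(volume.real (ball (0 : EuclideanSpace ℝ (Fin d)) 1) * ‖arrayCLM d‖ * c₀ + 1)
      (extendField l A) := by
  intro c ρ hρ hρ2 hball
  set V1 := volume.real (ball (0 : EuclideanSpace ℝ (Fin d)) 1) with hV1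
  have hV10 : 0 ≤ V1 := measureReal_nonneg
  set S : Set (Fin d → Fin d → ℝ) :=
    {B | (∀ x, l * ‖x‖ ^ 2 ≤ ⟪arrayCLM d B x, x⟫) ∧ ‖B‖ ≤ K} with hS
  have hSconv : Convex ℝ S := by
    intro B hB B' hB' s t hs ht hst
    refine ⟨fun x => ?_, ?_⟩
    · simp only [map_add, map_smul, ContinuousLinearMap.add_apply, ContinuousLinearMap.smul_apply,
        inner_add_left, real_inner_smul_left]
      calc l * ‖x‖ ^ 2 = s * (l * ‖x‖ ^ 2) + t * (l * ‖x‖ ^ 2) := by rw [← add_mul, hst, one_mul]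
        _ ≤ _ := add_le_add (mul_le_mul_of_nonneg_left (hB.1 x) hs)
          (mul_le_mul_of_nonneg_left (hB'.1 x) ht)
    · calc ‖s • B + t • B'‖ ≤ s * ‖B‖ + t * ‖B'‖ := by
            refine (norm_add_le _ _).trans_eq ?_
            rw [norm_smul, norm_smul, Real.norm_of_nonneg hs, Real.norm_of_nonneg ht]
        _ ≤ s * K + t * K := add_le_add (mul_le_mul_of_nonneg_left hB.2 hs)
          (mul_le_mul_of_nonneg_left hB'.2 ht)
        _ = K := by rw [← add_mul, hst, one_mul]
  have hSclosed : IsClosed S := by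
    have : S = (⋂ x, {B | l * ‖x‖ ^ 2 ≤ ⟪arrayCLM d B x, x⟫}) ∩ {B | ‖B‖ ≤ K} := by
      ext B
      simp [hS]
    rw [this]
    refine (isClosed_iInter fun x => isClosed_le continuous_const ?_).inter
      (isClosed_le continuous_norm continuous_const)
    exact (((arrayCLM d).continuous.clm_apply continuous_const).inner continuous_const)
  have hAint : IntegrableOn A (ball c ρ) :=
    Measure.integrableOn_of_bounded measure_ball_lt_top.ne hA.aestronglyMeasurable (M := K)
      ((ae_restrict_iff' measurableSet_ball).2 (.of_forall fun x hx => hbd x (hball hx)))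
  have hmem : (⨍ x in ball c ρ, A x) ∈ S := by
    refine hSconv.set_average_mem hSclosed (measure_ball_pos _ _ hρ).ne' measure_ball_lt_top.ne
      ((ae_restrict_iff' measurableSet_ball).2 (.of_forall fun x hx => ⟨fun ξ => ?_,
        hbd x (hball hx)⟩)) hAint
    rw [inner_arrayCLM, EuclideanSpace.real_norm_sq_eq]
    exact hell x (hball hx) _
  set m := ⨍ x in ball c ρ, A x with hm
  refine ⟨arrayCLM d m, hmem.1, ?_, ?_⟩
  · refine ((arrayCLM d).le_opNorm _).trans ?_
    have := mul_le_mul_of_nonneg_left hmem.2 (norm_nonneg (arrayCLM d))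
    linarith
  have hvol : volume.real (ball c ρ) = ρ ^ Module.finrank ℝ (EuclideanSpace ℝ (Fin d)) * V1 := by
    rw [measureReal_def, Measure.addHaar_ball_of_pos _ _ hρ, ENNReal.toReal_mul,
      ENNReal.toReal_ofReal (by positivity), ← measureReal_def]
  have hV1' : 0 < volume.real (ball c ρ) :=
    ENNReal.toReal_pos (measure_ball_pos _ _ hρ).ne' measure_ball_lt_top.ne
  rw [setIntegral_ball_comp_affine c hρ fun x => ‖arrayCLM d m - extendField l A x‖, div_pow,
    Real.sq_sqrt (by positivity)]
  have h1 : ∫ x in ball c ρ, ‖arrayCLM d m - extendField l A x‖ ≤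
      ∫ x in ball c ρ, ‖arrayCLM d‖ * ‖A x - m‖ := by
    refine integral_mono_of_nonneg (.of_forall fun _ => norm_nonneg _)
      ((hAint.sub (integrableOn_const measure_ball_lt_top.ne)).norm.const_mul _)
      ((ae_restrict_iff' measurableSet_ball).2 (.of_forall fun x hx => ?_))
    simp only
    rw [extendField_of_mem l A (hball hx), ← map_sub, norm_sub_rev]
    exact (arrayCLM d).le_opNorm _
  have h2 : ∫ x in ball c ρ, ‖A x - m‖ = volume.real (ball c ρ) * ⨍ x in ball c ρ, ‖A x - m‖ := by
    rw [setAverage_eq, smul_eq_mul, mul_inv_cancel_left₀ hV1'.ne']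
  have h3 := (setAverage_le_meanOscB hK hbd hρ hball).trans (hosc ρ hρ hρ2)
  rw [integral_const_mul, h2, hvol] at h1
  calc _ ≤ (ρ ^ Module.finrank ℝ (EuclideanSpace ℝ (Fin d)))⁻¹ * (‖arrayCLM d‖ *
        (ρ ^ Module.finrank ℝ (EuclideanSpace ℝ (Fin d)) * V1 *
          ⨍ x in ball c ρ, ‖A x - m‖)) := by gcongr
    _ = V1 * ‖arrayCLM d‖ * ⨍ x in ball c ρ, ‖A x - m‖ := by
        field_simp
    _ ≤ V1 * ‖arrayCLM d‖ * (c₀ / Real.log (1 / ρ) ^ 2) := by gcongr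
    _ ≤ _ := by
        rw [← mul_div_assoc]
        gcongr
        linarith

theorem norm_gradient_sub (φ ψ : E → ℝ) (x : E) :
    ‖∇ φ x - ∇ ψ x‖ = ‖fderiv ℝ φ x - fderiv ℝ ψ x‖ := by
  rw [gradient, gradient, ← map_sub, LinearIsometryEquiv.norm_map]

theorem exists_contDiff_norm_fderiv_sub_le {w : E → ℝ} (hw : ContDiff ℝ 1 w)
    (hc : HasCompactSupport w) {U : Set E} (hU : IsOpen U) (hs : tsupport w ⊆ U) {ε : ℝ}
    (hε : 0 < ε) :
    ∃ φ : E → ℝ, ContDiff ℝ ∞ φ ∧ HasCompactSupport φ ∧ tsupport φ ⊆ U ∧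
      ∀ x, ‖fderiv ℝ φ x - fderiv ℝ w x‖ ≤ ε := by
  have hcont : Continuous (fderiv ℝ w) := hw.continuous_fderiv one_ne_zero
  obtain ⟨δ₀, hδ₀, h₀⟩ := Metric.uniformContinuous_iff.1
    ((hc.fderiv ℝ).uniformContinuous_of_continuous hcont) ε hε
  obtain ⟨δ₁, hδ₁, h₁⟩ := IsCompact.exists_cthickening_subset_open hc hU hs
  have hδ : 0 < min δ₀ δ₁ := lt_min hδ₀ hδ₁
  set χ : ContDiffBump (0 : E) := ⟨min δ₀ δ₁ / 2, min δ₀ δ₁, by positivity, half_lt_self hδ⟩ with hχ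
  refine ⟨convolution (χ.normed volume) w (ContinuousLinearMap.lsmul ℝ ℝ) volume, ?_, ?_, ?_, ?_⟩
  · exact χ.hasCompactSupport_normed.contDiff_convolution_left _ χ.contDiff_normed
      hw.continuous.locallyIntegrable
  · exact χ.hasCompactSupport_normed.convolution _ hc
  · refine subset_trans (closure_minimal ?_ isClosed_cthickening) h₁
    refine (support_convolution_subset _).trans ?_
    rw [χ.support_normed_eq]
    rintro _ ⟨y, hy, z, hz, rfl⟩
    refine mem_cthickening_of_dist_le _ z _ _ (subset_tsupport _ hz) ?_
    simp only
    rw [dist_eq_norm, add_sub_cancel_right]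
    rw [mem_ball_zero_iff] at hy
    exact hy.le.trans (min_le_right _ _)
  · intro x
    rw [(hc.hasFDerivAt_convolution_right (ContinuousLinearMap.lsmul ℝ ℝ)
      (χ.continuous_normed.locallyIntegrable) hw x).fderiv, ← dist_eq_norm]
    exact χ.dist_normed_convolution_le hcont.aestronglyMeasurable fun y hy =>
      (h₀ (hy.trans_le (min_le_left _ _))).le

theorem mem_gradSpace_of_contDiff_one {w : E → ℝ} (hw : ContDiff ℝ 1 w)
    (hc : HasCompactSupport w) (hs : tsupport w ⊆ ball 0 1)
    {V : Lp E 2 (volume : Measure E)} (hV : V =ᵐ[volume] ∇ w) : V ∈ gradSpace E := by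
  refine Metric.mem_closure_iff.2 fun ε hε => ?_
  set v := volume.real (ball (0 : E) 1) with hv
  have hv0 : 0 ≤ v := measureReal_nonneg
  obtain ⟨φ, h1, h2, h3, h4⟩ := exists_contDiff_norm_fderiv_sub_le hw hc isOpen_ball hs
    (ε := ε / (v + 1)) (by positivity)
  have hmem : MemLp (∇ φ) 2 (volume : Measure E) :=
    (continuous_gradient h1).memLp_of_hasCompactSupport h2.gradient
  refine ⟨hmem.toLp, ⟨φ, h1, h2, h3, hmem.coeFn_toLp⟩, ?_⟩
  rw [dist_comm, dist_eq_norm]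
  refine lt_of_pow_lt_pow_left₀ 2 hε.le ?_
  rw [sq_norm_Lp_two]
  have e1 : ∀ᵐ x, ‖(hmem.toLp - V : Lp E 2 (volume : Measure E)) x‖ ^ 2 ≤
      (ball (0 : E) 1).indicator (fun _ => (ε / (v + 1)) ^ 2) x := by
    filter_upwards [Lp.coeFn_sub hmem.toLp V, hmem.coeFn_toLp, hV] with x a1 a2 a3
    rw [a1, Pi.sub_apply, a2, a3, norm_gradient_sub]
    by_cases hx : x ∈ ball (0 : E) 1
    · rw [indicator_of_mem hx]
      gcongr
      exact h4 x
    · have b1 : fderiv ℝ φ x = 0 := by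
        by_contra h
        exact hx (h3 (support_fderiv_subset ℝ h))
      have b2 : fderiv ℝ w x = 0 := by
        by_contra h
        exact hx (hs (support_fderiv_subset ℝ h))
      rw [indicator_of_notMem hx, b1, b2]
      simp
  calc _ ≤ ∫ x, (ball (0 : E) 1).indicator (fun _ => (ε / (v + 1)) ^ 2) x :=
        integral_mono_of_nonneg (.of_forall fun _ => by positivity)
          ((integrable_indicator_iff measurableSet_ball).2
            (integrableOn_const measure_ball_lt_top.ne)) e1
    _ = v * (ε / (v + 1)) ^ 2 := by
        rw [integral_indicator measurableSet_ball, setIntegral_const, smul_eq_mul]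
    _ = v / (v + 1) ^ 2 * ε ^ 2 := by
        rw [div_pow]
        ring
    _ < ε ^ 2 := by
        refine mul_lt_of_lt_one_left (by positivity) ?_
        rw [div_lt_one (by positivity)]
        nlinarith

theorem ae_fderiv_eq_zero [Nontrivial E] {u : E → ℝ} {s : Set E} (hs : MeasurableSet s)
    (hu : ∀ x ∈ s, DifferentiableAt ℝ u x) (h0 : ∀ x ∈ s, u x = 0) :
    ∀ᵐ x, x ∈ s → fderiv ℝ u x = 0 := by
  obtain ⟨e, he⟩ := exists_ne (0 : E)
  have h1 : ApproximatesLinearOn (fun x => u x • e) (0 : E →L[ℝ] E) s 0 := by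
    intro x hx y hy
    simp [h0 x hx, h0 y hy]
  have h2 := h1.norm_fderiv_sub_le volume hs (fun x => (fderiv ℝ u x).smulRight e)
    fun x hx => ((hu x hx).hasFDerivAt.smul_const e).hasFDerivWithinAt
  filter_upwards [(ae_restrict_iff' hs).1 h2] with x hx hxs
  have h3 := hx hxs
  rw [sub_zero, nonpos_iff_eq_zero, nnnorm_eq_zero] at h3
  ext y
  have h4 := DFunLike.congr_fun h3 y
  simpa [he] using h4

/-- A continuous cut-off function vanishing for `n * |t| ≤ 1`. -/
noncomputable def cutOff (n : ℕ) (t : ℝ) : ℝ := max 0 (min 1 (n * |t| - 1))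

theorem continuous_cutOff (n : ℕ) : Continuous (cutOff n) := by
  unfold cutOff
  fun_prop

theorem cutOff_nonneg (n : ℕ) (t : ℝ) : 0 ≤ cutOff n t := le_max_left _ _

theorem cutOff_le_one (n : ℕ) (t : ℝ) : cutOff n t ≤ 1 :=
  max_le zero_le_one (min_le_left _ _)

theorem cutOff_eq_zero {n : ℕ} {t : ℝ} (h : n * |t| ≤ 1) : cutOff n t = 0 :=
  max_eq_left ((min_le_right _ _).trans (by linarith))

theorem tendsto_cutOff {t : ℝ} (ht : t ≠ 0) :
    Tendsto (fun n => cutOff n t) atTop (𝓝 1) := by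
  refine tendsto_const_nhds.congr' ?_
  have h := (tendsto_natCast_atTop_atTop (R := ℝ)).atTop_mul_const (abs_pos.2 ht)
  filter_upwards [h.eventually_ge_atTop 2] with n hn
  rw [cutOff, min_eq_left (by linarith), max_eq_right zero_le_one]

theorem contDiff_integral_cutOff (n : ℕ) : ContDiff ℝ 1 fun t => ∫ s in (0 : ℝ)..t, cutOff n s := by
  have h : ∀ t, HasDerivAt (fun t => ∫ s in (0 : ℝ)..t, cutOff n s) (cutOff n t) t := fun t =>
    intervalIntegral.integral_hasDerivAt_right ((continuous_cutOff n).intervalIntegrable _ _)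
      ((continuous_cutOff n).stronglyMeasurableAtFilter _ _) (continuous_cutOff n).continuousAt
  refine contDiff_one_iff_deriv.2 ⟨fun t => (h t).differentiableAt, ?_⟩
  rw [funext fun t => (h t).deriv]
  exact continuous_cutOff n

theorem integral_cutOff_eq_zero {n : ℕ} {t : ℝ} (h : n * |t| ≤ 1) :
    ∫ s in (0 : ℝ)..t, cutOff n s = 0 := by
  refine intervalIntegral.integral_zero_ae (.of_forall fun s hs => cutOff_eq_zero ?_)
  refine le_trans (mul_le_mul_of_nonneg_left ?_ n.cast_nonneg) h
  rcases le_total 0 t with ht | ht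
  · rw [uIoc_of_le ht] at hs
    rw [abs_of_pos hs.1, abs_of_nonneg ht]
    exact hs.2
  · rw [uIoc_of_ge ht] at hs
    rw [abs_of_nonpos hs.2, abs_of_nonpos ht]
    linarith [hs.1]

theorem exists_contDiff_one_cutOff {u : E → ℝ} (hu : ContinuousOn u (closedBall 0 1))
    (hu1 : ContDiffOn ℝ 1 u (ball 0 1)) (h0 : ∀ x ∈ sphere (0 : E) 1, u x = 0) {n : ℕ}
    (hn : 0 < n) :
    ∃ w : E → ℝ, ContDiff ℝ 1 w ∧ HasCompactSupport w ∧ tsupport w ⊆ ball 0 1 ∧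
      ∇ w = (ball (0 : E) 1).indicator fun x => cutOff n (u x) • ∇ u x := by
  have hn' : (0 : ℝ) < n := by exact_mod_cast hn
  set G : ℝ → ℝ := fun t => ∫ s in (0 : ℝ)..t, cutOff n s with hG
  have hGd : ∀ t, HasDerivAt G (cutOff n t) t := fun t =>
    intervalIntegral.integral_hasDerivAt_right ((continuous_cutOff n).intervalIntegrable _ _)
      ((continuous_cutOff n).stronglyMeasurableAtFilter _ _) (continuous_cutOff n).continuousAt
  set K : Set E := closedBall 0 1 ∩ u ⁻¹' {t | 1 ≤ n * |t|} with hK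
  have hKclosed : IsClosed K := hu.preimage_isClosed_of_isClosed isClosed_closedBall
    (isClosed_le continuous_const (by fun_prop))
  have hKball : K ⊆ ball 0 1 := by
    rintro x ⟨hx1, hx2⟩
    rw [mem_preimage, mem_ofPred_eq] at hx2
    by_contra hx
    rw [h0 x (mem_sphere.2 (le_antisymm hx1 (not_lt.1 hx)))] at hx2
    norm_num at hx2
  set w : E → ℝ := (ball (0 : E) 1).indicator fun x => G (u x) with hw
  have hwK : Function.support w ⊆ K := by
    intro x hx
    by_contra hxK
    refine hx ?_
    by_cases hxb : x ∈ ball (0 : E) 1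
    · rw [hw, indicator_of_mem hxb]
      refine integral_cutOff_eq_zero (le_of_not_ge fun h => hxK ⟨ball_subset_closedBall hxb, h⟩)
    · rw [hw, indicator_of_notMem hxb]
  have hts : tsupport w ⊆ K := closure_minimal hwK hKclosed
  have hball : ∀ x ∈ ball (0 : E) 1, w =ᶠ[𝓝 x] G ∘ u := fun x hx => by
    filter_upwards [isOpen_ball.mem_nhds hx] with y hy
    rw [hw, indicator_of_mem hy, Function.comp_apply]
  refine ⟨w, contDiff_iff_contDiffAt.2 fun x => ?_, ?_, hts.trans hKball, ?_⟩
  · by_cases hx : x ∈ ball (0 : E) 1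
    · exact (((contDiff_integral_cutOff n).contDiffAt).comp x
        (hu1.contDiffAt (isOpen_ball.mem_nhds hx))).congr_of_eventuallyEq (hball x hx)
    · have h1 : w =ᶠ[𝓝 x] fun _ => 0 := by
        filter_upwards [hKclosed.isOpen_compl.mem_nhds fun h => hx (hKball h)] with y hy
        by_contra h
        exact hy (hwK h)
      exact contDiffAt_const.congr_of_eventuallyEq h1
  · exact (isCompact_closedBall 0 1).of_isClosed_subset (isClosed_tsupport w)
      (hts.trans inter_subset_left)
  · funext x
    by_cases hx : x ∈ ball (0 : E) 1
    · have hux : DifferentiableAt ℝ u x :=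
        (hu1.contDiffAt (isOpen_ball.mem_nhds hx)).differentiableAt one_ne_zero
      rw [indicator_of_mem hx, gradient, gradient, (hball x hx).fderiv_eq,
        ((hGd (u x)).comp_hasFDerivAt x hux.hasFDerivAt).fderiv, map_smul]
    · rw [indicator_of_notMem hx, gradient]
      have : fderiv ℝ w x = 0 := by
        by_contra h
        exact hx (hKball (hts (support_fderiv_subset ℝ h)))
      rw [this, map_zero]

theorem ContDiffOn.continuousOn_gradient {u : E → ℝ} {s : Set E} (hs : IsOpen s)
    (hu : ContDiffOn ℝ 1 u s) : ContinuousOn (∇ u) s :=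
  (InnerProductSpace.toDual ℝ E).symm.continuous.comp_continuousOn
    (hu.continuousOn_fderiv_of_isOpen hs le_rfl)

/-- A `C¹` function in the unit ball with zero boundary values and square integrable gradient has
its gradient in the closure of the gradients of test functions. -/
theorem mem_gradSpace_of_zero_boundary [Nontrivial E] {u : E → ℝ}
    (hu : ContinuousOn u (closedBall 0 1)) (hu1 : ContDiffOn ℝ 1 u (ball 0 1))
    (h0 : ∀ x ∈ sphere (0 : E) 1, u x = 0)
    (hint : IntegrableOn (fun x => ‖∇ u x‖ ^ 2) (ball 0 1)) {V : Lp E 2 (volume : Measure E)}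
    (hV : V =ᵐ[volume] (ball (0 : E) 1).indicator (∇ u)) : V ∈ gradSpace E := by
  have hgc := hu1.continuousOn_gradient isOpen_ball
  have hmeas : AEStronglyMeasurable (∇ u) (volume.restrict (ball (0 : E) 1)) :=
    hgc.aestronglyMeasurable measurableSet_ball
  have hcm : ∀ n, AEStronglyMeasurable (fun x => cutOff n (u x))
      (volume.restrict (ball (0 : E) 1)) := fun n =>
    ((continuous_cutOff n).comp_continuousOn
      (hu.mono ball_subset_closedBall)).aestronglyMeasurable measurableSet_ball
  have hdom : ∀ n x, ‖cutOff n (u x) • ∇ u x‖ ≤ ‖∇ u x‖ := fun n x => by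
    rw [norm_smul, Real.norm_of_nonneg (cutOff_nonneg _ _)]
    exact mul_le_of_le_one_left (norm_nonneg _) (cutOff_le_one _ _)
  have hmem : ∀ n, MemLp ((ball (0 : E) 1).indicator fun x => cutOff n (u x) • ∇ u x) 2
      (volume : Measure E) := fun n => by
    rw [memLp_indicator_iff_restrict measurableSet_ball]
    exact ((memLp_two_iff_integrable_sq_norm hmeas).2 hint).mono ((hcm n).smul hmeas)
      (.of_forall (hdom n))
  have hWmem : ∀ n, (hmem (n + 1)).toLp ∈ gradSpace E := fun n => by
    obtain ⟨w, h1, h2, h3, h4⟩ := exists_contDiff_one_cutOff hu hu1 h0 n.succ_pos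
    refine mem_gradSpace_of_contDiff_one h1 h2 h3 ?_
    rw [h4]
    exact (hmem (n + 1)).coeFn_toLp
  refine (testGradients E).isClosed_topologicalClosure.mem_of_tendsto (b := atTop)
    (f := fun n => (hmem (n + 1)).toLp) ?_ (.of_forall hWmem)
  rw [tendsto_iff_norm_sub_tendsto_zero]
  have hsq : Tendsto (fun n => ‖(hmem (n + 1)).toLp - V‖ ^ 2) atTop (𝓝 0) := by
    have e1 : ∀ n, ‖(hmem (n + 1)).toLp - V‖ ^ 2 =
        ∫ x in ball (0 : E) 1, ‖cutOff (n + 1) (u x) • ∇ u x - ∇ u x‖ ^ 2 := fun n => by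
      rw [sq_norm_Lp_two, ← integral_indicator measurableSet_ball]
      refine integral_congr_ae ?_
      filter_upwards [Lp.coeFn_sub (hmem (n + 1)).toLp V, (hmem (n + 1)).coeFn_toLp, hV]
        with x a1 a2 a3
      rw [a1, Pi.sub_apply, a2, a3]
      by_cases hx : x ∈ ball (0 : E) 1
      · simp only [indicator_of_mem hx]
      · simp [indicator_of_notMem hx]
    simp only [e1]
    rw [← integral_zero E ℝ (μ := volume.restrict (ball (0 : E) 1))]
    have hz : ∀ᵐ x, x ∈ ball 0 1 ∩ (closedBall 0 1 ∩ u ⁻¹' {0}) → fderiv ℝ u x = 0 :=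
      ae_fderiv_eq_zero (measurableSet_ball.inter
        (hu.preimage_isClosed_of_isClosed isClosed_closedBall isClosed_singleton).measurableSet)
        (fun x hx => (hu1.contDiffAt (isOpen_ball.mem_nhds hx.1)).differentiableAt one_ne_zero)
        fun x hx => hx.2.2
    refine tendsto_integral_of_dominated_convergence (fun x => 4 * ‖∇ u x‖ ^ 2)
      (fun n => (((hcm (n + 1)).smul hmeas).sub hmeas).norm.pow 2) (hint.const_mul 4)
      (fun n => .of_forall fun x => ?_) ?_
    · rw [Real.norm_of_nonneg (by positivity)]
      have h1 : ‖cutOff (n + 1) (u x) • ∇ u x - ∇ u x‖ ≤ 2 * ‖∇ u x‖ :=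
        (norm_sub_le _ _).trans (by linarith [hdom (n + 1) x])
      calc _ ≤ (2 * ‖∇ u x‖) ^ 2 := by gcongr
        _ = _ := by ring
    · refine (ae_restrict_iff' measurableSet_ball).2 ?_
      filter_upwards [hz] with x hx hxb
      by_cases hux : u x = 0
      · have h1 : ∇ u x = 0 := by
          rw [gradient, hx ⟨hxb, ball_subset_closedBall hxb, hux⟩, map_zero]
        simp [h1]
      · have h1 := ((((tendsto_cutOff hux).comp (tendsto_add_atTop_nat 1)).smul_const
          (∇ u x)).sub_const (∇ u x)).norm.pow 2
        simpa using h1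
  have h2 := (Real.continuous_sqrt.tendsto 0).comp hsq
  simpa [Function.comp_def] using h2

theorem ofLp_gradient {d : ℕ} (u : EuclideanSpace ℝ (Fin d) → ℝ) (x : EuclideanSpace ℝ (Fin d)) :
    (∇ u x).ofLp = grad u x := by
  funext i
  rw [grad, ← inner_gradient_left, EuclideanSpace.inner_single_right]
  simp

/-- The weak formulation for test functions extends to the closure of their gradients. -/
theorem inner_mulOp_eq_of_weak_solution {d : ℕ} {l L : ℝ}
    {A : EuclideanSpace ℝ (Fin d) → Fin d → Fin d → ℝ} (ha : IsEllipticField l L (extendField l A))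
    {f : EuclideanSpace ℝ (Fin d) → EuclideanSpace ℝ (Fin d)} (hf : MemLp f 2)
    {u : EuclideanSpace ℝ (Fin d) → ℝ}
    (hu : ∀ φ : EuclideanSpace ℝ (Fin d) → ℝ, ContDiff ℝ ∞ φ → HasCompactSupport φ →
      tsupport φ ⊆ ball (0 : EuclideanSpace ℝ (Fin d)) 1 →
      ∫ x in ball (0 : EuclideanSpace ℝ (Fin d)) 1, (Matrix.of (A x) *ᵥ grad u x) ⬝ᵥ grad φ x
        = ∫ x in ball (0 : EuclideanSpace ℝ (Fin d)) 1, (f x).ofLp ⬝ᵥ grad φ x)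
    {V : Lp (EuclideanSpace ℝ (Fin d)) 2 (volume : Measure (EuclideanSpace ℝ (Fin d)))}
    (hV : V =ᵐ[volume] (ball (0 : EuclideanSpace ℝ (Fin d)) 1).indicator (∇ u)) :
    ∀ w ∈ gradSpace (EuclideanSpace ℝ (Fin d)), ⟪ha.mulOp V, w⟫ = ∫ x, ⟪f x, w x⟫ := by
  have hclosed : IsClosed {w | ⟪ha.mulOp V, w⟫ = ⟪hf.toLp, w⟫} :=
    isClosed_eq (continuous_const.inner continuous_id) (continuous_const.inner continuous_id)
  have hF : ∀ w : Lp (EuclideanSpace ℝ (Fin d)) 2 (volume : Measure (EuclideanSpace ℝ (Fin d))),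
      ⟪hf.toLp, w⟫ = ∫ x, ⟪f x, w x⟫ := fun w => by
    rw [L2.inner_def]
    refine integral_congr_ae ?_
    filter_upwards [hf.coeFn_toLp] with x hx
    rw [hx]
  refine fun w hw => (closure_minimal ?_ hclosed hw : ⟪ha.mulOp V, w⟫ = _).trans (hF w)
  rintro g ⟨φ, h1, h2, h3, h4⟩
  have hzero : ∀ x, x ∉ ball (0 : EuclideanSpace ℝ (Fin d)) 1 → ∇ φ x = 0 := fun x hx => by
    have : fderiv ℝ φ x = 0 := by
      by_contra h
      exact hx (h3 (support_fderiv_subset ℝ h))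
    rw [gradient, this, map_zero]
  rw [mem_ofPred_eq, hF, ha.inner_mulOp]
  have e1 : ∫ x, ⟪extendField l A x (V x), g x⟫ =
      ∫ x in ball (0 : EuclideanSpace ℝ (Fin d)) 1,
        (Matrix.of (A x) *ᵥ grad u x) ⬝ᵥ grad φ x := by
    rw [← integral_indicator measurableSet_ball]
    refine integral_congr_ae ?_
    filter_upwards [hV, h4] with x a1 a2
    rw [a1, a2]
    by_cases hx : x ∈ ball (0 : EuclideanSpace ℝ (Fin d)) 1
    · rw [indicator_of_mem hx, indicator_of_mem hx, extendField_of_mem l A hx, inner_arrayCLM,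
        ofLp_gradient, ofLp_gradient]
    · rw [hzero x hx, inner_zero_right, indicator_of_notMem hx]
  have e2 : ∫ x, ⟪f x, g x⟫ =
      ∫ x in ball (0 : EuclideanSpace ℝ (Fin d)) 1, (f x).ofLp ⬝ᵥ grad φ x := by
    rw [← integral_indicator measurableSet_ball]
    refine integral_congr_ae ?_
    filter_upwards [h4] with x a2
    rw [a2]
    by_cases hx : x ∈ ball (0 : EuclideanSpace ℝ (Fin d)) 1
    · rw [indicator_of_mem hx, EuclideanSpace.inner_eq_star_dotProduct, ofLp_gradient,
        dotProduct_comm]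
      simp
    · rw [hzero x hx, inner_zero_right, indicator_of_notMem hx]
  rw [e1, e2]
  exact hu φ h1 h2 h3

end Work

/-- Weak type-(1,1) estimate for the divergence form operator with coefficients `A` whose mean
oscillation satisfies `ω_A(r) ≤ c₀ (ln(1/r))⁻²`: for `f` supported in `B(0,1/3)` and `u` the
solution of `div(A∇u) = div f` in `B = B(0,1)` with `u = 0` on `∂B`,
`|{x ∈ B : |∇u(x)| > α}| ≤ (C/α) ∫_B |f|`, `C = C(d,λ,Λ,c₀)`. -/
theorem weak11_div_log_dini
    (d : ℕ) (hd : 1 ≤ d) (lam Lam c₀ : ℝ) (hlam : 0 < lam) (hLam : 0 < Lam) (hc₀ : 0 < c₀) :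
    ∃ C : ℝ, 0 < C ∧
      ∀ A : EuclideanSpace ℝ (Fin d) → Fin d → Fin d → ℝ, Measurable A →
        (∀ x ∈ ball (0 : EuclideanSpace ℝ (Fin d)) 1, ∀ ξ : Fin d → ℝ,
          lam * ∑ i, ξ i ^ 2 ≤ (Matrix.of (A x) *ᵥ ξ) ⬝ᵥ ξ) →
        (∀ x ∈ ball (0 : EuclideanSpace ℝ (Fin d)) 1, ∑ i, ∑ j, (A x i j) ^ 2 ≤ Lam ^ 2) →
        (∀ r : ℝ, 0 < r → r < 1/2 → meanOscB A r ≤ c₀ / (Real.log (1/r)) ^ 2) →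
      ∀ f : EuclideanSpace ℝ (Fin d) → Fin d → ℝ, ContDiff ℝ (⊤ : ℕ∞) f →
        Function.support f ⊆ ball (0 : EuclideanSpace ℝ (Fin d)) (1/3) →
      ∀ u : EuclideanSpace ℝ (Fin d) → ℝ,
        ContinuousOn u (closedBall (0 : EuclideanSpace ℝ (Fin d)) 1) →
        ContDiffOn ℝ 1 u (ball (0 : EuclideanSpace ℝ (Fin d)) 1) →
        (∀ x ∈ sphere (0 : EuclideanSpace ℝ (Fin d)) 1, u x = 0) →
        IntegrableOn (fun x => ‖fderiv ℝ u x‖ ^ 2) (ball (0 : EuclideanSpace ℝ (Fin d)) 1) →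
        (∀ φ : EuclideanSpace ℝ (Fin d) → ℝ, ContDiff ℝ (⊤ : ℕ∞) φ → HasCompactSupport φ →
          tsupport φ ⊆ ball (0 : EuclideanSpace ℝ (Fin d)) 1 →
          ∫ x in ball (0 : EuclideanSpace ℝ (Fin d)) 1,
              (Matrix.of (A x) *ᵥ grad u x) ⬝ᵥ grad φ x
            = ∫ x in ball (0 : EuclideanSpace ℝ (Fin d)) 1, f x ⬝ᵥ grad φ x) →
      ∀ α : ℝ, 0 < α →
        volume {x ∈ ball (0 : EuclideanSpace ℝ (Fin d)) 1 | α < ‖fderiv ℝ u x‖}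
          ≤ ENNReal.ofReal (C / α * ∫ x in ball (0 : EuclideanSpace ℝ (Fin d)) 1, ‖f x‖) := by
  have : NeZero d := ⟨by omega⟩
  set e := (EuclideanSpace.equiv (Fin d) ℝ).symm with he
  set K : ℝ := ‖(e : (Fin d → ℝ) →L[ℝ] EuclideanSpace ℝ (Fin d))‖ with hK
  have hK0 : 0 ≤ K := norm_nonneg _
  obtain ⟨C, hC, H⟩ := exists_weak_type_bound d hd hlam
    (L := ‖arrayCLM d‖ * Lam + lam) (by positivity)
    (κ := √(volume.real (ball (0 : EuclideanSpace ℝ (Fin d)) 1) * ‖arrayCLM d‖ * c₀ + 1))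
    (by positivity)
  refine ⟨C * (K + 1), by positivity, ?_⟩
  intro A hA hell hbd hosc f hf hsupp u hu hu1 h0 hint hweak α hα
  have hbd' : ∀ x ∈ ball (0 : EuclideanSpace ℝ (Fin d)) 1, ‖A x‖ ≤ Lam := fun x hx =>
    norm_array_le hLam.le (hbd x hx)
  have ha := isEllipticField_extendField hlam hLam.le hA hell hbd'
  have hlog := logDini_extendField hlam hLam.le hc₀ hA hell hbd' hosc
  set F : EuclideanSpace ℝ (Fin d) → EuclideanSpace ℝ (Fin d) := fun x => e (f x) with hFdef
  have hFc : Continuous F := e.continuous.comp hf.continuous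
  have hFs : Function.support F ⊆ ball 0 (1 / 3) := fun x hx => hsupp fun h => hx (by
    simp [hFdef, h])
  have hFcs : HasCompactSupport F :=
    (isCompact_closedBall 0 (1 / 3)).of_isClosed_subset (isClosed_tsupport F)
      (closure_minimal (hFs.trans ball_subset_closedBall) isClosed_closedBall)
  have hfcs : HasCompactSupport f :=
    (isCompact_closedBall 0 (1 / 3)).of_isClosed_subset (isClosed_tsupport f)
      (closure_minimal (hsupp.trans ball_subset_closedBall) isClosed_closedBall)
  have hmeas : AEStronglyMeasurable (gradient u)
      (volume.restrict (ball (0 : EuclideanSpace ℝ (Fin d)) 1)) :=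
    (hu1.continuousOn_gradient isOpen_ball).aestronglyMeasurable measurableSet_ball
  have hint' : IntegrableOn (fun x => ‖gradient u x‖ ^ 2)
      (ball (0 : EuclideanSpace ℝ (Fin d)) 1) := by
    simpa only [norm_gradient] using hint
  have hmem : MemLp ((ball (0 : EuclideanSpace ℝ (Fin d)) 1).indicator (gradient u)) 2 := by
    rw [memLp_indicator_iff_restrict measurableSet_ball]
    exact (memLp_two_iff_integrable_sq_norm hmeas).2 hint'
  have hV := mem_gradSpace_of_zero_boundary hu hu1 h0 hint' hmem.coeFn_toLp
  have hsol := inner_mulOp_eq_of_weak_solution ha (hFc.memLp_of_hasCompactSupport hFcs) hweak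
    hmem.coeFn_toLp
  have hmain := H _ ha hlog F hFc hFs _ hV hsol α hα
  have hset : volume {x ∈ ball (0 : EuclideanSpace ℝ (Fin d)) 1 | α < ‖fderiv ℝ u x‖} =
      volume {x ∈ ball (0 : EuclideanSpace ℝ (Fin d)) 1 | α <
        ‖(hmem.toLp : EuclideanSpace ℝ (Fin d) → EuclideanSpace ℝ (Fin d)) x‖} := by
    refine measure_congr ?_
    filter_upwards [hmem.coeFn_toLp] with x hx
    refine propext (and_congr_right fun hxb => ?_)
    rw [hx, indicator_of_mem hxb, norm_gradient]
  rw [hset]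
  refine hmain.trans (ENNReal.ofReal_le_ofReal ?_)
  have hFI : ∫ x, ‖F x‖ ≤ (K + 1) * ∫ x in ball (0 : EuclideanSpace ℝ (Fin d)) 1, ‖f x‖ := by
    have h1 : ∫ x in ball (0 : EuclideanSpace ℝ (Fin d)) 1, ‖F x‖ = ∫ x, ‖F x‖ :=
      setIntegral_eq_integral_of_forall_compl_eq_zero fun x hx => by
        rw [norm_eq_zero]
        by_contra h
        exact hx (ball_subset_ball (by norm_num) (hFs h))
    rw [← h1, ← integral_const_mul]
    refine integral_mono (hFc.integrable_of_hasCompactSupport hFcs).norm.integrableOn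
      ((hf.continuous.integrable_of_hasCompactSupport hfcs).norm.const_mul _).integrableOn
      fun x => ?_
    refine ((e : (Fin d → ℝ) →L[ℝ] EuclideanSpace ℝ (Fin d)).le_opNorm (f x)).trans ?_
    gcongr
    linarith
  calc C / α * ∫ x, ‖F x‖ ≤ C / α *
        ((K + 1) * ∫ x in ball (0 : EuclideanSpace ℝ (Fin d)) 1, ‖f x‖) := by gcongr
    _ = _ := by ring
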